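/- Let S ⊂ M₂(ℂ) ≅ ℂ⁴ be a continuum of finite one-dimensional Hausdorff measure each of whose points is a rank-one idempotent matrix. Then every rank one complex topological vector bundle (complex line bundle) over the polynomially convex hull Ŝ of S is trivial. -/

import Mathlib

/-! Complex line bundles. -/

/-- A rank one complex topological vector bundle (complex line bundle) over `X`. -/
structure LineBundle (X : Type) [TopologicalSpace X] where
  E : X → Type
  [tE : ∀ x, TopologicalSpace (E x)]
  [aE : ∀ x, AddCommGroup (E x)]
  [mE : ∀ x, Module ℂ (E x)]
  [tT : TopologicalSpace (Bundle.TotalSpace ℂ E)]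
  [fb : FiberBundle ℂ E]
  [vb : VectorBundle ℂ ℂ E]

attribute [instance] LineBundle.tE LineBundle.aE LineBundle.mE LineBundle.tT
  LineBundle.fb LineBundle.vb

variable {X : Type} [TopologicalSpace X]

/-- Isomorphism of complex line bundles over `X`: a fiberwise `ℂ`-linear equivalence
which is a homeomorphism of total spaces. -/
def LineBundle.Iso (L₁ L₂ : LineBundle X) : Prop :=
  ∃ e : ∀ x, L₁.E x ≃ₗ[ℂ] L₂.E x,
    Continuous (fun p : Bundle.TotalSpace ℂ L₁.E =>
      (⟨p.proj, e p.proj p.snd⟩ : Bundle.TotalSpace ℂ L₂.E)) ∧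
    Continuous (fun p : Bundle.TotalSpace ℂ L₂.E =>
      (⟨p.proj, (e p.proj).symm p.snd⟩ : Bundle.TotalSpace ℂ L₁.E))

/-- The trivial complex line bundle `X × ℂ`. -/
noncomputable def trivialLineBundle (X : Type) [TopologicalSpace X] : LineBundle X where
  E := Bundle.Trivial X ℂ

/-- A line bundle is trivial if it is isomorphic to the product bundle `X × ℂ`. -/
def LineBundle.IsTrivial (L : LineBundle X) : Prop := L.Iso (trivialLineBundle X)

/-- The set `Vect₁(X)` of isomorphism classes of complex line bundles over `X`. -/
def Vect1 (X : Type) [TopologicalSpace X] := Quot (LineBundle.Iso (X := X))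

open MeasureTheory

noncomputable instance (n : ℕ) : MeasurableSpace (EuclideanSpace ℂ (Fin n)) := borel _
instance (n : ℕ) : BorelSpace (EuclideanSpace ℂ (Fin n)) := ⟨rfl⟩

/-- The polynomially convex hull of a bounded set `K ⊂ ℂⁿ`: all points at which every
polynomial in `n` complex variables is bounded by its supremum over `K`. -/
def polyHull {n : ℕ} (K : Set (EuclideanSpace ℂ (Fin n))) : Set (EuclideanSpace ℂ (Fin n)) :=
  {z | ∀ p : MvPolynomial (Fin n) ℂ,
    ‖MvPolynomial.eval (fun i => z i) p‖ ≤
      sSup ((fun w => ‖MvPolynomial.eval (fun i => w i) p‖) '' K)}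

/-- The `2×2` complex matrix corresponding to a point of `ℂ⁴`
(`(z₁,z₂,z₃,z₄) ↦ [[z₁,z₂],[z₃,z₄]]`). -/
noncomputable def toMat (z : EuclideanSpace ℂ (Fin 4)) : Matrix (Fin 2) (Fin 2) ℂ :=
  !![z 0, z 1; z 2, z 3]

/-- The point `z ∈ ℂ⁴` corresponds to a rank-one idempotent `2×2` matrix. -/
def IsRankOneIdem (z : EuclideanSpace ℂ (Fin 4)) : Prop :=
  toMat z * toMat z = toMat z ∧ (toMat z).rank = 1

open Set Filter Topology Metric
open scoped NNReal ENNReal CompactlySupported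

theorem exists_covering_walk {E : Type*} [DecidableEq E] (N : Finset E) (r : E → E → Prop)
    (hsymm : ∀ x y, r x y → r y x)
    (hconn : ∀ A ⊆ N, A.Nonempty → A ≠ N → ∃ u ∈ A, ∃ v ∈ N, v ∉ A ∧ r u v) (hN : N.Nonempty) :
    ∃ l : List E, l ≠ [] ∧ l.IsChain r ∧ l.toFinset = N ∧ l.length ≤ 2 * N.card := by
  have key : ∀ k : ℕ, 1 ≤ k → k ≤ N.card → ∃ l : List E, l ≠ [] ∧ l.IsChain r ∧
      l.toFinset ⊆ N ∧ k ≤ l.toFinset.card ∧ l.length ≤ 2 * k := by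
    intro k hk
    induction k, hk using Nat.le_induction with
    | base =>
      intro _
      obtain ⟨x, hx⟩ := hN
      exact ⟨[x], by simp, by simp, by simpa using hx, by simp, by simp⟩
    | succ k hk ih =>
      intro hkN
      obtain ⟨l, hl0, hlc, hlN, hlk, hll⟩ := ih (by omega)
      by_cases hc : k + 1 ≤ l.toFinset.card
      · exact ⟨l, hl0, hlc, hlN, hc, by omega⟩
      obtain ⟨u, hu, v, hv, hvl, huv⟩ := hconn l.toFinset hlN
        (by simpa [List.toFinset_nonempty_iff] using hl0)
        (by intro h; rw [h] at hc; omega)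
      obtain ⟨l₁, l₂, rfl⟩ := List.append_of_mem (List.mem_toFinset.1 hu)
      refine ⟨l₁ ++ u :: v :: u :: l₂, by simp, ?_, ?_, ?_, ?_⟩
      · rw [List.isChain_split] at hlc ⊢
        refine ⟨hlc.1, ?_⟩
        simp only [List.isChain_cons_cons]
        exact ⟨huv, hsymm _ _ huv, hlc.2⟩
      · intro x hx
        simp only [List.mem_toFinset, List.mem_append, List.mem_cons] at hx
        by_cases hxv : x = v
        · rwa [hxv]
        · apply hlN
          simp only [List.mem_toFinset, List.mem_append, List.mem_cons]
          tauto
      · have : insert v (l₁ ++ u :: l₂).toFinset ⊆ (l₁ ++ u :: v :: u :: l₂).toFinset := by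
          intro x hx
          simp only [Finset.mem_insert, List.mem_toFinset, List.mem_append, List.mem_cons] at hx ⊢
          tauto
        have h2 := Finset.card_le_card this
        rw [Finset.card_insert_of_notMem hvl] at h2
        omega
      · simp only [List.length_append, List.length_cons] at hll ⊢
        omega
  obtain ⟨l, h0, hc, hN', hk, hl⟩ := key N.card (Finset.card_pos.2 hN) le_rfl
  exact ⟨l, h0, hc, Finset.eq_of_subset_of_card_le hN' hk, hl⟩

theorem dist_getD_le_of_isChain {E : Type*} [MetricSpace E] {l : List E} {δ : ℝ}
    (h : l.IsChain fun x y => dist x y ≤ δ) (x₀ : E) {i j : ℕ} (hj : j < l.length) (hij : i ≤ j) :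
    dist (l.getD i x₀) (l.getD j x₀) ≤ δ * (j - i : ℝ) := by
  induction j, hij using Nat.le_induction with
  | base => simp
  | succ j hij ih =>
    have h1 := ih (by omega)
    have h2 : dist (l.getD j x₀) (l.getD (j + 1) x₀) ≤ δ := by
      rw [List.getD_eq_getElem _ _ (by omega), List.getD_eq_getElem _ _ hj]
      exact List.isChain_iff_getElem.1 h j hj
    push_cast
    linarith [dist_triangle (l.getD i x₀) (l.getD j x₀) (l.getD (j + 1) x₀)]

theorem le_hausdorffMeasure_ball_inter {E : Type*} [MetricSpace E] [MeasurableSpace E]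
    [BorelSpace E] {S : Set E} (hS : IsPreconnected S) {x y : E} (hx : x ∈ S) (hy : y ∈ S) {ρ : ℝ}
    (hxy : ρ ≤ dist x y) : ENNReal.ofReal ρ ≤ μH[1] (S ∩ ball x ρ) := by
  have hL : LipschitzWith 1 (fun z : E => dist x z) := LipschitzWith.dist_right x
  have h1 := hL.hausdorffMeasure_image_le (d := 1) (by norm_num) (S ∩ ball x ρ)
  have h2 : Ico 0 ρ ⊆ (fun z : E => dist x z) '' (S ∩ ball x ρ) := by
    intro t ht
    have := (hS.image (fun z : E => dist x z) hL.continuous.continuousOn).Icc_subset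
      (mem_image_of_mem _ hx) (mem_image_of_mem _ hy)
    obtain ⟨z, hz, hzt⟩ := this ⟨by simpa using ht.1, by simpa using (ht.2.le.trans hxy)⟩
    refine ⟨z, ⟨hz, ?_⟩, hzt⟩
    simp only [mem_ball, dist_comm z x]
    simp only at hzt
    rw [hzt]; exact ht.2
  have h3 : μH[1] (Ico 0 ρ) = ENNReal.ofReal ρ := by
    rw [hausdorffMeasure_real, Real.volume_Ico, sub_zero]
  calc ENNReal.ofReal ρ = μH[1] (Ico 0 ρ) := h3.symm
    _ ≤ _ := measure_mono h2
    _ ≤ _ := by simpa using h1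

theorem exists_discrete_parametrization {E : Type*} [MetricSpace E] [MeasurableSpace E]
    [BorelSpace E] {S : Set E} (hc : IsCompact S) (hS : IsConnected S) (hl : μH[1] S < ⊤)
    (hnt : S.Nontrivial) :
    ∃ ε₀ > 0, ∀ ε > 0, ε < ε₀ → ∃ g : ℝ → E, (∀ s, g s ∈ S) ∧
      (∀ s t, dist (g s) (g t) ≤ 8 * (μH[1] S).toReal * |s - t| + 2 * ε) ∧
      ∀ y ∈ S, ∃ s ∈ Icc (0 : ℝ) 1, dist (g s) y ≤ ε := by
  classical
  obtain ⟨a, ha, b, hb, hab⟩ := hnt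
  refine ⟨dist a b, dist_pos.2 hab, fun ε hε hεd => ?_⟩
  set ℓ := (μH[1] S).toReal with hℓ
  have far : ∀ x : E, ∃ y ∈ S, ε / 2 ≤ dist x y := by
    intro x
    by_contra! hcon
    have := dist_triangle_left a b x
    linarith [hcon a ha, hcon b hb]
  set P : ℕ → Prop := fun k => ∃ N : Finset E, (N : Set E) ⊆ S ∧
    (∀ x ∈ N, ∀ y ∈ N, x ≠ y → ε ≤ dist x y) ∧ N.card = k with hP
  have hcard : ∀ k, P k → k * (ε / 2) ≤ ℓ := by
    rintro k ⟨N, hNS, hsep, rfl⟩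
    have hdis : (N : Set E).PairwiseDisjoint fun x => S ∩ ball x (ε / 2) := by
      intro x hx y hy hxy
      refine (Metric.ball_disjoint_ball ?_).mono inter_subset_right inter_subset_right
      linarith [hsep x hx y hy hxy]
    have hmeas : ∀ x ∈ N, MeasurableSet (S ∩ ball x (ε / 2)) := fun x _ =>
      hc.isClosed.measurableSet.inter measurableSet_ball
    have h1 : ∑ x ∈ N, μH[1] (S ∩ ball x (ε / 2)) ≤ μH[1] S := by
      rw [← measure_biUnion_finset hdis hmeas]
      exact measure_mono (iUnion₂_subset fun x _ => inter_subset_left)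
    have h2 : ∑ x ∈ N, ENNReal.ofReal (ε / 2) ≤ ∑ x ∈ N, μH[1] (S ∩ ball x (ε / 2)) := by
      refine Finset.sum_le_sum fun x hx => ?_
      obtain ⟨y, hy, hxy⟩ := far x
      exact le_hausdorffMeasure_ball_inter hS.isPreconnected (hNS hx) hy hxy
    have h3 := ENNReal.toReal_mono hl.ne (h2.trans h1)
    simpa [ENNReal.toReal_ofReal (by positivity : 0 ≤ ε / 2)] using h3
  have hbdd : ∀ k, P k → k ≤ ⌈ℓ / (ε / 2)⌉₊ := by
    intro k hk
    have : (k : ℝ) ≤ ℓ / (ε / 2) := (le_div_iff₀ (by positivity)).2 (hcard k hk)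
    exact_mod_cast this.trans (Nat.le_ceil _)
  have hP0 : P 0 := ⟨∅, by simp, by simp, by simp⟩
  have hPn := Nat.findGreatest_spec (P := P) (Nat.zero_le ⌈ℓ / (ε / 2)⌉₊) hP0
  set n := Nat.findGreatest P ⌈ℓ / (ε / 2)⌉₊ with hn
  have hmax : ¬ P (n + 1) := fun h => by
    have := Nat.le_findGreatest (hbdd _ h) h
    omega
  have hcn := hcard n hPn
  obtain ⟨N, hNS, hsep, hNn⟩ := hPn
  have hnet : ∀ y ∈ S, ∃ x ∈ N, dist x y < ε := by
    intro y hy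
    by_contra! hcon
    apply hmax
    have hyN : y ∉ N := fun h => by
      have := hcon y h
      rw [dist_self] at this; linarith
    refine ⟨insert y N, ?_, ?_, by rw [Finset.card_insert_of_notMem hyN, hNn]⟩
    · intro z hz
      rcases Finset.mem_insert.1 (Finset.mem_coe.1 hz) with rfl | hz
      · exact hy
      · exact hNS hz
    · intro x hx z hz hxz
      rcases Finset.mem_insert.1 hx with hx | hx <;> rcases Finset.mem_insert.1 hz with hz | hz
      · exact absurd (hx.trans hz.symm) hxz
      · rw [hx, dist_comm]; exact hcon z hz
      · rw [hz]; exact hcon x hx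
      · exact hsep x hx z hz hxz
  obtain ⟨x₀, hx₀, -⟩ := hnet a ha
  obtain ⟨l, hl0, hlc, hlN, hll⟩ := exists_covering_walk N (fun x y => dist x y ≤ 2 * ε)
    (fun x y h => by rwa [dist_comm]) (by
      intro A hAN hA hAne
      have hso := hS.isPreconnected (⋃ x ∈ A, ball x ε) (⋃ x ∈ N \ A, ball x ε)
        (isOpen_biUnion fun _ _ => isOpen_ball) (isOpen_biUnion fun _ _ => isOpen_ball) (by
          intro y hy
          obtain ⟨x, hx, hxy⟩ := hnet y hy
          rw [dist_comm] at hxy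
          by_cases hxA : x ∈ A
          · exact Or.inl (mem_biUnion (show x ∈ (A : Set E) from hxA) hxy)
          · exact Or.inr (mem_iUnion₂.2 ⟨x, Finset.mem_sdiff.2 ⟨hx, hxA⟩, hxy⟩))
        (by
          obtain ⟨x, hx⟩ := hA
          exact ⟨x, hNS (hAN hx), mem_iUnion₂.2 ⟨x, hx, mem_ball_self hε⟩⟩)
        (by
          obtain ⟨x, hx⟩ := Finset.sdiff_nonempty.2 (fun h => hAne (hAN.antisymm h))
          exact ⟨x, hNS (Finset.mem_sdiff.1 hx).1, mem_iUnion₂.2 ⟨x, hx, mem_ball_self hε⟩⟩)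
      obtain ⟨y, -, hy1, hy2⟩ := hso
      obtain ⟨u, hu, huy⟩ := mem_iUnion₂.1 hy1
      obtain ⟨v, hv, hvy⟩ := mem_iUnion₂.1 hy2
      refine ⟨u, hu, v, (Finset.mem_sdiff.1 hv).1, (Finset.mem_sdiff.1 hv).2, ?_⟩
      have := dist_triangle_left u v y
      rw [mem_ball] at huy hvy
      linarith) ⟨x₀, hx₀⟩
  set m := l.length - 1 with hm
  have hlpos : 0 < l.length := List.length_pos_iff.2 hl0
  have hmε : 2 * ε * m ≤ 8 * ℓ := by
    have h1 : (m : ℝ) ≤ 2 * n := by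
      have : m ≤ 2 * n := by rw [← hNn]; omega
      exact_mod_cast this
    nlinarith
  refine ⟨fun s => l.getD (min m ⌊s * m⌋₊) x₀, fun s => ?_, fun s t => ?_, fun y hy => ?_⟩
  · have : min m ⌊s * m⌋₊ < l.length := by omega
    simp only
    rw [List.getD_eq_getElem _ _ this]
    apply hNS
    rw [← hlN]
    simp
  · have aux : ∀ s t : ℝ, s ≤ t → dist (l.getD (min m ⌊s * m⌋₊) x₀) (l.getD (min m ⌊t * m⌋₊) x₀) ≤
        8 * ℓ * |s - t| + 2 * ε := by
      intro s t hst
      have hmono : ⌊s * m⌋₊ ≤ ⌊t * m⌋₊ :=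
        Nat.floor_mono (mul_le_mul_of_nonneg_right hst (Nat.cast_nonneg _))
      have h1 := dist_getD_le_of_isChain hlc x₀
        (i := min m ⌊s * m⌋₊) (j := min m ⌊t * m⌋₊) (by omega) (by omega)
      have h2 : ((min m ⌊t * m⌋₊ : ℕ) : ℝ) - (min m ⌊s * m⌋₊ : ℕ) ≤ (t - s) * m + 1 := by
        have h3 : ((min m ⌊t * m⌋₊ : ℕ) : ℝ) - (min m ⌊s * m⌋₊ : ℕ) ≤ ⌊t * m⌋₊ - ⌊s * m⌋₊ := by
          have : (min m ⌊t * m⌋₊) + ⌊s * m⌋₊ ≤ ⌊t * m⌋₊ + (min m ⌊s * m⌋₊) := by omega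
          have : ((min m ⌊t * m⌋₊ : ℕ) : ℝ) + ⌊s * m⌋₊ ≤ ⌊t * m⌋₊ + (min m ⌊s * m⌋₊ : ℕ) := by
            exact_mod_cast this
          linarith
        have h4 := Nat.lt_floor_add_one (s * m)
        by_cases ht : 0 ≤ t
        · have h5 := Nat.floor_le (mul_nonneg ht (Nat.cast_nonneg m))
          nlinarith
        · have : t * m ≤ 0 := mul_nonpos_of_nonpos_of_nonneg (by linarith) (Nat.cast_nonneg _)
          rw [Nat.floor_of_nonpos this] at h3 hmono
          have h6 : (0:ℝ) ≤ (t - s) * m := mul_nonneg (by linarith) (Nat.cast_nonneg _)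
          have h7 : (0:ℝ) ≤ (⌊s * m⌋₊ : ℝ) := Nat.cast_nonneg _
          push_cast at h3 ⊢
          rw [Nat.floor_of_nonpos this]
          push_cast
          linarith
      rw [abs_sub_comm, abs_of_nonneg (by linarith : 0 ≤ t - s)]
      have h5 := mul_le_mul_of_nonneg_left h2 (by positivity : 0 ≤ 2 * ε)
      have h6 := mul_le_mul_of_nonneg_right hmε (by linarith : 0 ≤ t - s)
      linarith
    rcases le_total s t with h | h
    · exact aux s t h
    · rw [dist_comm, abs_sub_comm]; exact aux t s h
  · obtain ⟨x, hx, hxy⟩ := hnet y hy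
    rw [← hlN, List.mem_toFinset] at hx
    obtain ⟨i, hi, rfl⟩ := List.getElem_of_mem hx
    rcases Nat.eq_zero_or_pos m with hm0 | hm0
    · refine ⟨0, by simp, ?_⟩
      have : i = 0 := by omega
      subst this
      simp only [hm0, zero_le, inf_of_le_left]
      rw [List.getD_eq_getElem _ _ hi]
      exact hxy.le
    · have hm0' : (0:ℝ) < m := by exact_mod_cast hm0
      refine ⟨i / m, ⟨by positivity, ?_⟩, ?_⟩
      · rw [div_le_one hm0']
        exact_mod_cast (by omega : i ≤ m)
      · have : min m ⌊(i / m : ℝ) * m⌋₊ = i := by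
          rw [div_mul_cancel₀ _ hm0'.ne', Nat.floor_natCast]; omega
        simp only [this]
        rw [List.getD_eq_getElem _ _ hi]
        exact hxy.le

/-- A continuum of finite length is a Lipschitz image of an interval. -/
theorem IsCompact.exists_lipschitz_parametrization {E : Type*} [MetricSpace E] [MeasurableSpace E]
    [BorelSpace E] {S : Set E} (hc : IsCompact S) (hS : IsConnected S) (hl : μH[1] S < ⊤) :
    ∃ (C : ℝ≥0) (γ : ℝ → E), LipschitzWith C γ ∧ γ '' Icc 0 1 = S ∧ ∀ s, γ s ∈ S := by
  rcases S.subsingleton_or_nontrivial with hsub | hnt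
  · obtain ⟨x, hx⟩ := hS.nonempty
    refine ⟨0, fun _ => x, LipschitzWith.const x, ?_, fun _ => hx⟩
    rw [Nonempty.image_const ⟨0, by simp⟩]
    exact (hsub.eq_singleton_of_mem hx).symm
  obtain ⟨ε₀, hε₀, H⟩ := exists_discrete_parametrization hc hS hl hnt
  have H' : ∀ n : ℕ, ∃ g : ℝ → E, (∀ s, g s ∈ S) ∧
      (∀ s t, dist (g s) (g t) ≤ 8 * (μH[1] S).toReal * |s - t| + 2 * (ε₀ / (n + 2))) ∧
      ∀ y ∈ S, ∃ s ∈ Icc (0 : ℝ) 1, dist (g s) y ≤ ε₀ / (n + 2) := fun n =>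
    H _ (by positivity) (by
      rw [div_lt_iff₀ (by positivity)]
      nlinarith [(Nat.cast_nonneg n : (0:ℝ) ≤ n)])
  choose g hgS hg1 hg2 using H'
  set U : Ultrafilter ℕ := hyperfilter ℕ
  have hU : (U : Filter ℕ) ≤ atTop := Nat.hyperfilter_le_atTop
  have hε : Tendsto (fun n : ℕ => ε₀ / ((n : ℝ) + 2)) U (𝓝 0) :=
    (tendsto_const_nhds.div_atTop (tendsto_atTop_add_const_right _ _
      tendsto_natCast_atTop_atTop)).mono_left hU
  have hlim : ∀ s, ∃ x ∈ S, Tendsto (fun n => g n s) U (𝓝 x) := fun s =>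
    hc.ultrafilter_le_nhds (U.map fun n => g n s)
      (tendsto_principal.2 (Eventually.of_forall fun n => hgS n s))
  choose γ hγS hγ using hlim
  set ℓ := (μH[1] S).toReal
  have hℓ : 0 ≤ 8 * ℓ := by positivity
  have hLip : LipschitzWith (Real.toNNReal (8 * ℓ)) γ := by
    refine LipschitzWith.of_dist_le_mul fun s t => ?_
    rw [Real.coe_toNNReal _ hℓ, Real.dist_eq]
    have h1 := (hγ s).dist (hγ t)
    have h2 : Tendsto (fun n : ℕ => 8 * ℓ * |s - t| + 2 * (ε₀ / ((n : ℝ) + 2))) U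
        (𝓝 (8 * ℓ * |s - t| + 2 * 0)) := (hε.const_mul 2).const_add _
    simpa using le_of_tendsto_of_tendsto' h1 h2 fun n => hg1 n s t
  refine ⟨_, γ, hLip, Subset.antisymm (by rintro _ ⟨s, -, rfl⟩; exact hγS s) fun y hy => ?_, hγS⟩
  choose s hs hsy using fun n => hg2 n y hy
  obtain ⟨t, ht, hst⟩ := isCompact_Icc.ultrafilter_le_nhds (U.map s)
    (tendsto_principal.2 (Eventually.of_forall hs))
  refine ⟨t, ht, ?_⟩
  have hst' : Tendsto s U (𝓝 t) := hst
  have h1 : Tendsto (fun n => dist (g n t) y) U (𝓝 (dist (γ t) y)) := (hγ t).dist tendsto_const_nhds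
  have h2 : Tendsto (fun n : ℕ => 8 * ℓ * |t - s n| + 2 * (ε₀ / ((n : ℝ) + 2)) + ε₀ / ((n : ℝ) + 2))
      U (𝓝 (8 * ℓ * |t - t| + 2 * 0 + 0)) :=
    (((tendsto_const_nhds.sub hst').abs.const_mul _).add (hε.const_mul 2)).add hε
  have h3 := le_of_tendsto_of_tendsto' h1 h2 fun n =>
    (dist_triangle (g n t) (g n (s n)) y).trans (add_le_add (hg1 n t (s n)) (hsy n))
  simp only [sub_self, abs_zero, mul_zero, add_zero] at h3
  exact dist_le_zero.1 h3

/-- A holomorphic function on an open set star-shaped about `0` has the radial primitive. -/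
theorem hasDerivAt_radial_primitive {V : Set ℂ} (hVo : IsOpen V) (hV : StarConvex ℝ 0 V)
    {q : ℂ → ℂ} (hq : DifferentiableOn ℂ q V) {w : ℂ} (hw : w ∈ V) :
    HasDerivAt (fun w => ∫ t in (0 : ℝ)..1, q (t * w) * w) (q w) w := by
  have hseg : ∀ z ∈ V, ∀ t ∈ Icc (0 : ℝ) 1, (t : ℂ) * z ∈ V := fun z hz t ht => by
    simpa [Complex.real_smul] using hV.smul_mem hz ht.1 ht.2
  have hqd : DifferentiableOn ℂ (deriv q) V := hq.deriv hVo
  have hKc : IsCompact ((fun t : ℝ => (t : ℂ) * w) '' Icc 0 1) :=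
    isCompact_Icc.image (by fun_prop)
  obtain ⟨δ, hδ, hδV⟩ := hKc.exists_cthickening_subset_open hVo
    (by rintro _ ⟨t, ht, rfl⟩; exact hseg w hw t ht)
  set K := cthickening δ ((fun t : ℝ => (t : ℂ) * w) '' Icc 0 1)
  have hK : IsCompact K := hKc.cthickening
  have hmem : ∀ z ∈ ball w δ, ∀ t ∈ Icc (0 : ℝ) 1, (t : ℂ) * z ∈ K := by
    intro z hz t ht
    refine mem_cthickening_of_dist_le _ _ _ _ ⟨t, ht, rfl⟩ ?_
    rw [dist_eq_norm, ← mul_sub, norm_mul, Complex.norm_real, Real.norm_of_nonneg ht.1]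
    have h1 : ‖z - w‖ < δ := by simpa [dist_eq_norm] using hz
    nlinarith [norm_nonneg (z - w), ht.1, ht.2]
  obtain ⟨C₁, hC₁⟩ := hK.exists_bound_of_continuousOn (hq.continuousOn.mono hδV)
  obtain ⟨C₂, hC₂⟩ := hK.exists_bound_of_continuousOn (hqd.continuousOn.mono hδV)
  have hcont : ∀ (f : ℂ → ℂ), ContinuousOn f V → ∀ z ∈ ball w δ,
      ContinuousOn (fun t : ℝ => f (t * z)) (Icc 0 1) := fun f hf z hz =>
    hf.comp (by fun_prop) fun t ht => hδV (hmem z hz t ht)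
  have hIoc : uIoc (0:ℝ) 1 ⊆ Icc 0 1 := by rw [uIoc_of_le zero_le_one]; exact Ioc_subset_Icc_self
  have main := intervalIntegral.hasDerivAt_integral_of_dominated_loc_of_deriv_le
    (μ := volume) (a := 0) (b := 1) (x₀ := w) (s := ball w δ)
    (F := fun (w : ℂ) (t : ℝ) => q (t * w) * w)
    (F' := fun (w : ℂ) (t : ℝ) => deriv q (t * w) * t * w + q (t * w))
    (bound := fun _ => C₂ * (‖w‖ + δ) + C₁) (ball_mem_nhds w hδ) ?_ ?_ ?_ ?_ ?_ ?_
  · have h2 := main.2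
    have h3 : ∫ t in (0:ℝ)..1, (deriv q (t * w) * t * w + q (t * w)) = q w := by
      have hd : ∀ t ∈ uIcc (0:ℝ) 1, HasDerivAt (fun t : ℝ => (t : ℂ) * q (t * w))
          (deriv q (t * w) * t * w + q (t * w)) t := by
        intro t ht
        rw [uIcc_of_le zero_le_one] at ht
        have hq' := (hq.differentiableAt (hVo.mem_nhds (hseg w hw t ht))).hasDerivAt
        have h4 : HasDerivAt (fun t : ℝ => (t : ℂ) * w) (1 * w) t :=
          (Complex.ofRealCLM.hasDerivAt (x := t)).mul_const w
        have h5 := hq'.comp t h4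
        have h6 := (Complex.ofRealCLM.hasDerivAt (x := t)).mul h5
        simp only [Complex.ofRealCLM_apply, Complex.ofReal_one, one_mul, Function.comp_def] at h6
        refine h6.congr_deriv ?_
        ring
      rw [intervalIntegral.integral_eq_sub_of_hasDerivAt hd]
      · simp
      · apply ContinuousOn.intervalIntegrable
        rw [uIcc_of_le zero_le_one]
        exact (((hcont _ hqd.continuousOn w (mem_ball_self hδ)).mul
          Complex.continuous_ofReal.continuousOn).mul continuousOn_const).add
          (hcont _ hq.continuousOn w (mem_ball_self hδ))
    rwa [h3] at h2
  · filter_upwards [ball_mem_nhds w hδ] with z hz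
    refine ContinuousOn.aestronglyMeasurable ?_ measurableSet_uIoc
    exact ((hcont _ hq.continuousOn z hz).mono hIoc).mul continuousOn_const
  · apply ContinuousOn.intervalIntegrable
    rw [uIcc_of_le zero_le_one]
    exact (hcont _ hq.continuousOn w (mem_ball_self hδ)).mul continuousOn_const
  · refine ContinuousOn.aestronglyMeasurable ?_ measurableSet_uIoc
    exact ((((hcont _ hqd.continuousOn w (mem_ball_self hδ)).mono hIoc).mul
      Complex.continuous_ofReal.continuousOn).mul continuousOn_const).add
      ((hcont _ hq.continuousOn w (mem_ball_self hδ)).mono hIoc)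
  · refine Eventually.of_forall fun t ht z hz => ?_
    have ht' := hIoc ht
    have hm := hmem z hz t ht'
    have hz' : ‖z‖ ≤ ‖w‖ + δ := by
      have h1 : ‖z - w‖ < δ := by simpa [dist_eq_norm] using hz
      have := norm_le_norm_add_norm_sub w z
      rw [norm_sub_rev] at this
      linarith
    refine (norm_add_le _ _).trans (add_le_add ?_ (hC₁ _ hm))
    rw [norm_mul, norm_mul, Complex.norm_real, Real.norm_of_nonneg ht'.1]
    have h7 := hC₂ _ hm
    refine mul_le_mul ?_ hz' (norm_nonneg _) ((norm_nonneg _).trans h7)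
    nlinarith [norm_nonneg (deriv q (t * z)), ht'.2]
  · exact intervalIntegrable_const
  · refine Eventually.of_forall fun t ht z hz => ?_
    have ht' := hIoc ht
    have hq' := (hq.differentiableAt (hVo.mem_nhds (hδV (hmem z hz t ht')))).hasDerivAt
    have h4 : HasDerivAt (fun z : ℂ => (t : ℂ) * z) (t * 1) z := (hasDerivAt_id z).const_mul _
    have h5 := (hq'.comp z h4).mul (hasDerivAt_id z)
    simp only [Function.comp_def, id, mul_one] at h5
    exact h5

theorem Complex.re_cpow_mul_ge {z : ℂ} (hz : 0 < z.re) {s T t : ℝ} (hs0 : 0 < s) (hs1 : s < 1)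
    (ht : |t| ≤ T) :
    ‖z‖ ^ s * (Real.cos (s * (Real.pi / 2)) - T * Real.sin (s * (Real.pi / 2))) ≤
      (z ^ (s : ℂ) * (1 - t * Complex.I)).re := by
  have hz0 : z ≠ 0 := fun h => by simp [h] at hz
  have harg : |z.arg| < Real.pi / 2 := Complex.abs_arg_lt_pi_div_two_iff.2 (Or.inl hz)
  have hpi := Real.pi_pos
  have hre := Complex.cpow_ofReal_re z s
  have him := Complex.cpow_ofReal_im z s
  have h1 : (z ^ (s : ℂ) * (1 - t * Complex.I)).re =
      ‖z‖ ^ s * (Real.cos (z.arg * s) + t * Real.sin (z.arg * s)) := by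
    simp only [Complex.mul_re, Complex.sub_re, Complex.one_re, Complex.sub_im, Complex.one_im,
      Complex.mul_im, Complex.ofReal_re, Complex.ofReal_im, Complex.I_re, Complex.I_im, hre, him]
    ring
  rw [h1]
  refine mul_le_mul_of_nonneg_left ?_ (by positivity)
  have habs : |z.arg * s| ≤ s * (Real.pi / 2) := by
    rw [abs_mul, abs_of_pos hs0]; nlinarith
  have hle : s * (Real.pi / 2) ≤ Real.pi / 2 := by nlinarith
  have hcos : Real.cos (s * (Real.pi / 2)) ≤ Real.cos (z.arg * s) := by
    rw [← Real.cos_abs (z.arg * s)]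
    exact Real.cos_le_cos_of_nonneg_of_le_pi (abs_nonneg _) (by linarith) habs
  have hsin : |Real.sin (z.arg * s)| ≤ Real.sin (s * (Real.pi / 2)) := by
    have h2 := abs_le.1 habs
    rw [abs_le]
    constructor
    · rw [← Real.sin_neg]
      exact Real.sin_le_sin_of_le_of_le_pi_div_two (by linarith) (by linarith) (by linarith)
    · exact Real.sin_le_sin_of_le_of_le_pi_div_two (by linarith) (by linarith) (by linarith)
  have h3 : |t * Real.sin (z.arg * s)| ≤ T * Real.sin (s * (Real.pi / 2)) := by
    rw [abs_mul]
    exact mul_le_mul ht hsin (abs_nonneg _) ((abs_nonneg _).trans ht)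
  have := (abs_le.1 h3).1
  linarith

theorem Complex.im_cpow_le_im_cpow {x y y' : ℝ} (hx : 0 < x) (hy : y ≤ y') {s : ℝ} (hs0 : 0 < s)
    (hs1 : s < 1) :
    (((x : ℂ) + y * Complex.I) ^ (s : ℂ)).im ≤ (((x : ℂ) + y' * Complex.I) ^ (s : ℂ)).im := by
  have hd : ∀ y : ℝ, HasDerivAt (fun y : ℝ => (((x : ℂ) + y * Complex.I) ^ (s : ℂ)).im)
      ((s * ((x : ℂ) + y * Complex.I) ^ ((s : ℂ) - 1) * Complex.I).im) y := by
    intro y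
    have h1 : HasDerivAt (fun y : ℝ => (x : ℂ) + y * Complex.I) (1 * Complex.I) y :=
      ((Complex.ofRealCLM.hasDerivAt (x := y)).mul_const Complex.I).const_add _
    have h2 : (x : ℂ) + y * Complex.I ∈ Complex.slitPlane := by
      left; simpa using hx
    have h3 := HasDerivAt.comp y
      ((hasDerivAt_id ((x : ℂ) + y * Complex.I)).cpow_const (c := (s : ℂ)) h2) h1
    have h4 := Complex.imCLM.hasFDerivAt.comp_hasDerivAt y h3
    simpa [Function.comp_def] using h4
  have hmono : Monotone (fun y : ℝ => (((x : ℂ) + y * Complex.I) ^ (s : ℂ)).im) := by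
    refine monotone_of_deriv_nonneg (fun y => (hd y).differentiableAt) fun y => ?_
    rw [(hd y).deriv]
    set z : ℂ := (x : ℂ) + y * Complex.I
    have hz : 0 < z.re := by simpa [z] using hx
    have h5 : (s : ℂ) - 1 = ((s - 1 : ℝ) : ℂ) := by push_cast; ring
    have h6 : (s * z ^ ((s : ℂ) - 1) * Complex.I).im = s * (z ^ (((s - 1 : ℝ)) : ℂ)).re := by
      rw [h5]; simp [Complex.mul_im, Complex.mul_re]
    rw [h6, Complex.cpow_ofReal_re]
    have harg : |z.arg| < Real.pi / 2 := Complex.abs_arg_lt_pi_div_two_iff.2 (Or.inl hz)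
    have : |z.arg * (s - 1)| ≤ Real.pi / 2 := by
      rw [abs_mul, abs_of_neg (by linarith : s - 1 < 0)]
      nlinarith [abs_nonneg z.arg]
    have h7 := Real.cos_nonneg_of_neg_pi_div_two_le_of_le (abs_le.1 this).1 (abs_le.1 this).2
    positivity
  exact hmono hy

theorem measure_le_radial_primitive_sub {V : Set ℂ} (hVo : IsOpen V) (hV : StarConvex ℝ 0 V)
    {q : ℂ → ℂ} (hq : DifferentiableOn ℂ q V) {ζ : ℝ → ℂ} {C : ℝ≥0} (hζ : LipschitzWith C ζ)
    {a b : ℝ} (hab : a ≤ b) (hmem : ∀ α ∈ Icc a b, ζ α ∈ V) {B : Set ℝ} (hB : MeasurableSet B)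
    {k F₀ : ℝ} (hle : ∀ α ∈ Icc a b, DifferentiableAt ℝ ζ α →
      B.indicator (fun _ => k) α - F₀ ≤ (q (ζ α) * deriv ζ α).im) :
    (∫ α in a..b, B.indicator (fun _ => k) α) - F₀ * (b - a) ≤
      (∫ t in (0 : ℝ)..1, q (t * ζ b) * ζ b).im - (∫ t in (0 : ℝ)..1, q (t * ζ a) * ζ a).im := by
  set G : ℂ → ℂ := fun w => ∫ t in (0 : ℝ)..1, q (t * w) * w with hG
  have hGd : ∀ w ∈ V, HasDerivAt G (q w) w := fun w hw => hasDerivAt_radial_primitive hVo hV hq hw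
  have hGs : ∀ w ∈ V, HasStrictDerivAt G (q w) w := fun w hw => by
    have : DifferentiableOn ℂ G V := fun z hz => (hGd z hz).differentiableAt.differentiableWithinAt
    have h := (this.analyticAt (hVo.mem_nhds hw)).hasStrictDerivAt
    rwa [(hGd w hw).deriv] at h
  have hloc : LocallyLipschitzOn (Icc a b) (fun α => (G (ζ α)).im) := by
    intro α hα
    obtain ⟨K, U, hU, hK⟩ := (hGs _ (hmem α hα)).hasStrictFDerivAt.exists_lipschitzOnWith
    refine ⟨1 * (K * C), ζ ⁻¹' U, mem_nhdsWithin_of_mem_nhds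
      (hζ.continuous.continuousAt.preimage_mem_nhds hU), ?_⟩
    have h1 : LipschitzOnWith (K * C) (fun α => G (ζ α)) (ζ ⁻¹' U) :=
      hK.comp (hζ.lipschitzOnWith) (fun x hx => hx)
    have h2 : LipschitzWith 1 Complex.im := LipschitzWith.of_dist_le_mul fun x y => by
      rw [Real.dist_eq, dist_eq_norm, ← Complex.sub_im]
      simpa using Complex.abs_im_le_norm (x - y)
    exact h2.comp_lipschitzOnWith h1
  obtain ⟨K, hK⟩ := hloc.exists_lipschitzOnWith_of_compact isCompact_Icc
  rw [← uIcc_of_le hab] at hK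
  have hac := hK.absolutelyContinuousOnInterval
  have hInteg := hac.integral_deriv_eq_sub
  have hii := hac.intervalIntegrable_deriv
  change _ ≤ (G (ζ b)).im - (G (ζ a)).im
  rw [← hInteg]
  have hind : IntervalIntegrable (fun α => B.indicator (fun _ => k) α - F₀) volume a b := by
    refine IntervalIntegrable.sub ?_ intervalIntegrable_const
    rw [intervalIntegrable_iff]
    exact (integrableOn_const (by simp [uIoc_of_le hab])).indicator hB
  have hval : ∫ α in a..b, (B.indicator (fun _ => k) α - F₀) =
      (∫ α in a..b, B.indicator (fun _ => k) α) - F₀ * (b - a) := by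
    rw [intervalIntegral.integral_sub _ intervalIntegrable_const, intervalIntegral.integral_const,
      smul_eq_mul, mul_comm F₀]
    rw [intervalIntegrable_iff]
    exact (integrableOn_const (by simp [uIoc_of_le hab])).indicator hB
  rw [← hval]
  refine intervalIntegral.integral_mono_ae_restrict hab hind hii ?_
  rw [EventuallyLE, ae_restrict_iff' measurableSet_Icc]
  filter_upwards [hζ.ae_differentiableAt_real] with α hd hα
  have h1 := (hGd _ (hmem α hα)).comp_of_eq α hd.hasDerivAt rfl
  have h2 := Complex.imCLM.hasFDerivAt.comp_hasDerivAt α h1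
  have h3 : deriv (fun α => (G (ζ α)).im) α = (q (ζ α) * deriv ζ α).im := h2.deriv
  rw [h3]
  exact hle α hα hd

theorem Complex.norm_log_le_abs_add_pi (z : ℂ) : ‖Complex.log z‖ ≤ |Real.log ‖z‖| + Real.pi := by
  refine (Complex.norm_le_abs_re_add_abs_im _).trans ?_
  rw [Complex.log_re, Complex.log_im]
  gcongr
  exact Complex.abs_arg_le_pi z

theorem Complex.norm_log_one_sub_le {u : ℂ} (hu : ‖u‖ ≠ 1) :
    ‖Complex.log (1 - u)‖ ≤ |Real.log (1 - ‖u‖)| + ‖u‖ + Real.pi := by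
  have h1 : |1 - ‖u‖| ≤ ‖1 - u‖ := by simpa using abs_norm_sub_norm_le (1 : ℂ) u
  have h2 : ‖1 - u‖ ≤ 1 + ‖u‖ := by simpa using norm_sub_le (1 : ℂ) u
  have h3 : 0 < |1 - ‖u‖| := abs_pos.2 (sub_ne_zero.2 (Ne.symm hu))
  have h4 : Real.log ‖1 - u‖ ≤ ‖u‖ :=
    (Real.log_le_log (h3.trans_le h1) h2).trans
      ((Real.log_le_sub_one_of_pos (by positivity)).trans (by linarith))
  have h5 : Real.log (1 - ‖u‖) ≤ Real.log ‖1 - u‖ := by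
    rw [← Real.log_abs]
    exact Real.log_le_log h3 h1
  refine (Complex.norm_log_le_abs_add_pi _).trans ?_
  gcongr
  rw [abs_le]
  constructor
  · have := neg_abs_le (Real.log (1 - ‖u‖)); have := norm_nonneg u; linarith
  · have := abs_nonneg (Real.log (1 - ‖u‖)); linarith

theorem le_of_forall_eventually_le {n : ℝ → ℝ} {a b : ℝ} (hab : a ≤ b)
    (hl : ∀ x ∈ Icc a b, ∀ᶠ y in 𝓝[<] x, n y ≤ n x)
    (hr : ∀ x ∈ Icc a b, ∀ᶠ y in 𝓝[>] x, n x ≤ n y) : n a ≤ n b := by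
  set A := {x ∈ Icc a b | ∀ y ∈ Icc a x, n a ≤ n y} with hA
  have haA : a ∈ A := ⟨⟨le_rfl, hab⟩, fun y hy => by rw [le_antisymm hy.2 hy.1]⟩
  have hbdd : BddAbove A := ⟨b, fun x hx => hx.1.2⟩
  set c := sSup A with hc
  have hac : a ≤ c := le_csSup hbdd haA
  have hcb : c ≤ b := csSup_le ⟨a, haA⟩ fun x hx => hx.1.2
  have hlt : ∀ y ∈ Ico a c, n a ≤ n y := by
    intro y hy
    obtain ⟨x, hx, hyx⟩ := exists_lt_of_lt_csSup ⟨a, haA⟩ hy.2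
    exact hx.2 y ⟨hy.1, hyx.le⟩
  have hcn : n a ≤ n c := by
    rcases hac.eq_or_lt with h | h
    · rw [← h]
    · have h1 := hl c ⟨hac, hcb⟩
      have h2 : ∀ᶠ y in 𝓝[<] c, y ∈ Ico a c := by
        filter_upwards [Ioo_mem_nhdsLT h] with y hy using ⟨hy.1.le, hy.2⟩
      obtain ⟨y, hy1, hy2⟩ := (h1.and h2).exists
      exact (hlt y hy2).trans hy1
  rcases hcb.eq_or_lt with h | h
  · rwa [← h]
  · exfalso
    have h1 := hr c ⟨hac, hcb⟩
    rw [eventually_nhdsWithin_iff, Metric.eventually_nhds_iff] at h1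
    obtain ⟨ε, hε, h1⟩ := h1
    set d := min (c + ε / 2) b with hd
    have hcd : c < d := lt_min (by linarith) h
    have hdA : d ∈ A := by
      refine ⟨⟨hac.trans hcd.le, min_le_right _ _⟩, fun y hy => ?_⟩
      rcases lt_trichotomy y c with h2 | h2 | h2
      · exact hlt y ⟨hy.1, h2⟩
      · rwa [h2]
      · refine hcn.trans (h1 ?_ h2)
        rw [Real.dist_eq, abs_of_pos (by linarith)]
        have := hy.2.trans (min_le_left _ _)
        linarith
    exact absurd (le_csSup hbdd hdA) (not_le.2 hcd)

/-- The principal determination of `- log (exp (g w) * ∏ (1 - w / Z j))`. -/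
noncomputable def negLogProd {ι : Type*} [Fintype ι] (g : ℂ → ℂ) (Z : ι → ℂ) (w : ℂ) : ℂ :=
  -(g w + ∑ j, Complex.log (1 - w / Z j))

section
variable {ι : Type*} [Fintype ι] {g : ℂ → ℂ} {Z : ι → ℂ} {w : ℂ}

theorem negLogProd_re (hw : ∀ j, 1 - w / Z j ≠ 0) :
    (negLogProd g Z w).re = -Real.log ‖Complex.exp (g w) * ∏ j, (1 - w / Z j)‖ := by
  rw [norm_mul, Real.log_mul (by simp) (by simpa [Finset.prod_eq_zero_iff] using hw), norm_prod,
    Real.log_prod (fun j _ => by simpa using hw j), Complex.norm_exp, Real.log_exp]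
  simp [negLogProd, Complex.log_re]

theorem norm_negLogProd_le {C : ℝ} (hg : ‖g w‖ ≤ C) (hw : ∀ j, ‖w‖ / ‖Z j‖ ≠ 1) :
    ‖negLogProd g Z w‖ ≤
      C + ∑ j, (|Real.log (1 - ‖w‖ / ‖Z j‖)| + ‖w‖ / ‖Z j‖ + Real.pi) := by
  rw [negLogProd, norm_neg]
  refine (norm_add_le _ _).trans (add_le_add hg ((norm_sum_le _ _).trans ?_))
  refine Finset.sum_le_sum fun j _ => ?_
  rw [← norm_div]
  exact Complex.norm_log_one_sub_le (by rw [norm_div]; exact hw j)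

end

theorem intervalIntegrable_log_one_sub_div {r : ℝ} (hr : r ≠ 0) (a b : ℝ) :
    IntervalIntegrable (fun x => Real.log (1 - x / r)) volume a b := by
  have h := (intervalIntegral.intervalIntegrable_log' (a := 1 - a / r) (b := 1 - b /
      r)).comp_sub_left 1
  have h2 := h.comp_mul_left (c := r⁻¹)
  simp only [sub_sub_cancel, div_inv_eq_mul] at h2
  have e1 : a / r * r = a := by field_simp
  have e2 : b / r * r = b := by field_simp
  rw [e1, e2] at h2
  refine h2.congr fun x _ => ?_
  simp [div_eq_inv_mul]

/-- A Lipschitz closed curve `α ↦ R α * exp (α * I)` inside an open set which is star-shaped with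
respect to the origin. -/
structure IsStarCurve (V : Set ℂ) (R : ℝ → ℝ) (L : ℝ≥0) (ρ : ℝ) : Prop where
  isOpen : IsOpen V
  starConvex : StarConvex ℝ 0 V
  lipschitz : LipschitzWith L R
  periodic : Function.Periodic R (2 * Real.pi)
  pos : 0 < ρ
  le : ∀ α, ρ ≤ R α
  mem : ∀ α, (R α : ℂ) * Complex.exp (α * Complex.I) ∈ V

namespace IsStarCurve
variable {V : Set ℂ} {R : ℝ → ℝ} {L : ℝ≥0} {ρ : ℝ}

theorem R_pos (h : IsStarCurve V R L ρ) (α : ℝ) : 0 < R α := h.pos.trans_le (h.le α)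

theorem mem_of_le (h : IsStarCurve V R L ρ) {α r : ℝ} (h0 : 0 ≤ r) (hr : r ≤ R α) :
    (r : ℂ) * Complex.exp (α * Complex.I) ∈ V := by
  have h1 := h.starConvex.smul_mem (h.mem α) (t := r / R α) (div_nonneg h0 (h.R_pos α).le)
    (div_le_one_of_le₀ hr (h.R_pos α).le)
  have h2 : (R α : ℂ) ≠ 0 := by exact_mod_cast (h.R_pos α).ne'
  convert h1 using 1
  rw [Complex.real_smul]
  push_cast
  field_simp

theorem zero_mem (h : IsStarCurve V R L ρ) : (0 : ℂ) ∈ V := by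
  simpa using h.mem_of_le (α := 0) le_rfl (h.R_pos 0).le

theorem continuous_curve (h : IsStarCurve V R L ρ) :
    Continuous fun α : ℝ => (R α : ℂ) * Complex.exp (α * Complex.I) :=
  (Complex.continuous_ofReal.comp h.lipschitz.continuous).mul
    (Complex.continuous_exp.comp (Complex.continuous_ofReal.mul continuous_const))

theorem exists_isCompact (h : IsStarCurve V R L ρ) : ∃ T ⊆ V, IsCompact T ∧
    ∀ α r : ℝ, α ∈ Icc (-1) 7 → 0 ≤ r → r ≤ R α → (r : ℂ) * Complex.exp (α * Complex.I) ∈ T := by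
  refine ⟨(fun p : ℝ × ℝ => ((p.1 * R p.2 : ℝ) : ℂ) * Complex.exp (p.2 * Complex.I)) ''
    (Icc 0 1 ×ˢ Icc (-1) 7), ?_, (isCompact_Icc.prod isCompact_Icc).image ?_, ?_⟩
  · rintro _ ⟨⟨t, α⟩, ⟨ht, -⟩, rfl⟩
    exact h.mem_of_le (mul_nonneg ht.1 (h.R_pos α).le)
      (mul_le_of_le_one_left (h.R_pos α).le ht.2)
  · exact (Complex.continuous_ofReal.comp
      (continuous_fst.mul (h.lipschitz.continuous.comp continuous_snd))).mul
      (Complex.continuous_exp.comp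
        ((Complex.continuous_ofReal.comp continuous_snd).mul continuous_const))
  · intro α r hα h0 hr
    refine ⟨(r / R α, α), ⟨⟨div_nonneg h0 (h.R_pos α).le,
      div_le_one_of_le₀ hr (h.R_pos α).le⟩, hα⟩, ?_⟩
    simp only
    rw [div_mul_cancel₀ _ (h.R_pos α).ne']

end IsStarCurve

theorem Complex.norm_cpow_ofReal_le_one_add (z : ℂ) {s : ℝ} (hs0 : 0 < s) (hs1 : s < 1) :
    ‖z ^ (s : ℂ)‖ ≤ 1 + ‖z‖ := by
  rw [Complex.norm_cpow_real]
  rcases le_total ‖z‖ 1 with h | h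
  · have := Real.rpow_le_one (norm_nonneg z) h hs0.le
    linarith [norm_nonneg z]
  · have := Real.rpow_le_rpow_of_exponent_le h hs1.le
    rw [Real.rpow_one] at this
    linarith

section
variable {ι : Type*} [Fintype ι] {g : ℂ → ℂ} {Z : ι → ℂ} {s : ℝ}

theorem differentiableAt_negLogProd_cpow {w : ℂ} (hg : DifferentiableAt ℂ g w)
    (hw : ∀ j, 1 - w / Z j ∈ Complex.slitPlane)
    (hD : ‖Complex.exp (g w) * ∏ j, (1 - w / Z j)‖ < 1) :
    0 < (negLogProd g Z w).re ∧
      DifferentiableAt ℂ (fun w => negLogProd g Z w ^ (s : ℂ)) w := by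
  have hne : ∀ j, 1 - w / Z j ≠ 0 := fun j => Complex.slitPlane_ne_zero (hw j)
  have hpos : 0 < (negLogProd g Z w).re := by
    rw [negLogProd_re hne, neg_pos]
    exact Real.log_neg (norm_pos_iff.2 (mul_ne_zero (Complex.exp_ne_zero _)
      (Finset.prod_ne_zero_iff.2 fun j _ => hne j))) hD
  refine ⟨hpos, DifferentiableAt.cpow_const ?_ (Or.inl hpos)⟩
  refine (hg.add (DifferentiableAt.fun_sum fun j _ => ?_)).neg
  exact ((differentiableAt_const _).sub (differentiableAt_id.div_const _)).clog (hw j)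

theorem exists_integrable_bound_negLogProd_cpow {T : Set ℂ} (hT : IsCompact T)
    (hg : ContinuousOn g T) (hZ : ∀ j, Z j ≠ 0) (hs0 : 0 < s) (hs1 : s < 1)
    (hd : DifferentiableAt ℂ (fun w => negLogProd g Z w ^ (s : ℂ)) 0)
    (h0 : (negLogProd g Z 0 ^ (s : ℂ)).im = 0) (c : ℝ) :
    ∃ b : ℝ → ℝ, IntegrableOn b (Ioc 0 c) ∧ ∀ w ∈ T, w ≠ 0 → (∀ j, ‖w‖ / ‖Z j‖ ≠ 1) →
      ‖w‖ ≤ c → |(negLogProd g Z w ^ (s : ℂ)).im / ‖w‖| ≤ b ‖w‖ := by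
  obtain ⟨C, hC⟩ := hT.exists_bound_of_continuousOn hg
  obtain ⟨K, hK⟩ := hd.isBigO_sub.bound
  rw [Metric.eventually_nhds_iff] at hK
  obtain ⟨r₁, hr₁, hK⟩ := hK
  refine ⟨fun r => |K| + r₁⁻¹ * (1 + (|C| + ∑ j, (|Real.log (1 - r / ‖Z j‖)| + r / ‖Z j‖ +
      Real.pi))),
    ?_, ?_⟩
  · rcases le_or_gt 0 c with hc | hc
    swap
    · rw [Ioc_eq_empty (not_lt.2 hc.le)]; exact integrableOn_empty
    rw [← intervalIntegrable_iff_integrableOn_Ioc_of_le hc]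
    refine intervalIntegrable_const.add (IntervalIntegrable.const_mul
      (intervalIntegrable_const.add (intervalIntegrable_const.add ?_)) _)
    have := IntervalIntegrable.sum (μ := volume) (a := 0) (b := c) Finset.univ
      (f := fun (j : ι) (r : ℝ) => |Real.log (1 - r / ‖Z j‖)| + r / ‖Z j‖ + Real.pi)
      (fun j _ => ?_)
    · exact this.congr fun r _ => by simp
    · refine ((intervalIntegrable_log_one_sub_div (norm_ne_zero_iff.2 (hZ j)) _ _).norm.add
        (Continuous.intervalIntegrable (by fun_prop) _ _)).add intervalIntegrable_const
  · intro w hw hw0 hwZ hwc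
    have hwp : 0 < ‖w‖ := norm_pos_iff.2 hw0
    have hsum : 0 ≤ ∑ j, (|Real.log (1 - ‖w‖ / ‖Z j‖)| + ‖w‖ / ‖Z j‖ + Real.pi) :=
      Finset.sum_nonneg fun j _ => by have := Real.pi_pos; positivity
    rw [abs_div, abs_of_pos hwp]
    rcases lt_or_ge ‖w‖ r₁ with h | h
    · have h1 := hK (y := w) (by simpa using h)
      have h2 : |(negLogProd g Z w ^ (s : ℂ)).im| ≤ K * ‖w‖ := by
        have h3 := Complex.abs_im_le_norm (negLogProd g Z w ^ (s : ℂ) - negLogProd g Z 0 ^ (s : ℂ))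
        rw [Complex.sub_im, h0, sub_zero] at h3
        refine h3.trans (h1.trans (by simp))
      have h3 : |(negLogProd g Z w ^ (s : ℂ)).im| / ‖w‖ ≤ K := by rwa [div_le_iff₀ hwp]
      refine (h3.trans (le_abs_self K)).trans (le_add_of_nonneg_right ?_)
      have := abs_nonneg C
      positivity
    · have h1 : |(negLogProd g Z w ^ (s : ℂ)).im| ≤
          1 + (|C| + ∑ j, (|Real.log (1 - ‖w‖ / ‖Z j‖)| + ‖w‖ / ‖Z j‖ + Real.pi)) := by
        refine (Complex.abs_im_le_norm _).trans
          ((Complex.norm_cpow_ofReal_le_one_add _ hs0 hs1).trans ?_)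
        gcongr
        exact norm_negLogProd_le ((hC w hw).trans (le_abs_self C)) hwZ
      have h2 : ‖w‖⁻¹ ≤ r₁⁻¹ := by gcongr
      rw [div_eq_inv_mul]
      refine le_trans ?_ (le_add_of_nonneg_left (abs_nonneg K))
      have := abs_nonneg C
      gcongr

end

theorem continuous_one_sub_ray_div (r : ℝ) (Z : ℂ) :
    Continuous fun α : ℝ => 1 - r * Complex.exp (α * Complex.I) / Z :=
  continuous_const.sub ((continuous_const.mul (Complex.continuous_exp.comp
    (Complex.continuous_ofReal.mul continuous_const))).div_const _)

theorem one_sub_ray_div_im {r β : ℝ} {Z : ℂ}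
    (h : 1 - r * Complex.exp (β * Complex.I) / Z ∉ Complex.slitPlane) :
    (1 - r * Complex.exp (β * Complex.I) / Z).re ≤ 0 ∧
    (1 - r * Complex.exp (β * Complex.I) / Z).im = 0 ∧
    ∀ α : ℝ, (1 - r * Complex.exp (α * Complex.I) / Z).im =
      -((1 - (1 - r * Complex.exp (β * Complex.I) / Z).re) * Real.sin (α - β)) := by
  rw [Complex.mem_slitPlane_iff, not_or, not_lt, not_ne_iff] at h
  refine ⟨h.1, h.2, fun α => ?_⟩
  set u := r * Complex.exp (β * Complex.I) / Z with hu
  have h1 : r * Complex.exp (α * Complex.I) / Z = u * Complex.exp ((α - β : ℝ) * Complex.I) := by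
    rw [hu]
    have : (α : ℂ) * Complex.I = β * Complex.I + (α - β : ℝ) * Complex.I := by push_cast; ring
    rw [this, Complex.exp_add]
    ring
  have h2 : u.im = 0 := by simpa using h.2
  rw [h1]
  rw [Complex.sub_im, Complex.mul_im, h2, Complex.exp_ofReal_mul_I_im]
  simp

theorem tendsto_log_one_sub_ray_left {r β : ℝ} {Z : ℂ}
    (h0 : 1 - r * Complex.exp (β * Complex.I) / Z ≠ 0) :
    Tendsto (fun α : ℝ => Complex.log (1 - r * Complex.exp (α * Complex.I) / Z)) (𝓝[<] β)
      (𝓝 (Complex.log (1 - r * Complex.exp (β * Complex.I) / Z))) := by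
  have hc := (continuous_one_sub_ray_div r Z).continuousAt (x := β)
  by_cases h : 1 - r * Complex.exp (β * Complex.I) / Z ∈ Complex.slitPlane
  · exact (hc.clog h).tendsto.mono_left nhdsWithin_le_nhds
  · obtain ⟨hre, him, hs⟩ := one_sub_ray_div_im h
    have hre' : (1 - r * Complex.exp (β * Complex.I) / Z).re < 0 :=
      hre.lt_of_ne fun h => h0 (Complex.ext h him)
    refine (Complex.continuousWithinAt_log_of_re_neg_of_im_zero hre' him).tendsto.comp
      (tendsto_nhdsWithin_iff.2 ⟨hc.tendsto.mono_left nhdsWithin_le_nhds, ?_⟩)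
    filter_upwards [Ioo_mem_nhdsLT (show β - Real.pi < β by linarith [Real.pi_pos])] with α hα
    have : Real.sin (α - β) ≤ 0 :=
      Real.sin_nonpos_of_nonpos_of_neg_pi_le (by linarith [hα.2]) (by linarith [hα.1])
    change 0 ≤ (1 - r * Complex.exp (α * Complex.I) / Z).im
    rw [hs]
    nlinarith

theorem exists_tendsto_log_one_sub_ray_right {r β : ℝ} {Z : ℂ}
    (h0 : 1 - r * Complex.exp (β * Complex.I) / Z ≠ 0) :
    ∃ δ : ℝ, 0 ≤ δ ∧
    Tendsto (fun α : ℝ => Complex.log (1 - r * Complex.exp (α * Complex.I) / Z)) (𝓝[>] β)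
      (𝓝 (Complex.log (1 - r * Complex.exp (β * Complex.I) / Z) - δ * Complex.I)) := by
  have hc := (continuous_one_sub_ray_div r Z).continuousAt (x := β)
  by_cases h : 1 - r * Complex.exp (β * Complex.I) / Z ∈ Complex.slitPlane
  · refine ⟨0, le_rfl, ?_⟩
    simpa using (hc.clog h).tendsto.mono_left nhdsWithin_le_nhds
  · obtain ⟨hre, him, hs⟩ := one_sub_ray_div_im h
    have hre' : (1 - r * Complex.exp (β * Complex.I) / Z).re < 0 :=
      hre.lt_of_ne fun h => h0 (Complex.ext h him)
    refine ⟨2 * Real.pi, by positivity, ?_⟩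
    have h1 := (Complex.tendsto_log_nhdsWithin_im_neg_of_re_neg_of_im_zero hre' him).comp
      (tendsto_nhdsWithin_iff.2 ⟨hc.tendsto.mono_left nhdsWithin_le_nhds,
      (?_ : ∀ᶠ α : ℝ in 𝓝[>] β, 1 - r * Complex.exp (α * Complex.I) / Z ∈ {z : ℂ | z.im < 0})⟩)
    · convert h1 using 2
      · rfl
      rw [Complex.log, Complex.arg_eq_pi_iff.2 ⟨hre', him⟩]
      push_cast
      ring
    · filter_upwards [Ioo_mem_nhdsGT (show (β : ℝ) < β + Real.pi by linarith [Real.pi_pos])] with α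
          hα
      have : 0 < Real.sin (α - β) :=
        Real.sin_pos_of_pos_of_lt_pi (by linarith [hα.1]) (by linarith [hα.2])
      change (1 - r * Complex.exp (α * Complex.I) / Z).im < 0
      rw [hs]
      nlinarith

section
variable {ι : Type*} [Fintype ι] {g : ℂ → ℂ} {Z : ι → ℂ} {s : ℝ}

theorem tendsto_negLogProd_cpow_left {r β : ℝ}
    (hg : ContinuousAt g (r * Complex.exp (β * Complex.I)))
    (hne : ∀ j, 1 - r * Complex.exp (β * Complex.I) / Z j ≠ 0)
    (hre : 0 < (negLogProd g Z (r * Complex.exp (β * Complex.I))).re) :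
    Tendsto (fun α : ℝ => negLogProd g Z (r * Complex.exp (α * Complex.I)) ^ (s : ℂ)) (𝓝[<] β)
      (𝓝 (negLogProd g Z (r * Complex.exp (β * Complex.I)) ^ (s : ℂ))) := by
  have hr : Continuous fun α : ℝ => (r : ℂ) * Complex.exp (α * Complex.I) :=
    continuous_const.mul (Complex.continuous_exp.comp
      (Complex.continuous_ofReal.mul continuous_const))
  refine Tendsto.cpow (l := 𝓝[<] β) ?_ tendsto_const_nhds (Or.inl hre)
  refine (Tendsto.add ?_ (tendsto_finsetSum _ fun j _ => tendsto_log_one_sub_ray_left (hne j))).neg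
  exact (ContinuousAt.comp (f := fun α : ℝ => (r : ℂ) * Complex.exp (α * Complex.I)) hg
    hr.continuousAt).tendsto.mono_left nhdsWithin_le_nhds

theorem exists_tendsto_negLogProd_cpow_right {r β : ℝ} (hs0 : 0 < s) (hs1 : s < 1)
    (hg : ContinuousAt g (r * Complex.exp (β * Complex.I)))
    (hne : ∀ j, 1 - r * Complex.exp (β * Complex.I) / Z j ≠ 0)
    (hre : 0 < (negLogProd g Z (r * Complex.exp (β * Complex.I))).re) :
    ∃ z : ℂ, (negLogProd g Z (r * Complex.exp (β * Complex.I)) ^ (s : ℂ)).im ≤ z.im ∧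
    Tendsto (fun α : ℝ => negLogProd g Z (r * Complex.exp (α * Complex.I)) ^ (s : ℂ)) (𝓝[>] β)
      (𝓝 z) := by
  have hr : Continuous fun α : ℝ => (r : ℂ) * Complex.exp (α * Complex.I) :=
    continuous_const.mul (Complex.continuous_exp.comp
      (Complex.continuous_ofReal.mul continuous_const))
  choose δ hδ hlim using fun j => exists_tendsto_log_one_sub_ray_right (hne j)
  set z₀ := negLogProd g Z (r * Complex.exp (β * Complex.I)) with hz₀
  have hlim' : Tendsto (fun α : ℝ => negLogProd g Z (r * Complex.exp (α * Complex.I))) (𝓝[>] β)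
      (𝓝 (z₀ + (∑ j, δ j : ℝ) * Complex.I)) := by
    have h1 : Tendsto (fun α : ℝ => g (r * Complex.exp (α * Complex.I))) (𝓝[>] β) _ :=
      (ContinuousAt.comp (f := fun α : ℝ => (r : ℂ) * Complex.exp (α * Complex.I)) hg
        hr.continuousAt).tendsto.mono_left nhdsWithin_le_nhds
    have h2 := (h1.add (tendsto_finsetSum Finset.univ fun j _ => hlim j)).neg
    convert h2 using 2
    · rfl
    rw [hz₀, negLogProd, Finset.sum_sub_distrib, Complex.ofReal_sum, Finset.sum_mul]
    simp only [Function.comp_apply]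
    ring
  refine ⟨(z₀ + (∑ j, δ j : ℝ) * Complex.I) ^ (s : ℂ), ?_, ?_⟩
  · have h1 := Complex.im_cpow_le_im_cpow hre (y := z₀.im) (y' := z₀.im + ∑ j, δ j)
      (le_add_of_nonneg_right (Finset.sum_nonneg fun j _ => hδ j)) hs0 hs1
    rw [Complex.re_add_im] at h1
    convert h1 using 3
    conv_lhs => rw [← Complex.re_add_im z₀]
    push_cast
    ring
  · refine hlim'.cpow tendsto_const_nhds (Or.inl ?_)
    simpa using hre

end

/-- The integrand of the radial primitive of `(F - F 0) / w` with `F = negLogProd g Z ^ s`. -/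
noncomputable def radialIntegrand {ι : Type*} [Fintype ι] (g : ℂ → ℂ) (Z : ι → ℂ) (s : ℝ)
    (R : ℝ → ℝ) (α r : ℝ) : ℝ :=
  (Iio (R α)).indicator
    (fun r => (negLogProd g Z (r * Complex.exp (α * Complex.I)) ^ (s : ℂ)).im / r) r

theorem norm_ofReal_mul_exp {r : ℝ} (hr : 0 ≤ r) (α : ℝ) :
    ‖(r : ℂ) * Complex.exp (α * Complex.I)‖ = r := by
  rw [norm_mul, Complex.norm_exp_ofReal_mul_I, mul_one, Complex.norm_real, Real.norm_of_nonneg hr]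

section
variable {ι : Type*} [Fintype ι] {g : ℂ → ℂ} {Z : ι → ℂ} {s : ℝ} {V : Set ℂ} {R : ℝ → ℝ} {L : ℝ≥0}
  {ρ : ℝ}

theorem aestronglyMeasurable_radialIntegrand (h : IsStarCurve V R L ρ) (hg : ContinuousOn g V)
    (α c : ℝ) :
    AEStronglyMeasurable (radialIntegrand g Z s R α) (volume.restrict (Ioc 0 c)) := by
  unfold radialIntegrand
  rw [aestronglyMeasurable_indicator_iff measurableSet_Iio, Measure.restrict_restrict
    measurableSet_Iio]
  refine AEMeasurable.aestronglyMeasurable ?_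
  have hm : MeasurableSet (Iio (R α) ∩ Ioc 0 c) := measurableSet_Iio.inter measurableSet_Ioc
  have hray : Continuous fun r : ℝ => (r : ℂ) * Complex.exp (α * Complex.I) :=
    Complex.continuous_ofReal.mul continuous_const
  have h1 : AEMeasurable (fun r : ℝ => g (r * Complex.exp (α * Complex.I)))
      (volume.restrict (Iio (R α) ∩ Ioc 0 c)) :=
    (ContinuousOn.comp hg hray.continuousOn fun r hr => h.mem_of_le hr.2.1.le hr.1.le).aemeasurable
        hm
  have h2 : AEMeasurable (fun r : ℝ => negLogProd g Z (r * Complex.exp (α * Complex.I)))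
      (volume.restrict (Iio (R α) ∩ Ioc 0 c)) := by
    refine (h1.add (Measurable.aemeasurable ?_)).neg
    refine Finset.measurable_sum _ fun j _ => Complex.measurable_log.comp ?_
    exact (continuous_const.sub (hray.div_const _)).measurable
  exact (Complex.measurable_im.comp_aemeasurable (h2.pow_const _)).div measurable_id.aemeasurable

theorem tendsto_integral_radialIntegrand (h : IsStarCurve V R L ρ) (hg : ContinuousOn g V) {c : ℝ}
    {b : ℝ → ℝ} (hb : IntegrableOn b (Ioc 0 c)) {T : Set ℂ} {J : Set ℝ}
    (hT : ∀ α r : ℝ, α ∈ J → 0 ≤ r → r ≤ R α → (r : ℂ) * Complex.exp (α * Complex.I) ∈ T)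
    (hbT : ∀ w ∈ T, w ≠ 0 → (∀ j, ‖w‖ / ‖Z j‖ ≠ 1) →
      ‖w‖ ≤ c → |(negLogProd g Z w ^ (s : ℂ)).im / ‖w‖| ≤ b ‖w‖)
    {β : ℝ} {l : Filter ℝ} [l.IsCountablyGenerated] [l.NeBot] (hl : l ≤ 𝓝 β) (hlJ : J ∈ l)
    {f : ℝ → ℂ}
    (hf : ∀ r, 0 < r → r < R β → (∀ j, r / ‖Z j‖ ≠ 1) → Tendsto
      (fun α : ℝ => negLogProd g Z (r * Complex.exp (α * Complex.I)) ^ (s : ℂ)) l (𝓝 (f r))) :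
    IntegrableOn ((Iio (R β)).indicator fun r => (f r).im / r) (Ioc 0 c) ∧
    Tendsto (fun α => ∫ r in Ioc 0 c, radialIntegrand g Z s R α r) l
      (𝓝 (∫ r in Ioc 0 c, (Iio (R β)).indicator (fun r => (f r).im / r) r)) := by
  have hb0 : ∀ᵐ r ∂(volume.restrict (Ioc 0 c)), (∀ j, r / ‖Z j‖ ≠ 1) ∧ r ≠ R β ∧ r ∈ Ioc 0 c := by
    have hc : (range fun j => ‖Z j‖).Countable := (finite_range _).countable
    rw [ae_restrict_iff' measurableSet_Ioc]
    have h1 : ∀ᵐ r : ℝ, r ∉ (range fun j => ‖Z j‖) ∪ {R β} :=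
      measure_eq_zero_iff_ae_notMem.1 ((hc.union (countable_singleton _)).measure_zero _)
    filter_upwards [h1] with r hr hr'
    refine ⟨fun j hj => hr (Or.inl ⟨j, ?_⟩), fun hj => hr (Or.inr hj), hr'⟩
    have : ‖Z j‖ ≠ 0 := fun h => by simp [h] at hj
    exact ((div_eq_one_iff_eq this).1 hj).symm
  have hbd : ∀ α ∈ J, ∀ r ∈ Ioc 0 c, (∀ j, r / ‖Z j‖ ≠ 1) → ‖radialIntegrand g Z s R α r‖ ≤ |b
      r| := by
    intro α hα r hr hrZ
    unfold radialIntegrand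
    by_cases hrR : r ∈ Iio (R α)
    · rw [indicator_of_mem hrR]
      have hn := norm_ofReal_mul_exp hr.1.le α
      have := hbT _ (hT α r hα hr.1.le (le_of_lt hrR)) (by rw [← norm_pos_iff, hn]; exact hr.1)
        (by rw [hn]; exact hrZ) (by rw [hn]; exact hr.2)
      rw [hn] at this
      exact this.trans (le_abs_self _)
    · rw [indicator_of_notMem hrR, norm_zero]
      exact abs_nonneg _
  have hlim : ∀ᵐ r ∂(volume.restrict (Ioc 0 c)), Tendsto (fun α => radialIntegrand g Z s R α r) l
      (𝓝 ((Iio (R β)).indicator (fun r => (f r).im / r) r)) := by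
    filter_upwards [hb0] with r hr
    have hRl : Tendsto R l (𝓝 (R β)) := (h.lipschitz.continuous.tendsto β).mono_left hl
    rcases lt_or_gt_of_ne hr.2.1 with h1 | h1
    · rw [indicator_of_mem (mem_Iio.2 h1)]
      have h2 := ((Complex.continuous_im.tendsto _).comp
        (hf r hr.2.2.1 h1 hr.1)).div_const r
      refine h2.congr' ?_
      filter_upwards [hRl.eventually (lt_mem_nhds h1)] with α hα
      rw [radialIntegrand, indicator_of_mem (mem_Iio.2 hα)]
      rfl
    · rw [indicator_of_notMem (notMem_Iio.2 h1.le)]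
      refine tendsto_const_nhds.congr' ?_
      filter_upwards [hRl.eventually (gt_mem_nhds h1)] with α hα
      rw [radialIntegrand, indicator_of_notMem (notMem_Iio.2 hα.le)]
  constructor
  · obtain ⟨u, hu⟩ := exists_seq_tendsto l
    have hm : AEStronglyMeasurable ((Iio (R β)).indicator fun r => (f r).im / r)
        (volume.restrict (Ioc 0 c)) := by
      refine aestronglyMeasurable_of_tendsto_ae atTop
        (fun n => aestronglyMeasurable_radialIntegrand (Z := Z) (s := s) h hg (u n) c) ?_
      filter_upwards [hlim] with r hr using hr.comp hu
    refine hb.abs.mono' hm ?_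
    filter_upwards [hlim, hb0] with r hr hr2
    refine le_of_tendsto hr.norm ?_
    filter_upwards [hlJ] with α hα using hbd α hα r hr2.2.2 hr2.1
  · refine tendsto_integral_filter_of_dominated_convergence (fun r => |b r|) ?_ ?_ hb.abs hlim
    · exact Eventually.of_forall fun α => aestronglyMeasurable_radialIntegrand h hg α c
    · filter_upwards [hlJ] with α hα
      filter_upwards [hb0] with r hr using hbd α hα r hr.2.2 hr.1

end

section
variable {ι : Type*} [Fintype ι] {g : ℂ → ℂ} {Z : ι → ℂ} {s : ℝ} {V : Set ℂ} {R : ℝ → ℝ} {L : ℝ≥0}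
  {ρ : ℝ}

theorem one_sub_smul_div_mem_slitPlane {w Z : ℂ} (h : 1 - w / Z ∈ Complex.slitPlane) {t : ℝ}
    (h0 : 0 ≤ t) (h1 : t ≤ 1) : 1 - (t * w) / Z ∈ Complex.slitPlane := by
  have h2 : w / Z = -(-(w / Z)) := by ring
  have h3 := StarConvex.add_smul_mem Complex.starConvex_one_slitPlane
    (y := -(w / Z)) (by rwa [← sub_eq_add_neg]) h0 h1
  convert h3 using 1
  rw [Complex.real_smul]
  ring

theorem integral_radialIntegrand_eq (h : IsStarCurve V R L ρ) {V' : Set ℂ} (hVo : IsOpen V')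
    (hV's : StarConvex ℝ 0 V')
    (hF : DifferentiableOn ℂ (fun w => negLogProd g Z w ^ (s : ℂ)) V')
    (h0 : (negLogProd g Z 0 ^ (s : ℂ)).im = 0) {α c : ℝ} (hc : R α ≤ c)
    (hα : (R α : ℂ) * Complex.exp (α * Complex.I) ∈ V') :
    (∫ t in (0 : ℝ)..1, dslope (fun w => negLogProd g Z w ^ (s : ℂ)) 0
      (t * ((R α : ℂ) * Complex.exp (α * Complex.I))) *
        ((R α : ℂ) * Complex.exp (α * Complex.I))).im =
      ∫ r in Ioc 0 c, radialIntegrand g Z s R α r := by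
  set F : ℂ → ℂ := fun w => negLogProd g Z w ^ (s : ℂ) with hFdef
  set ζ : ℂ := (R α : ℂ) * Complex.exp (α * Complex.I) with hζ
  have hR := h.R_pos α
  have h0V : (0 : ℂ) ∈ V' := by simpa using hV's.smul_mem hα le_rfl zero_le_one
  have hq : DifferentiableOn ℂ (dslope F 0) V' :=
    (Complex.differentiableOn_dslope (hVo.mem_nhds h0V)).2 hF
  have hci : ContinuousOn (fun t : ℝ => dslope F 0 (t * ζ) * ζ) (Icc 0 1) := by
    refine ContinuousOn.mul (ContinuousOn.comp hq.continuousOn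
      (Complex.continuous_ofReal.mul continuous_const).continuousOn fun t ht => ?_)
          continuousOn_const
    simpa using hV's.smul_mem hα ht.1 ht.2
  have hInteg : IntervalIntegrable (fun t : ℝ => dslope F 0 (t * ζ) * ζ) volume 0 1 :=
    hci.intervalIntegrable_of_Icc zero_le_one
  have h1 := Complex.imCLM.intervalIntegral_comp_comm hInteg
  rw [Complex.imCLM_apply] at h1
  rw [← h1]
  have hζ0 : ζ ≠ 0 := by
    rw [← norm_pos_iff, hζ, norm_ofReal_mul_exp hR.le]; exact hR
  set f : ℝ → ℝ := fun r => (F (r * Complex.exp (α * Complex.I))).im / r with hf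
  have h2 : ∫ t in (0 : ℝ)..1, Complex.imCLM (dslope F 0 (t * ζ) * ζ) =
      ∫ t in (0 : ℝ)..1, R α • f (t * R α) := by
    refine intervalIntegral.integral_congr_ae (Eventually.of_forall fun t ht => ?_)
    rw [uIoc_of_le zero_le_one] at ht
    have ht0 : (t : ℂ) ≠ 0 := by exact_mod_cast ht.1.ne'
    have h3 : (t : ℂ) * ζ ≠ 0 := mul_ne_zero ht0 hζ0
    rw [dslope_of_ne _ h3, slope_def_field, sub_zero, Complex.imCLM_apply]
    have h4 : (F (t * ζ) - F 0) / (t * ζ) * ζ = ((t⁻¹ : ℝ) : ℂ) * (F (t * ζ) - F 0) := by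
      push_cast; field_simp
    rw [h4, Complex.im_ofReal_mul, Complex.sub_im, h0, sub_zero, hf]
    have h5 : ((t * R α : ℝ) : ℂ) * Complex.exp (α * Complex.I) = t * ζ := by
      rw [hζ]; push_cast; ring
    simp only [h5, smul_eq_mul]
    field_simp
  rw [h2, intervalIntegral.integral_smul, intervalIntegral.smul_integral_comp_mul_right]
  rw [zero_mul, one_mul, intervalIntegral.integral_of_le hR.le]
  unfold radialIntegrand
  rw [setIntegral_indicator measurableSet_Iio]
  refine setIntegral_congr_set ?_
  have : Ioc 0 c ∩ Iio (R α) = Ioo 0 (R α) := by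
    ext x; simp only [mem_inter_iff, mem_Ioc, mem_Iio, mem_Ioo]
    constructor
    · rintro ⟨h1, h2⟩; exact ⟨h1.1, h2⟩
    · rintro ⟨h1, h2⟩; exact ⟨⟨h1, h2.le.trans hc⟩, h2⟩
  rw [this]
  exact Ioo_ae_eq_Ioc.symm

/-- The angles of the zeros `Z j` are isolated. -/
theorem eventually_ray_mem_slitPlane (hZ : ∀ j, Z j ≠ 0) (β : ℝ) :
    ∀ᶠ α : ℝ in 𝓝[≠] β, ∀ (r : ℝ), 0 ≤ r → ∀ j,
      1 - r * Complex.exp (α * Complex.I) / Z j ∈ Complex.slitPlane := by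
  have h1 : ∀ j, ∀ᶠ α : ℝ in 𝓝[≠] β, Complex.exp (α * Complex.I) ≠ Z j / ‖Z j‖ := by
    intro j
    have hd : HasDerivAt (fun α : ℝ => Complex.exp (α * Complex.I))
        (Complex.exp (β * Complex.I) * (1 * Complex.I)) β :=
      ((Complex.ofRealCLM.hasDerivAt (x := β)).mul_const Complex.I).cexp
    exact hd.eventually_ne (by simp [Complex.exp_ne_zero])
  filter_upwards [eventually_all.2 h1] with α hα r hr j
  by_contra hns
  rw [Complex.mem_slitPlane_iff, not_or, not_lt, not_ne_iff] at hns
  refine hα j ?_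
  set u := r * Complex.exp (α * Complex.I) / Z j with hu
  have hure : 1 ≤ u.re := by simpa using hns.1
  have huim : u.im = 0 := by simpa using hns.2
  have hueq : u = (u.re : ℂ) := Complex.ext rfl (by simpa using huim)
  have h2 : (r : ℂ) * Complex.exp (α * Complex.I) = (u.re : ℂ) * Z j := by
    rw [← hueq, hu, div_mul_cancel₀ _ (hZ j)]
  have h3 : r = u.re * ‖Z j‖ := by
    rw [← norm_ofReal_mul_exp hr α, h2, norm_mul, Complex.norm_real,
      Real.norm_of_nonneg (by linarith)]
  have h4 : ((u.re : ℝ) : ℂ) ≠ 0 := by exact_mod_cast (by linarith : u.re ≠ 0)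
  have h5 : ((‖Z j‖ : ℝ) : ℂ) ≠ 0 := by exact_mod_cast norm_ne_zero_iff.2 (hZ j)
  rw [h3] at h2
  push_cast at h2
  rw [eq_div_iff h5]
  apply mul_left_cancel₀ h4
  linear_combination h2

end

section
variable {ι : Type*} [Fintype ι] {g : ℂ → ℂ} {Z : ι → ℂ} {s : ℝ} {V : Set ℂ} {R : ℝ → ℝ} {L : ℝ≥0}
  {ρ : ℝ}

theorem IsStarCurve.lipschitz_curve (h : IsStarCurve V R L ρ) :
    ∃ C : ℝ≥0, LipschitzWith C fun α : ℝ => (R α : ℂ) * Complex.exp (α * Complex.I) := by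
  obtain ⟨c, hc⟩ : ∃ c, ∀ α, R α ≤ c := by
    obtain ⟨c, hc⟩ := (isCompact_Icc (a := 0) (b := 2 * Real.pi)).bddAbove_image
      h.lipschitz.continuous.continuousOn
    refine ⟨c, fun α => ?_⟩
    obtain ⟨y, hy, hyα⟩ := h.periodic.exists_mem_Ico₀ Real.two_pi_pos α
    rw [hyα]
    exact hc ⟨y, ⟨hy.1, hy.2.le⟩, rfl⟩
  have hc0 : 0 ≤ c := (h.R_pos 0).le.trans (hc 0)
  refine ⟨L + c.toNNReal, LipschitzWith.of_dist_le_mul fun x y => ?_⟩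
  have hexp : ‖Complex.exp (x * Complex.I) - Complex.exp (y * Complex.I)‖ ≤ |x - y| := by
    have hl : LipschitzWith 1 fun α : ℝ => Complex.exp (α * Complex.I) := by
      refine lipschitzWith_of_nnnorm_deriv_le (𝕜 := ℝ) ?_ ?_
      · intro β
        exact ((Complex.ofRealCLM.hasDerivAt (x := β)).mul_const Complex.I).cexp.differentiableAt
      · intro β
        have hd : deriv (fun α : ℝ => Complex.exp (α * Complex.I)) β = _ :=
          ((Complex.ofRealCLM.hasDerivAt (x := β)).mul_const Complex.I).cexp.deriv
        rw [hd, ← NNReal.coe_le_coe, coe_nnnorm]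
        simp [Complex.norm_exp_ofReal_mul_I]
    simpa [dist_eq_norm] using hl.dist_le_mul x y
  have hR := h.lipschitz.dist_le_mul x y
  rw [Real.dist_eq] at hR
  have e : (R x : ℂ) * Complex.exp (x * Complex.I) - R y * Complex.exp (y * Complex.I) =
    ((R x - R y : ℝ) : ℂ) * Complex.exp (x * Complex.I) +
      R y * (Complex.exp (x * Complex.I) - Complex.exp (y * Complex.I)) := by push_cast; ring
  rw [dist_eq_norm, e]
  refine (norm_add_le _ _).trans ?_
  rw [norm_mul, norm_mul, Complex.norm_exp_ofReal_mul_I, mul_one, Complex.norm_real,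
    Complex.norm_real, Real.norm_eq_abs, Real.norm_of_nonneg (h.R_pos y).le, NNReal.coe_add,
    Real.coe_toNNReal _ hc0, add_mul, Real.dist_eq]
  rw [Real.dist_eq] at hR
  gcongr
  exact hc y

theorem indicator_sub_le_im_dslope_mul_deriv (h : IsStarCurve V R L ρ)
    (h0 : (negLogProd g Z 0 ^ (s : ℂ)).im = 0) (hs0 : 0 < s) (hs1 : s < 1) {κ M : ℝ}
    (hκ0 : 0 < κ)
    (hκ : κ ≤ Real.cos (s * (Real.pi / 2)) - (L / ρ) * Real.sin (s * (Real.pi / 2)))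
    (hM : 0 < M) {B : Set ℝ} {α : ℝ}
    (hre : 0 < (negLogProd g Z (R α * Complex.exp (α * Complex.I))).re)
    (hB : α ∈ B → M ≤ (negLogProd g Z (R α * Complex.exp (α * Complex.I))).re)
    (hd : DifferentiableAt ℝ (fun α : ℝ => (R α : ℂ) * Complex.exp (α * Complex.I)) α) :
    B.indicator (fun _ => κ * M ^ s) α - (negLogProd g Z 0 ^ (s : ℂ)).re ≤
      (dslope (fun w => negLogProd g Z w ^ (s : ℂ)) 0 (R α * Complex.exp (α * Complex.I)) *
        deriv (fun α : ℝ => (R α : ℂ) * Complex.exp (α * Complex.I)) α).im := by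
  have hRp := h.R_pos α
  have hRd : DifferentiableAt ℝ R α := by
    have h1 : R = fun α : ℝ => (((R α : ℂ) * Complex.exp (α * Complex.I)) *
        Complex.exp (-(α * Complex.I))).re := by
      ext α
      rw [mul_assoc, ← Complex.exp_add, add_neg_cancel, Complex.exp_zero, mul_one,
        Complex.ofReal_re]
    rw [h1]
    have h2 : DifferentiableAt ℝ (fun α : ℝ => Complex.exp (-(α * Complex.I))) α :=
      ((Complex.ofRealCLM.hasDerivAt (x := α)).mul_const Complex.I).neg.cexp.differentiableAt
    exact Complex.reCLM.differentiableAt.comp α (hd.mul h2)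
  have hder : deriv (fun α : ℝ => (R α : ℂ) * Complex.exp (α * Complex.I)) α =
      (deriv R α + R α * Complex.I) * Complex.exp (α * Complex.I) := by
    have h1 := hRd.hasDerivAt.ofReal_comp.mul
      ((Complex.ofRealCLM.hasDerivAt (x := α)).mul_const Complex.I).cexp
    refine (h1.congr_deriv ?_).deriv
    simp
    ring
  have hR' : |deriv R α| ≤ L := by
    have := norm_deriv_le_of_lipschitz (x₀ := α) h.lipschitz
    simpa using this
  set ζ : ℂ := R α * Complex.exp (α * Complex.I) with hζ
  have hζ0 : ζ ≠ 0 := by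
    rw [← norm_pos_iff, hζ, norm_ofReal_mul_exp hRp.le]; exact hRp
  have hRc : (R α : ℂ) ≠ 0 := by exact_mod_cast hRp.ne'
  have h3 : dslope (fun w => negLogProd g Z w ^ (s : ℂ)) 0 ζ *
      ((deriv R α + R α * Complex.I) * Complex.exp (α * Complex.I)) =
      ((negLogProd g Z ζ ^ (s : ℂ) - negLogProd g Z 0 ^ (s : ℂ)) *
        (1 - (deriv R α / R α : ℝ) * Complex.I)) * Complex.I := by
    rw [dslope_of_ne _ hζ0, slope_def_field, sub_zero, hζ]
    push_cast
    field_simp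
    linear_combination (negLogProd g Z (R α * Complex.exp (α * Complex.I)) ^ (s : ℂ) -
      negLogProd g Z 0 ^ (s : ℂ)) * ((deriv R α : ℝ) : ℂ) * Complex.I_sq
  rw [hder, h3, Complex.mul_I_im, sub_mul, Complex.sub_re]
  have h4 : (negLogProd g Z 0 ^ (s : ℂ) * (1 - (deriv R α / R α : ℝ) * Complex.I)).re =
      (negLogProd g Z 0 ^ (s : ℂ)).re := by
    rw [Complex.mul_re, h0]; simp
  rw [h4]
  refine sub_le_sub_right ?_ _
  have hT : |deriv R α / R α| ≤ L / ρ := by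
    rw [abs_div, abs_of_pos hRp]
    exact div_le_div₀ L.2 hR' h.pos (h.le α)
  have h5 := Complex.re_cpow_mul_ge hre hs0 hs1 hT
  refine le_trans ?_ h5
  have h6 : 0 ≤ ‖negLogProd g Z ζ‖ ^ s := by positivity
  have h7 : ‖negLogProd g Z ζ‖ ^ s * κ ≤ ‖negLogProd g Z ζ‖ ^ s *
    (Real.cos (s * (Real.pi / 2)) - (L / ρ) * Real.sin (s * (Real.pi / 2))) := by gcongr
  refine le_trans ?_ h7
  by_cases hαB : α ∈ B
  · rw [indicator_of_mem hαB, mul_comm]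
    gcongr
    exact (hB hαB).trans (Complex.re_le_norm _)
  · rw [indicator_of_notMem hαB]
    positivity

end

section
variable {ι : Type*} [Fintype ι] {g : ℂ → ℂ} {Z : ι → ℂ} {s : ℝ} {V : Set ℂ} {R : ℝ → ℝ} {L : ℝ≥0}
  {ρ : ℝ}

theorem radialIntegrand_two_pi (h : IsStarCurve V R L ρ) :
    radialIntegrand g Z s R (2 * Real.pi) = radialIntegrand g Z s R 0 := by
  ext r
  have h1 : R (2 * Real.pi) = R 0 := by simpa using h.periodic 0
  unfold radialIntegrand
  rw [h1]
  simp [Complex.exp_two_pi_mul_I]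

/-- On a Lipschitz star-shaped curve a bounded holomorphic function is very small only on a set of
angles of small measure. -/
theorem IsStarCurve.measure_norm_le_exp_neg (h : IsStarCurve V R L ρ)
    (hg : DifferentiableOn ℂ g V) (hg0 : (g 0).im = 0) (hZ : ∀ j, Z j ≠ 0)
    (hD : ∀ w ∈ V, ‖Complex.exp (g w) * ∏ j, (1 - w / Z j)‖ < 1)
    (hs0 : 0 < s) (hs1 : s < 1) {κ M : ℝ} (hκ0 : 0 < κ)
    (hκ : κ ≤ Real.cos (s * (Real.pi / 2)) - (L / ρ) * Real.sin (s * (Real.pi / 2)))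
    (hM : 0 < M) :
    κ * M ^ s * (volume ({α : ℝ | ‖Complex.exp (g (R α * Complex.exp (α * Complex.I))) *
      ∏ j, (1 - R α * Complex.exp (α * Complex.I) / Z j)‖ ≤ Real.exp (-M)} ∩
        Ioc 0 (2 * Real.pi))).toReal ≤ 2 * Real.pi * (-(g 0).re) ^ s := by
  classical
  set D : ℂ → ℂ := fun w => Complex.exp (g w) * ∏ j, (1 - w / Z j)
  set ζ : ℝ → ℂ := fun α => R α * Complex.exp (α * Complex.I) with hζ
  set B : Set ℝ := {α : ℝ | ‖D (ζ α)‖ ≤ Real.exp (-M)} with hBdef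
  have hDc : ContinuousOn D V := (Complex.continuous_exp.comp_continuousOn hg.continuousOn).mul
    (Continuous.continuousOn (continuous_finsetProd _ fun j _ =>
      continuous_const.sub (continuous_id.div_const _)))
  have hBm : MeasurableSet B := by
    refine (isClosed_le (f := fun α => ‖D (ζ α)‖) ?_ continuous_const).measurableSet
    exact (hDc.comp_continuous h.continuous_curve h.mem).norm
  set F : ℂ → ℂ := fun w => negLogProd g Z w ^ (s : ℂ) with hF
  -- the value at the origin
  have hL0 : negLogProd g Z 0 = ((-(g 0).re : ℝ) : ℂ) := by
    simp only [negLogProd, zero_div, sub_zero, Complex.log_one, Finset.sum_const_zero, add_zero]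
    apply Complex.ext <;> simp [hg0]
  have hg0pos : 0 < -(g 0).re := by
    have h1 := hD 0 h.zero_mem
    simp only [zero_div, sub_zero, Finset.prod_const_one, mul_one, Complex.norm_exp] at h1
    rw [Real.exp_lt_one_iff] at h1
    linarith
  have hF0 : F 0 = (((-(g 0).re) ^ s : ℝ) : ℂ) := by
    simp only [hF]
    rw [hL0, Complex.ofReal_cpow hg0pos.le]
  have hF0im : (negLogProd g Z 0 ^ (s : ℂ)).im = 0 := by
    change (F 0).im = 0
    rw [hF0, Complex.ofReal_im]
  have hF0re : (negLogProd g Z 0 ^ (s : ℂ)).re = (-(g 0).re) ^ s := by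
    change (F 0).re = _
    rw [hF0, Complex.ofReal_re]
  -- the slit domain
  set V' : Set ℂ := V ∩ ⋂ j, (fun w => 1 - w / Z j) ⁻¹' Complex.slitPlane with hV'
  have hV'o : IsOpen V' := h.isOpen.inter (isOpen_iInter_of_finite fun j =>
    Complex.isOpen_slitPlane.preimage (continuous_const.sub (continuous_id.div_const _)))
  have hV's : StarConvex ℝ 0 V' := by
    rw [starConvex_zero_iff]
    intro w hw t ht0 ht1
    refine ⟨h.starConvex.smul_mem hw.1 ht0 ht1, mem_iInter.2 fun j => ?_⟩
    simpa using one_sub_smul_div_mem_slitPlane (mem_iInter.1 hw.2 j) ht0 ht1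
  have hV'F : ∀ w ∈ V', 0 < (negLogProd g Z w).re ∧ DifferentiableAt ℂ F w := fun w hw =>
    differentiableAt_negLogProd_cpow (hg.differentiableAt (h.isOpen.mem_nhds hw.1))
      (fun j => mem_iInter.1 hw.2 j) (hD w hw.1)
  have hFd : DifferentiableOn ℂ F V' := fun w hw => (hV'F w hw).2.differentiableWithinAt
  have h0V' : (0 : ℂ) ∈ V' := ⟨h.zero_mem, mem_iInter.2 fun j => by simp [Complex.slitPlane]⟩
  have hreV : ∀ w ∈ V, (∀ j, 1 - w / Z j ≠ 0) → 0 < (negLogProd g Z w).re := by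
    intro w hw hne
    rw [negLogProd_re hne, neg_pos]
    exact Real.log_neg (norm_pos_iff.2 (mul_ne_zero (Complex.exp_ne_zero _)
      (Finset.prod_ne_zero_iff.2 fun j _ => hne j))) (hD w hw)
  have hBre : ∀ w ∈ V', ‖D w‖ ≤ Real.exp (-M) → M ≤ (negLogProd g Z w).re := by
    intro w hw hle
    have hne : ∀ j, 1 - w / Z j ≠ 0 := fun j =>
      Complex.slitPlane_ne_zero (mem_iInter.1 hw.2 j)
    rw [negLogProd_re hne]
    have h1 : 0 < ‖D w‖ := norm_pos_iff.2 (mul_ne_zero (Complex.exp_ne_zero _)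
      (Finset.prod_ne_zero_iff.2 fun j _ => hne j))
    have h2 := Real.log_le_log h1 hle
    rw [Real.log_exp] at h2
    linarith
  -- uniform bounds
  obtain ⟨T, hTV, hT, hTmem⟩ := h.exists_isCompact
  obtain ⟨c, hc⟩ := (isCompact_Icc (a := (-1 : ℝ)) (b := 7)).bddAbove_image
      h.lipschitz.continuous.continuousOn
  have hc : ∀ α ∈ Icc (-1 : ℝ) 7, R α ≤ c := fun α hα => hc ⟨α, hα, rfl⟩
  obtain ⟨b, hb, hbT⟩ := exists_integrable_bound_negLogProd_cpow hT (hg.continuousOn.mono hTV) hZ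
    hs0 hs1 (hV'F 0 h0V').2 hF0im c
  set Φ : ℝ → ℝ := fun α => ∫ r in Ioc 0 c, radialIntegrand g Z s R α r with hΦ
  set k : ℝ := κ * M ^ s with hk
  obtain ⟨C, hC⟩ := h.lipschitz_curve
  -- the estimate away from the slits
  have hgood : ∀ a b : ℝ, a ≤ b → Icc a b ⊆ Icc (-1) 7 → (∀ α ∈ Icc a b, ζ α ∈ V') →
      (∫ α in a..b, B.indicator (fun _ => k) α) - (-(g 0).re) ^ s * (b - a) ≤ Φ b - Φ a := by
    intro a b hab hsub hmem
    have h1 := measure_le_radial_primitive_sub hV'o hV's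
      ((Complex.differentiableOn_dslope (hV'o.mem_nhds h0V')).2 hFd) hC hab hmem hBm
      (k := k) (F₀ := (-(g 0).re) ^ s) (fun α hα hd => ?_)
    · rwa [integral_radialIntegrand_eq h hV'o hV's hFd hF0im (hc b (hsub (right_mem_Icc.2 hab)))
        (hmem b (right_mem_Icc.2 hab)), integral_radialIntegrand_eq h hV'o hV's hFd hF0im
          (hc a (hsub (left_mem_Icc.2 hab))) (hmem a (left_mem_Icc.2 hab))] at h1
    · rw [← hF0re]
      exact indicator_sub_le_im_dslope_mul_deriv h hF0im hs0 hs1 hκ0 hκ hM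
        (hV'F _ (hmem α hα)).1 (fun hα' => hBre _ (hmem α hα) hα') hd
  have hindint : ∀ a b : ℝ, IntervalIntegrable (fun α => B.indicator (fun _ => k) α) volume a b :=
    fun a b => by
      rw [intervalIntegrable_iff]
      exact (integrableOn_const (by simp [uIoc])).indicator hBm
  set m : ℝ → ℝ := fun α => ∫ x in (0 : ℝ)..α, B.indicator (fun _ => k) x with hm
  have hmc : Continuous m := intervalIntegral.continuous_primitive hindint 0
  have hmsub : ∀ a b, ∫ α in a..b, B.indicator (fun _ => k) α = m b - m a := fun a b =>
    (intervalIntegral.integral_interval_sub_left (hindint 0 b) (hindint 0 a)).symm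
  set n : ℝ → ℝ := fun α => Φ α - m α + (-(g 0).re) ^ s * α with hn
  have hngood : ∀ a b : ℝ, a ≤ b → Icc a b ⊆ Icc (-1) 7 → (∀ α ∈ Icc a b, ζ α ∈ V') →
      n a ≤ n b := by
    intro a b hab hsub hmem
    have h1 := hgood a b hab hsub hmem
    rw [hmsub] at h1
    simp only [hn]
    linarith
  have h2pi : 2 * Real.pi < 7 := by linarith [Real.pi_lt_d2]
  have hIcc : ∀ β ∈ Icc 0 (2 * Real.pi), Icc (-1 : ℝ) 7 ∈ 𝓝 β := fun β hβ =>
    Icc_mem_nhds (by linarith [hβ.1]) (by linarith [hβ.2])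
  have hgoodnear : ∀ β ∈ Icc 0 (2 * Real.pi), ∃ ε > 0, Ioo (β - ε) (β + ε) ⊆ Icc (-1) 7 ∧
      ∀ α ∈ Ioo (β - ε) (β + ε), α ≠ β → ζ α ∈ V' := by
    intro β hβ
    have h1 := eventually_ray_mem_slitPlane hZ β
    rw [eventually_nhdsWithin_iff] at h1
    obtain ⟨ε, hε, h2⟩ := Metric.eventually_nhds_iff.1 (h1.and (hIcc β hβ))
    have h3 : ∀ α ∈ Ioo (β - ε) (β + ε), dist α β < ε := fun α hα => by
      rw [Real.dist_eq, abs_lt]; constructor <;> linarith [hα.1, hα.2]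
    refine ⟨ε, hε, fun α hα => (h2 (h3 α hα)).2, fun α hα hne => ⟨h.mem α, mem_iInter.2 fun j =>
        ?_⟩⟩
    exact (h2 (h3 α hα)).1 hne _ (h.R_pos α).le j
  have hzero : ∀ β r : ℝ, 0 < r → r < R β → (∀ j, r / ‖Z j‖ ≠ 1) →
      ContinuousAt g (r * Complex.exp (β * Complex.I)) ∧
      (∀ j, 1 - r * Complex.exp (β * Complex.I) / Z j ≠ 0) ∧
      0 < (negLogProd g Z (r * Complex.exp (β * Complex.I))).re := by
    intro β r hr hrR hrZ
    have hmem := h.mem_of_le hr.le hrR.le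
    have hne : ∀ j, 1 - r * Complex.exp (β * Complex.I) / Z j ≠ 0 := by
      intro j hj
      apply hrZ j
      rw [sub_eq_zero] at hj
      rw [← norm_ofReal_mul_exp hr.le β, ← norm_div, ← hj, norm_one]
    exact ⟨hg.continuousOn.continuousAt (h.isOpen.mem_nhds hmem), hne, hreV _ hmem hne⟩
  have hleft : ∀ β ∈ Icc 0 (2 * Real.pi), ∀ᶠ y in 𝓝[<] β, n y ≤ n β := by
    intro β hβ
    obtain ⟨ε, hε, hεI, hεV⟩ := hgoodnear β hβ
    have hlim := (tendsto_integral_radialIntegrand (Z := Z) (s := s) h hg.continuousOn hb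
      hTmem hbT (β := β) (l := 𝓝[<] β) nhdsWithin_le_nhds
      (mem_nhdsWithin_of_mem_nhds (hIcc β hβ))
      (f := fun r => negLogProd g Z (r * Complex.exp (β * Complex.I)) ^ (s : ℂ))
      (fun r hr hrR hrZ => by
        obtain ⟨h1, h2, h3⟩ := hzero β r hr hrR hrZ
        exact tendsto_negLogProd_cpow_left h1 h2 h3)).2
    have hnlim : Tendsto n (𝓝[<] β) (𝓝 (n β)) :=
      (hlim.sub (hmc.continuousAt.tendsto.mono_left nhdsWithin_le_nhds)).add
        ((continuous_const.mul continuous_id).continuousAt.tendsto.mono_left nhdsWithin_le_nhds)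
    filter_upwards [Ioo_mem_nhdsLT (show β - ε < β by linarith)] with y hy
    refine ge_of_tendsto hnlim ?_
    filter_upwards [Ioo_mem_nhdsLT hy.2] with x hx
    have hxy : Icc y x ⊆ Ioo (β - ε) (β + ε) := fun z hz =>
      ⟨hy.1.trans_le hz.1, (hz.2.trans_lt hx.2).trans (by linarith)⟩
    exact hngood y x hx.1.le (hxy.trans hεI) fun α hα =>
      hεV α (hxy hα) (hα.2.trans_lt hx.2).ne
  have hright : ∀ β ∈ Icc 0 (2 * Real.pi), ∀ᶠ y in 𝓝[>] β, n β ≤ n y := by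
    intro β hβ
    obtain ⟨ε, hε, hεI, hεV⟩ := hgoodnear β hβ
    have hex : ∀ r : ℝ, ∃ z : ℂ, 0 < r → r < R β → (∀ j, r / ‖Z j‖ ≠ 1) →
        (negLogProd g Z (r * Complex.exp (β * Complex.I)) ^ (s : ℂ)).im ≤ z.im ∧
        Tendsto (fun α : ℝ => negLogProd g Z (r * Complex.exp (α * Complex.I)) ^ (s : ℂ)) (𝓝[>] β)
          (𝓝 z) := by
      intro r
      by_cases hr : 0 < r ∧ r < R β ∧ (∀ j, r / ‖Z j‖ ≠ 1)
      · obtain ⟨h1, h2, h3⟩ := hzero β r hr.1 hr.2.1 hr.2.2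
        obtain ⟨z, hz⟩ := exists_tendsto_negLogProd_cpow_right hs0 hs1 h1 h2 h3
        exact ⟨z, fun _ _ _ => hz⟩
      · exact ⟨0, fun h1 h2 h3 => absurd ⟨h1, h2, h3⟩ hr⟩
    choose f hf using hex
    have hlim := tendsto_integral_radialIntegrand (Z := Z) (s := s) h hg.continuousOn hb
      hTmem hbT (β := β) (l := 𝓝[>] β) nhdsWithin_le_nhds
      (mem_nhdsWithin_of_mem_nhds (hIcc β hβ)) (f := f)
      (fun r hr hrR hrZ => (hf r hr hrR hrZ).2)
    have hInteg := (tendsto_integral_radialIntegrand (Z := Z) (s := s) h hg.continuousOn hb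
      hTmem hbT (β := β) (l := 𝓝[<] β) nhdsWithin_le_nhds
      (mem_nhdsWithin_of_mem_nhds (hIcc β hβ))
      (f := fun r => negLogProd g Z (r * Complex.exp (β * Complex.I)) ^ (s : ℂ))
      (fun r hr hrR hrZ => by
        obtain ⟨h1, h2, h3⟩ := hzero β r hr hrR hrZ
        exact tendsto_negLogProd_cpow_left h1 h2 h3)).1
    have hΦle : Φ β ≤ ∫ r in Ioc 0 c, (Iio (R β)).indicator (fun r => (f r).im / r) r := by
      refine integral_mono_ae hInteg hlim.1 ?_
      have hcount : (range fun j => ‖Z j‖).Countable := (finite_range _).countable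
      have h1 : ∀ᵐ r : ℝ, r ∉ (range fun j => ‖Z j‖) :=
        measure_eq_zero_iff_ae_notMem.1 (hcount.measure_zero _)
      rw [EventuallyLE, ae_restrict_iff' measurableSet_Ioc]
      filter_upwards [h1] with r hr hr'
      have hrZ : ∀ j, r / ‖Z j‖ ≠ 1 := fun j hj => hr ⟨j, by
        have : ‖Z j‖ ≠ 0 := fun h => by simp [h] at hj
        exact ((div_eq_one_iff_eq this).1 hj).symm⟩
      change radialIntegrand g Z s R β r ≤ _
      unfold radialIntegrand
      by_cases hrR : r < R β
      · rw [indicator_of_mem (mem_Iio.2 hrR), indicator_of_mem (mem_Iio.2 hrR)]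
        exact div_le_div_of_nonneg_right (hf r hr'.1 hrR hrZ).1 hr'.1.le
      · rw [indicator_of_notMem (by simpa using hrR), indicator_of_notMem (by simpa using hrR)]
    have hnlim : Tendsto n (𝓝[>] β) (𝓝 ((∫ r in Ioc 0 c,
        (Iio (R β)).indicator (fun r => (f r).im / r) r) - m β + (-(g 0).re) ^ s * β)) :=
      (hlim.2.sub (hmc.continuousAt.tendsto.mono_left nhdsWithin_le_nhds)).add
        ((continuous_const.mul continuous_id).continuousAt.tendsto.mono_left nhdsWithin_le_nhds)
    filter_upwards [Ioo_mem_nhdsGT (show β < β + ε by linarith)] with y hy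
    refine le_trans (b := (∫ r in Ioc 0 c,
        (Iio (R β)).indicator (fun r => (f r).im / r) r) - m β + (-(g 0).re) ^ s * β) ?_ ?_
    · simp only [hn]
      linarith
    refine le_of_tendsto hnlim ?_
    filter_upwards [Ioo_mem_nhdsGT hy.1] with x hx
    have hxy : Icc x y ⊆ Ioo (β - ε) (β + ε) := fun z hz =>
      ⟨by linarith [hx.1, hz.1], hz.2.trans_lt hy.2⟩
    exact hngood x y hx.2.le (hxy.trans hεI) fun α hα =>
      hεV α (hxy hα) (hx.1.trans_le hα.1).ne'
  have hfinal := le_of_forall_eventually_le Real.two_pi_pos.le hleft hright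
  have hΦ2 : Φ (2 * Real.pi) = Φ 0 := by
    simp only [hΦ, radialIntegrand_two_pi h]
  have hm0 : m 0 = 0 := by simp [hm]
  have hm2 : m (2 * Real.pi) = k * (volume (B ∩ Ioc 0 (2 * Real.pi))).toReal := by
    simp only [hm]
    rw [intervalIntegral.integral_of_le Real.two_pi_pos.le, integral_indicator hBm,
        setIntegral_const,
      measureReal_restrict_apply hBm, smul_eq_mul, mul_comm, measureReal_def]
  simp only [hn, hΦ2, hm0, hm2] at hfinal
  linarith

end

theorem exists_eq_mul_prod_of_zeros_subset {V K : Set ℂ} (hV : IsOpen V) (F : Finset ℂ) :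
    ∀ D : ℂ → ℂ, DifferentiableOn ℂ D V → (∀ z ∈ V, ¬ ∀ᶠ w in 𝓝 z, D w = 0) → D 0 ≠ 0 →
      (∀ z ∈ K, D z = 0 → z ∈ F) → (↑F ⊆ V) →
      ∃ (ι : Type) (_ : Fintype ι) (Z : ι → ℂ) (u : ℂ → ℂ), (∀ j, Z j ≠ 0) ∧
        DifferentiableOn ℂ u V ∧ (∀ z ∈ K, u z ≠ 0) ∧
        ∀ w ∈ V, D w = u w * ∏ j, (1 - w / Z j) := by
  classical
  induction F using Finset.induction_on with
  | empty =>
    intro D hD _ _ hz _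
    exact ⟨Empty, inferInstance, Empty.elim, D, fun j => j.elim, hD,
      fun z hz1 hz2 => by simpa using hz z hz1 hz2, fun w _ => by simp⟩
  | insert z F hzF ih =>
    intro D hD hne h0 hz hFV
    have hzV : z ∈ V := hFV (by simp)
    have hFV' : (F : Set ℂ) ⊆ V := fun x hx => hFV (by simp [Finset.mem_coe.1 hx])
    by_cases hDz : D z = 0
    swap
    · refine ih D hD hne h0 (fun x hx hx0 => ?_) hFV'
      rcases Finset.mem_insert.1 (hz x hx hx0) with rfl | h
      · exact absurd hx0 hDz
      · exact h
    have hz0 : z ≠ 0 := by rintro rfl; exact h0 hDz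
    have han : AnalyticAt ℂ D z := hD.analyticAt (hV.mem_nhds hzV)
    obtain ⟨n, g, hg, hgz, hDg⟩ := han.exists_eventuallyEq_pow_smul_nonzero_iff.2 (hne z hzV)
    set h : ℂ → ℂ := Function.update (fun w => D w / (w - z) ^ n) z (g z) with hh
    have hhg : h =ᶠ[𝓝 z] g := by
      filter_upwards [hDg] with w hw
      rcases eq_or_ne w z with rfl | hwz
      · simp [hh]
      · rw [hh, Function.update_of_ne hwz, hw, smul_eq_mul,
          mul_div_cancel_left₀ _ (pow_ne_zero _ (sub_ne_zero.2 hwz))]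
    have hDh : ∀ w, D w = (w - z) ^ n * h w := by
      intro w
      rcases eq_or_ne w z with rfl | hwz
      · rw [hh, Function.update_self]; simpa using hDg.self_of_nhds
      · rw [hh, Function.update_of_ne hwz, mul_div_cancel₀ _ (pow_ne_zero _ (sub_ne_zero.2 hwz))]
    have hdiff : DifferentiableOn ℂ h V := by
      intro w hw
      rcases eq_or_ne w z with rfl | hwz
      · exact ((hg.congr hhg.symm).differentiableAt).differentiableWithinAt
      · have h1 : DifferentiableAt ℂ (fun w => D w / (w - z) ^ n) w :=
          (hD.differentiableAt (hV.mem_nhds hw)).div (by fun_prop)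
            (pow_ne_zero _ (sub_ne_zero.2 hwz))
        refine (h1.congr_of_eventuallyEq ?_).differentiableWithinAt
        filter_upwards [isOpen_ne.mem_nhds hwz] with y hy
        rw [hh, Function.update_of_ne hy]
    have hhz : h z ≠ 0 := by rw [hh, Function.update_self]; exact hgz
    obtain ⟨ι, _, Z, u, hZ, hu, huK, hfac⟩ := ih h hdiff
      (fun x hx hx0 => hne x hx (hx0.mono fun w hw => by rw [hDh, hw, mul_zero]))
      (fun h1 => h0 (by rw [hDh, h1, mul_zero]))
      (fun x hx hx0 => by
        rcases Finset.mem_insert.1 (hz x hx (by rw [hDh, hx0, mul_zero])) with rfl | h1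
        · exact absurd hx0 hhz
        · exact h1) hFV'
    refine ⟨ι ⊕ Fin n, inferInstance, Sum.elim Z fun _ => z, fun w => u w * (-z) ^ n, ?_,
      hu.mul_const _, fun x hx => mul_ne_zero (huK x hx) (pow_ne_zero _ (neg_ne_zero.2 hz0)), ?_⟩
    · rintro (j | j)
      · exact hZ j
      · exact hz0
    · intro w hw
      rw [hDh, hfac w hw, Fintype.prod_sum_type]
      simp only [Sum.elim_inl, Sum.elim_inr, Finset.prod_const, Finset.card_univ, Fintype.card_fin]
      have : w - z = -z * (1 - w / z) := by field_simp; ring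
      rw [this, mul_pow]
      ring

theorem finite_zeros_of_isCompact {V K : Set ℂ} {D : ℂ → ℂ}
    (hK : IsCompact K) (hKV : K ⊆ V) (hV : IsOpen V) (hD : DifferentiableOn ℂ D V)
    (hne : ∀ z ∈ V, ¬ ∀ᶠ w in 𝓝 z, D w = 0) : {z ∈ K | D z = 0}.Finite := by
  by_contra hinf
  obtain ⟨z, hz, hacc⟩ := Set.Infinite.exists_accPt_of_subset_isCompact hinf hK (fun z hz => hz.1)
  have han : AnalyticAt ℂ D z := hD.analyticAt (hV.mem_nhds (hKV hz))
  rcases han.eventually_eq_zero_or_eventually_ne_zero with h | h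
  · exact hne z (hKV hz) h
  · rw [accPt_iff_frequently_nhdsNE] at hacc
    obtain ⟨w, hw1, hw2⟩ := (hacc.and_eventually h).exists
    exact hw2 hw1.2

/-- A bounded-away-from-the-boundary factorization of a holomorphic function on a star-shaped
domain into linear factors and an exponential. -/
theorem exists_eq_exp_mul_prod {V K V' : Set ℂ} {D : ℂ → ℂ} (hV : IsOpen V)
    (hVs : StarConvex ℝ 0 V) (hK : IsCompact K) (hKV : K ⊆ V) (hV'K : V' ⊆ K) (hV' : IsOpen V')
    (hV's : StarConvex ℝ 0 V') (h0 : 0 ∈ V') (hD : DifferentiableOn ℂ D V)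
    (hD0 : (D 0).im = 0) (hD0' : 0 < (D 0).re) :
    ∃ (ι : Type) (_ : Fintype ι) (Z : ι → ℂ) (g : ℂ → ℂ), (∀ j, Z j ≠ 0) ∧
      DifferentiableOn ℂ g V' ∧ g 0 = Real.log (D 0).re ∧
      ∀ w ∈ V', D w = Complex.exp (g w) * ∏ j, (1 - w / Z j) := by
  have h0V : (0:ℂ) ∈ V := hKV (hV'K h0)
  have hD00 : D 0 ≠ 0 := fun h => by rw [h] at hD0'; simp at hD0'
  have hne : ∀ z ∈ V, ¬ ∀ᶠ w in 𝓝 z, D w = 0 := by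
    intro z hz h
    exact hD00 ((hD.analyticOnNhd hV).eqOn_zero_of_preconnected_of_eventuallyEq_zero
      (hVs.isPathConnected h0V).isConnected.isPreconnected hz h h0V)
  have hfin := finite_zeros_of_isCompact hK hKV hV hD hne
  obtain ⟨ι, _, Z, u, hZ, hu, huK, hfac⟩ := exists_eq_mul_prod_of_zeros_subset (K := K) hV
    hfin.toFinset D hD hne hD00 (fun z hz hz0 => by simpa using ⟨hz, hz0⟩)
    (fun z hz => hKV (by simpa using (hfin.mem_toFinset.1 (Finset.mem_coe.1 hz)).1))
  have hu' : DifferentiableOn ℂ u V' := hu.mono (hV'K.trans hKV)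
  have hu0 : u 0 = D 0 := by rw [hfac 0 h0V]; simp
  have hq : DifferentiableOn ℂ (fun w => deriv u w / u w) V' :=
    (hu'.deriv hV').div hu' fun w hw => huK w (hV'K hw)
  set G : ℂ → ℂ := fun w => ∫ t in (0:ℝ)..1, (deriv u (t*w) / u (t*w))*w with hG
  have hGd : ∀ w ∈ V', HasDerivAt G (deriv u w / u w) w := fun w hw =>
    hasDerivAt_radial_primitive hV' hV's hq hw
  have hG0 : G 0 = 0 := by simp [hG]
  have hval : ((D 0).re : ℂ) = D 0 := by apply Complex.ext <;> simp [hD0]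
  refine ⟨ι, inferInstance, Z, fun w => G w + Real.log (D 0).re, hZ,
    fun w hw => ((hGd w hw).differentiableAt.add_const _).differentiableWithinAt, by simp [hG0],
    fun w hw => ?_⟩
  rw [hfac w (hKV (hV'K hw))]
  congr 1
  have hcst : ∀ w ∈ V', HasDerivAt (fun w => u w * Complex.exp (-G w)) 0 w := by
    intro w hw
    have h1 := (hu'.differentiableAt (hV'.mem_nhds hw)).hasDerivAt.mul (hGd w hw).neg.cexp
    refine h1.congr_deriv ?_
    have := huK w (hV'K hw)
    field_simp
    ring
  have hpre : IsPreconnected V' := (hV's.isPathConnected h0).isConnected.isPreconnected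
  have := hV'.is_const_of_deriv_eq_zero hpre
    (fun w hw => (hcst w hw).differentiableAt.differentiableWithinAt)
    (fun w hw => (hcst w hw).deriv) hw h0
  simp only [hG0, neg_zero, Complex.exp_zero, mul_one, hu0] at this
  rw [Complex.exp_add, ← Complex.ofReal_exp, Real.exp_log hD0', hval, ← this, Complex.exp_neg]
  field_simp

theorem exists_exponent_half_le (a : ℝ) : ∃ s : ℝ, 0 < s ∧ s < 1 ∧
    1 / 2 ≤ Real.cos (s * (Real.pi / 2)) - a * Real.sin (s * (Real.pi / 2)) := by
  have h1 : Tendsto (fun s : ℝ => Real.cos (s * (Real.pi / 2)) - a * Real.sin (s * (Real.pi / 2)))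
      (𝓝[>] 0) (𝓝 1) := by
    have : Continuous
      (fun s : ℝ => Real.cos (s * (Real.pi / 2)) - a * Real.sin (s * (Real.pi / 2))) := by fun_prop
    simpa using (this.tendsto 0).mono_left nhdsWithin_le_nhds
  have h2 := (h1.eventually (lt_mem_nhds (by norm_num : (1/2:ℝ) < 1))).and
    (Ioo_mem_nhdsGT (by norm_num : (0:ℝ) < 1))
  obtain ⟨s, hs, hs1⟩ := h2.exists
  exact ⟨s, hs1.1, hs1.2, hs.le⟩

theorem measure_norm_dilate_le {V : Set ℂ} {R : ℝ → ℝ} {L : ℝ≥0} {ρ s η M : ℝ} {D : ℂ → ℂ}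
    (h : ∀ η ∈ Ioo (0:ℝ) 1, IsStarCurve V (fun α => η * R α) (η.toNNReal * L) (η * ρ))
    (hball : ∀ v ∈ ball (0:ℂ) ρ, StarConvex ℝ v V) (hbdd : Bornology.IsBounded V)
    (hD : DifferentiableOn ℂ D V) (hD1 : ∀ w ∈ V, ‖D w‖ < 1) (hD0 : D 0 ≠ 0)
    (hs0 : 0 < s) (hs1 : s < 1)
    (hκ : 1 / 2 ≤ Real.cos (s * (Real.pi / 2)) - (L / ρ) * Real.sin (s * (Real.pi / 2)))
    (hM : 0 < M) (hη0 : 0 < η) (hη1 : η < 1) :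
    1 / 2 * M ^ s * (volume ({α : ℝ | ‖D ((η * R α : ℝ) * Complex.exp (α * Complex.I))‖ ≤
      Real.exp (-M)} ∩ Ioc 0 (2 * Real.pi))).toReal ≤ 2 * Real.pi * (-Real.log ‖D 0‖) ^ s := by
  obtain ⟨η', h1, h2⟩ := exists_between hη1
  have hη' : 0 < η' := hη0.trans h1
  have hi := h η ⟨hη0, hη1⟩
  have hρ : 0 < ρ := pos_of_mul_pos_right hi.pos hη0.le
  have hη'c : (η' : ℂ) ≠ 0 := by exact_mod_cast hη'.ne'
  set V' : Set ℂ := {w | w / η' ∈ V} with hV'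
  set K : Set ℂ := (fun w : ℂ => η' * w) '' closure V with hK
  have hKc : IsCompact K := hbdd.isCompact_closure.image (by fun_prop)
  have hV'K : V' ⊆ K := fun w hw => ⟨w / η', subset_closure hw, by field_simp⟩
  have hKV : K ⊆ V := by
    rintro _ ⟨x, hx, rfl⟩
    obtain ⟨y, hy, hxy⟩ := Metric.mem_closure_iff.1 hx ((1 - η') * ρ)
      (mul_pos (by linarith) hρ)
    have h3 : (η' / (1 - η') : ℝ) • (x - y) ∈ ball (0:ℂ) ρ := by
      rw [mem_ball_zero_iff, norm_smul, Real.norm_of_nonneg (div_nonneg hη'.le (by linarith)),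
        div_mul_eq_mul_div, div_lt_iff₀ (by linarith), ← dist_eq_norm]
      have := dist_nonneg (x := x) (y := y)
      nlinarith
    have h4 := hball _ h3 hy (a := 1 - η') (b := η') (by linarith) hη'.le (by ring)
    convert h4 using 1
    simp only [smul_smul]
    rw [mul_div_cancel₀ _ (by linarith : (1 - η') ≠ 0), smul_sub]
    simp
  have hV'o : IsOpen V' := hi.isOpen.preimage (by fun_prop)
  have hV's : StarConvex ℝ 0 V' := by
    rw [starConvex_zero_iff]
    intro x hx a ha ha1
    have := (starConvex_zero_iff.1 hi.starConvex) hx ha ha1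
    change a • x / η' ∈ V
    convert this using 1
    simp [mul_div_assoc]
  have h0' : (0:ℂ) ∈ V' := by change (0:ℂ) / η' ∈ V; simpa using hi.zero_mem
  have hn0 : 0 < ‖D 0‖ := norm_pos_iff.2 hD0
  set c : ℂ := (starRingEnd ℂ (D 0)) / ‖D 0‖ with hc
  have hc1 : ‖c‖ = 1 := by
    rw [hc, norm_div, RCLike.norm_conj, Complex.norm_real, norm_norm, div_self hn0.ne']
  have hcD : c * D 0 = (‖D 0‖ : ℂ) := by
    have hn : (‖D 0‖ : ℂ) ≠ 0 := by exact_mod_cast hn0.ne'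
    rw [hc, div_mul_eq_mul_div, div_eq_iff hn, Complex.conj_mul']
    ring
  obtain ⟨ι, _, Z, g, hZ, hg, hg0, hfac⟩ := exists_eq_exp_mul_prod (D := fun w => c * D w)
    hi.isOpen hi.starConvex hKc hKV hV'K hV'o hV's h0' (hD.const_mul c)
    (by simp [hcD]) (by simpa [hcD] using hn0)
  simp only [hcD, Complex.ofReal_re] at hg0
  have hstar : IsStarCurve V' (fun α => η * R α) (η.toNNReal * L) (η * ρ) :=
    { hi with
      isOpen := hV'o
      starConvex := hV's
      mem := fun α => by
        have := (h (η / η') ⟨div_pos hη0 hη', (div_lt_one hη').2 h1⟩).mem α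
        change _ / _ ∈ V
        convert this using 1
        push_cast
        ring }
  have key := hstar.measure_norm_le_exp_neg (g := g) (Z := Z) (s := s) (κ := 1/2) (M := M)
    hg (by rw [hg0]; exact Complex.ofReal_im _) hZ
    (fun w hw => by
      rw [← hfac w hw, norm_mul, hc1, one_mul]
      exact hD1 w (hKV (hV'K hw))) hs0 hs1 (by norm_num) (by
      refine hκ.trans_eq ?_
      congr 2
      rw [NNReal.coe_mul, Real.coe_toNNReal _ hη0.le]
      field_simp) hM
  rw [hg0, Complex.ofReal_re] at key
  refine le_trans (le_of_eq ?_) key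
  congr 5
  ext α
  rw [← hfac _ (hstar.mem α), norm_mul, hc1, one_mul]

/-- Under the hypotheses of a star curve, a bounded holomorphic function whose radial limits vanish
on a set of directions of positive measure is zero at the centre. -/
theorem volume_radial_limit_eq_zero {V : Set ℂ} {R : ℝ → ℝ} {L : ℝ≥0} {ρ : ℝ} {D : ℂ → ℂ}
    (h : ∀ η ∈ Ioo (0:ℝ) 1, IsStarCurve V (fun α => η * R α) (η.toNNReal * L) (η * ρ))
    (hball : ∀ v ∈ ball (0:ℂ) ρ, StarConvex ℝ v V) (hbdd : Bornology.IsBounded V)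
    (hD : DifferentiableOn ℂ D V) (hD1 : ∀ w ∈ V, ‖D w‖ < 1) (hD0 : D 0 ≠ 0) :
    volume ({α : ℝ | Tendsto (fun t : ℝ => D ((t * R α : ℝ) * Complex.exp (α * Complex.I)))
      (𝓝[<] 1) (𝓝 0)} ∩ Ioc 0 (2 * Real.pi)) = 0 := by
  obtain ⟨s, hs0, hs1, hs⟩ := exists_exponent_half_le (L / ρ)
  set A := {α : ℝ | Tendsto (fun t : ℝ => D ((t * R α : ℝ) * Complex.exp (α * Complex.I)))
      (𝓝[<] 1) (𝓝 0)} ∩ Ioc 0 (2 * Real.pi) with hA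
  set c := 2 * (2 * Real.pi * (-Real.log ‖D 0‖) ^ s) with hc
  have hmain : ∀ M : ℝ, 0 < M → volume A ≤ ENNReal.ofReal (c / M ^ s) := by
    intro M hM
    set η : ℕ → ℝ := fun n => 1 - 1 / ((n : ℝ) + 2) with hη
    have hη0 : ∀ n, 0 < η n := fun n => by
      have : 1 / ((n:ℝ) + 2) < 1 := by
        rw [div_lt_one (by positivity)]
        linarith [n.cast_nonneg (α := ℝ)]
      simp only [hη]; linarith
    have hη1 : ∀ n, η n < 1 := fun n => by
      have : 0 < 1 / ((n:ℝ) + 2) := by positivity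
      simp only [hη]; linarith
    have hηt : Tendsto η atTop (𝓝[<] 1) := by
      refine tendsto_nhdsWithin_iff.2 ⟨?_, Eventually.of_forall hη1⟩
      have : Tendsto (fun n : ℕ => 1 / ((n:ℝ) + 2)) atTop (𝓝 0) := by
        simpa using ((tendsto_natCast_atTop_atTop (R := ℝ)).atTop_add
          (tendsto_const_nhds (x := (2:ℝ)))).const_div_atTop 1
      simpa [hη] using this.const_sub 1
    set B : ℕ → Set ℝ := fun n => {α : ℝ | ‖D ((η n * R α : ℝ) * Complex.exp (α * Complex.I))‖ ≤
      Real.exp (-M)} ∩ Ioc 0 (2 * Real.pi) with hB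
    have hsub : A ⊆ ⋃ N, ⋂ n ≥ N, B n := by
      intro α hα
      have h1 : ∀ᶠ n in atTop, ‖D ((η n * R α : ℝ) * Complex.exp (α * Complex.I))‖ < Real.exp
          (-M) := by
        have h2 := (hα.1.comp hηt).norm
        rw [norm_zero] at h2
        exact h2.eventually (gt_mem_nhds (Real.exp_pos _))
      obtain ⟨N, hN⟩ := eventually_atTop.1 h1
      exact mem_iUnion.2 ⟨N, mem_iInter₂.2 fun n hn => ⟨(hN n hn).le, hα.2⟩⟩
    have hBle : ∀ n, volume (B n) ≤ ENNReal.ofReal (c / M ^ s) := by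
      intro n
      have h1 := measure_norm_dilate_le h hball hbdd hD hD1 hD0 hs0 hs1 hs hM (hη0 n) (hη1 n)
      have hfin : volume (B n) ≠ ⊤ :=
        ((measure_mono inter_subset_right).trans_lt measure_Ioc_lt_top).ne
      rw [← ENNReal.ofReal_toReal hfin]
      apply ENNReal.ofReal_le_ofReal
      rw [le_div_iff₀ (by positivity)]
      simp only [hB, hc]
      linarith
    refine (measure_mono hsub).trans ?_
    rw [Monotone.measure_iUnion (fun N N' hN => biInter_subset_biInter_left fun n hn => le_trans hN
        hn)]
    exact iSup_le fun N => (measure_mono (biInter_subset_of_mem (le_refl N))).trans (hBle N)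
  have hlim : Tendsto (fun M : ℝ => ENNReal.ofReal (c / M ^ s)) atTop (𝓝 0) := by
    rw [← ENNReal.ofReal_zero]
    exact ENNReal.tendsto_ofReal ((tendsto_rpow_atTop hs0).const_div_atTop c)
  exact le_antisymm (ge_of_tendsto hlim ((eventually_gt_atTop 0).mono hmain)) bot_le

/-- A bounded holomorphic function whose radial limits vanish at a set of boundary points, each
being the vertex of a cone over a fixed disc contained in the domain, vanishes at the centre unless
the set of boundary points has null projection. -/
theorem volume_re_image_eq_zero {P Ω : Set ℂ} {D : ℂ → ℂ} {ρ Rm C : ℝ} 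
    (hD : DifferentiableOn ℂ D Ω) (hρ : 0 < ρ) (h1 : ∀ b ∈ P, ‖b‖ ≤ Rm) (h2 : ∀ b ∈ P, b ∉ Ω)
    (h3 : ∀ b ∈ P, ∀ t ∈ Ico (0:ℝ) 1, ∀ v ∈ ball (0:ℂ) ρ, t * b + (1 - t) * v ∈ Ω)
    (h4 : ∀ b ∈ P, ∀ t ∈ Ico (0:ℝ) 1, ∀ v ∈ ball (0:ℂ) ρ, ‖D (t * b + (1 - t) * v)‖ ≤ C)
    (h5 : ∀ b ∈ P, Tendsto (fun t : ℝ => D (t * b)) (𝓝[<] 1) (𝓝 0)) (h6 : D 0 ≠ 0) :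
    volume (Complex.re '' P) = 0 := by
  rcases P.eq_empty_or_nonempty with rfl | ⟨b0, hb0⟩
  · simp
  have hρb : ∀ b ∈ P, ρ ≤ ‖b‖ := by
    intro b hb
    by_contra! h
    have := h3 b hb 0 (by simp) b (by simpa using h)
    simp only [Complex.ofReal_zero, zero_mul, sub_zero, one_mul, zero_add] at this
    exact h2 b hb this
  have hRm : 0 < Rm := hρ.trans_le ((hρb b0 hb0).trans (h1 b0 hb0))
  set V : Set ℂ := ⋃ b ∈ P, ⋃ t ∈ Ico (0:ℝ) 1, ball (t * b) ((1 - t) * ρ) with hV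
  have hVrep : ∀ w ∈ V, ∃ b ∈ P, ∃ t ∈ Ico (0:ℝ) 1, ∃ v ∈ ball (0:ℂ) ρ,
      w = t * b + (1 - t) * v := by
    intro w hw
    simp only [hV, mem_iUnion] at hw
    obtain ⟨b, hb, t, ht, hw⟩ := hw
    have ht1 : (0:ℝ) < 1 - t := by linarith [ht.2]
    have ht1' : (1 - t : ℂ) ≠ 0 := by exact_mod_cast ht1.ne'
    refine ⟨b, hb, t, ht, (w - t * b) / (1 - t), ?_, by field_simp; ring⟩
    rw [mem_ball_zero_iff, norm_div]
    have : ‖(1 - t : ℂ)‖ = 1 - t := by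
      rw [← Complex.ofReal_one, ← Complex.ofReal_sub, Complex.norm_real, Real.norm_of_nonneg ht1.le]
    rw [this, div_lt_iff₀ ht1, mul_comm ρ, ← dist_eq_norm]
    exact hw
  have hrepV : ∀ b ∈ P, ∀ t ∈ Ico (0:ℝ) 1, ∀ v ∈ ball (0:ℂ) ρ, t * b + (1 - t) * v ∈ V := by
    intro b hb t ht v hv
    simp only [hV, mem_iUnion]
    refine ⟨b, hb, t, ht, ?_⟩
    have ht1 : (0:ℝ) < 1 - t := by linarith [ht.2]
    rw [mem_ball, dist_eq_norm, add_sub_cancel_left, norm_mul, ← Complex.ofReal_one,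
      ← Complex.ofReal_sub, Complex.norm_real, Real.norm_of_nonneg ht1.le]
    exact mul_lt_mul_of_pos_left (by simpa using hv) ht1
  have hVo : IsOpen V := isOpen_biUnion fun b _ => isOpen_biUnion fun t _ => isOpen_ball
  have hVΩ : V ⊆ Ω := by
    intro w hw
    obtain ⟨b, hb, t, ht, v, hv, rfl⟩ := hVrep w hw
    exact h3 b hb t ht v hv
  have hVC : ∀ w ∈ V, ‖D w‖ ≤ C := by
    intro w hw
    obtain ⟨b, hb, t, ht, v, hv, rfl⟩ := hVrep w hw
    exact h4 b hb t ht v hv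
  have hball : ∀ v ∈ ball (0:ℂ) ρ, StarConvex ℝ v V := by
    intro v hv w hw a c ha hc hac
    obtain ⟨b, hb, t, ht, v', hv', rfl⟩ := hVrep w hw
    have hct : c * t < 1 := by nlinarith [ht.1, ht.2]
    have h1ct : 0 < 1 - c * t := by linarith
    have h1ct' : (1 - c * t : ℂ) ≠ 0 := by exact_mod_cast h1ct.ne'
    have hv'' := (convex_ball (0:ℂ) ρ) hv hv' (a := a / (1 - c * t)) (b := c * (1 - t) / (1 - c *
        t))
      (by positivity) (div_nonneg (mul_nonneg hc (by linarith [ht.2])) h1ct.le) (by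
        rw [← add_div, div_eq_one_iff_eq h1ct.ne']; linarith)
    have := hrepV b hb (c * t) ⟨mul_nonneg hc ht.1, hct⟩ _ hv''
    convert this using 1
    simp only [Complex.real_smul]
    push_cast
    field_simp
    ring
  have hVb : V ⊆ closedBall 0 (Rm + ρ) := by
    intro w hw
    obtain ⟨b, hb, t, ht, v, hv, rfl⟩ := hVrep w hw
    rw [mem_closedBall_zero_iff]
    refine (norm_add_le _ _).trans (add_le_add ?_ ?_)
    · rw [norm_mul, Complex.norm_real, Real.norm_of_nonneg ht.1]
      nlinarith [ht.2, ht.1, h1 b hb, norm_nonneg b]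
    · rw [norm_mul, ← Complex.ofReal_one, ← Complex.ofReal_sub, Complex.norm_real,
        Real.norm_of_nonneg (by linarith [ht.2])]
      have := mem_ball_zero_iff.1 hv
      nlinarith [ht.1, norm_nonneg v]
  set Λ : ℝ := Rm ^ 2 / ρ with hΛ
  have hΛ0 : 0 < Λ := by positivity
  have : Nonempty P := ⟨⟨b0, hb0⟩⟩
  set φ : P → ℝ → ℝ := fun b α => ‖(b:ℂ)‖ - Λ * ‖Complex.exp (α * Complex.I) - b / ‖(b:ℂ)‖‖ with hφ
  have hφb : ∀ α, BddAbove (range fun b => φ b α) := by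
    intro α
    refine ⟨Rm, ?_⟩
    rintro _ ⟨b, rfl⟩
    have : 0 ≤ Λ * ‖Complex.exp (α * Complex.I) - b / ‖(b:ℂ)‖‖ := by positivity
    have := h1 b b.2
    simp only [hφ]
    linarith
  set R : ℝ → ℝ := fun α => max (ρ / 2) (⨆ b, φ b α) with hR
  have hexpL : ∀ x y : ℝ, ‖Complex.exp (x * Complex.I) - Complex.exp (y * Complex.I)‖ ≤ |x -
      y| := by
    intro x y
    have e : Complex.exp (x * Complex.I) - Complex.exp (y * Complex.I) =
        Complex.exp (y * Complex.I) * (Complex.exp (Complex.I * (x - y : ℝ)) - 1) := by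
      rw [mul_sub, ← Complex.exp_add, mul_one]
      congr 2
      push_cast
      ring
    rw [e, norm_mul, Complex.norm_exp_ofReal_mul_I, one_mul]
    exact Real.norm_exp_I_mul_ofReal_sub_one_le
  have hφL : ∀ (b : P) (x y : ℝ), φ b x ≤ φ b y + Λ * |x - y| := by
    intro b x y
    have e1 := norm_sub_le_norm_sub_add_norm_sub (Complex.exp (y * Complex.I))
      (Complex.exp (x * Complex.I)) ((b:ℂ) / ‖(b:ℂ)‖)
    have e2 := hexpL y x
    rw [abs_sub_comm] at e2
    simp only [hφ]
    nlinarith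
  have hRL : LipschitzWith Λ.toNNReal R := by
    refine LipschitzWith.of_le_add_mul _ fun x y => ?_
    rw [Real.coe_toNNReal _ hΛ0.le, Real.dist_eq]
    have : 0 ≤ Λ * |x - y| := by positivity
    refine max_le ?_ (ciSup_le fun b => ?_)
    · have := le_max_left (ρ / 2) (⨆ b, φ b y)
      simp only [hR]; linarith
    · have e1 := (le_ciSup (hφb y) b).trans (le_max_right (ρ / 2) _)
      have e2 := hφL b x y
      simp only [hR]
      linarith
  have hRmem : ∀ α r : ℝ, 0 ≤ r → r < R α → (r : ℂ) * Complex.exp (α * Complex.I) ∈ V := by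
    intro α r hr0 hr
    rcases lt_max_iff.1 hr with h | h
    · have := hrepV b0 hb0 0 (by simp) (r * Complex.exp (α * Complex.I)) (by
        rw [mem_ball_zero_iff, norm_mul, Complex.norm_exp_ofReal_mul_I, Complex.norm_real,
          Real.norm_of_nonneg hr0]
        linarith)
      simpa using this
    · obtain ⟨⟨b, hb⟩, hb'⟩ := exists_lt_of_lt_ciSup h
      simp only [hφ] at hb'
      have hbρ := hρb b hb
      have hbR := h1 b hb
      have hb0' : 0 < ‖b‖ := hρ.trans_le hbρ
      have hb0c : (‖b‖ : ℂ) ≠ 0 := by exact_mod_cast hb0'.ne'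
      have hnn : 0 ≤ ‖Complex.exp (α * Complex.I) - b / ‖b‖‖ := norm_nonneg _
      have hrb : r < ‖b‖ := by nlinarith
      simp only [hV, mem_iUnion]
      refine ⟨b, hb, r / ‖b‖, ⟨by positivity, (div_lt_one hb0').2 hrb⟩, ?_⟩
      rw [mem_ball, dist_eq_norm]
      have e : (r:ℂ) * Complex.exp (α * Complex.I) - ((r / ‖b‖ : ℝ) : ℂ) * b =
          r * (Complex.exp (α * Complex.I) - b / ‖b‖) := by
        push_cast; ring
      rw [e, norm_mul, Complex.norm_real, Real.norm_of_nonneg hr0]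
      have e3 : Λ * ρ = Rm ^ 2 := by rw [hΛ]; field_simp
      have e4 : (1 - r / ‖b‖) * ρ = (‖b‖ - r) * ρ / ‖b‖ := by field_simp
      rw [e4, lt_div_iff₀ hb0']
      set q := ‖Complex.exp (α * Complex.I) - b / ‖b‖‖
      have e5 : r * q * ‖b‖ ≤ Rm ^ 2 * q := by
        have : r * ‖b‖ ≤ Rm ^ 2 := by nlinarith
        nlinarith
      have e6 : Λ * q * ρ < (‖b‖ - r) * ρ := by nlinarith
      nlinarith
  have hRper : Function.Periodic R (2 * Real.pi) := by
    intro α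
    simp only [hR, hφ]
    have : Complex.exp ((α + 2 * Real.pi : ℝ) * Complex.I) = Complex.exp (α * Complex.I) := by
      push_cast
      rw [add_mul, Complex.exp_add, Complex.exp_two_pi_mul_I, mul_one]
    rw [this]
  have hstar : ∀ η ∈ Ioo (0:ℝ) 1,
      IsStarCurve V (fun α => η * R α) (η.toNNReal * Λ.toNNReal) (η * (ρ / 2)) := by
    intro η hη
    exact
    { isOpen := hVo
      starConvex := hball 0 (mem_ball_self hρ)
      lipschitz := by
        refine LipschitzWith.of_dist_le_mul fun x y => ?_
        rw [Real.dist_eq, ← mul_sub, abs_mul, abs_of_pos hη.1, ← Real.dist_eq, NNReal.coe_mul,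
          Real.coe_toNNReal _ hη.1.le, mul_assoc]
        exact mul_le_mul_of_nonneg_left (hRL.dist_le_mul x y) hη.1.le
      periodic := fun x => by simp only [hRper x]
      pos := mul_pos hη.1 (by positivity)
      le := fun α => mul_le_mul_of_nonneg_left (le_max_left _ _) hη.1.le
      mem := fun α => hRmem α _ (mul_nonneg hη.1.le (le_trans (by positivity) (le_max_left _ _)))
        (by
          have : 0 < R α := lt_of_lt_of_le (by positivity) (le_max_left _ _)
          nlinarith [hη.2]) }
  have hC : 0 < C + 1 := by
    have := (norm_nonneg _).trans (hVC 0 (by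
      have := hrepV b0 hb0 0 (by simp) 0 (mem_ball_self hρ); simpa using this))
    linarith
  have hCc : ((C + 1 : ℝ) : ℂ) ≠ 0 := by exact_mod_cast hC.ne'
  have hnull := volume_radial_limit_eq_zero (D := fun w => D w / ((C + 1 : ℝ) : ℂ)) hstar
    (fun v hv => hball v (ball_subset_ball (by linarith) hv))
    (isBounded_closedBall.subset hVb) ((hD.mono hVΩ).div_const _) (fun w hw => by
      rw [norm_div, Complex.norm_real, Real.norm_of_nonneg hC.le, div_lt_one hC]
      linarith [hVC w hw]) (div_ne_zero h6 hCc)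
  set A := {α : ℝ | Tendsto (fun t : ℝ => D ((t * R α : ℝ) * Complex.exp (α * Complex.I)) /
    ((C + 1 : ℝ) : ℂ)) (𝓝[<] 1) (𝓝 0)} ∩ Ioc 0 (2 * Real.pi) with hA
  have hsub : Complex.re '' P ⊆ (fun α => R α * Real.cos α) '' A := by
    rintro _ ⟨b, hb, rfl⟩
    have hbn : 0 < ‖b‖ := hρ.trans_le (hρb b hb)
    obtain ⟨α, hα, hαe⟩ : ∃ α ∈ Ioc 0 (2 * Real.pi), (‖b‖ : ℂ) * Complex.exp (α * Complex.I) =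
        b := by
      refine ⟨toIocMod Real.two_pi_pos 0 b.arg,
        by simpa using toIocMod_mem_Ioc Real.two_pi_pos 0 b.arg, ?_⟩
      conv_rhs => rw [← Complex.norm_mul_exp_arg_mul_I b]
      congr 1
      rw [toIocMod]
      have := Complex.exp_periodic.sub_zsmul_eq (x := b.arg * Complex.I) (toIocDiv Real.two_pi_pos
          0 b.arg)
      rw [← this]
      congr 1
      simp only [zsmul_eq_mul]
      push_cast
      ring
    have hRα : R α = ‖b‖ := by
      apply le_antisymm
      · by_contra! h
        have := hVΩ (hRmem α ‖b‖ hbn.le h)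
        rw [hαe] at this
        exact h2 b hb this
      · refine le_trans ?_ ((le_ciSup (hφb α) ⟨b, hb⟩).trans (le_max_right _ _))
        have hb0c : (‖b‖ : ℂ) ≠ 0 := by exact_mod_cast hbn.ne'
        have : Complex.exp (α * Complex.I) - b / ‖b‖ = 0 := by
          rw [sub_eq_zero, eq_div_iff hb0c, mul_comm]; exact hαe
        simp only [hφ]
        rw [this]
        simp
    refine ⟨α, ⟨?_, hα⟩, ?_⟩
    · have := (h5 b hb).div_const ((C + 1 : ℝ) : ℂ)
      rw [zero_div] at this
      refine this.congr fun t => ?_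
      rw [hRα]
      push_cast
      rw [mul_assoc, hαe]
    · simp only [hRα]
      have := congrArg Complex.re hαe
      rw [Complex.re_ofReal_mul, Complex.exp_ofReal_mul_I_re] at this
      exact this
  have hRle : ∀ α, R α ≤ Rm + ρ := fun α =>
    max_le (by linarith) (ciSup_le fun b => by
      have : 0 ≤ Λ * ‖Complex.exp (α * Complex.I) - b / ‖(b:ℂ)‖‖ := by positivity
      have := h1 b b.2
      simp only [hφ]
      linarith)
  have hLip : LipschitzWith (Λ + (Rm + ρ)).toNNReal (fun α => R α * Real.cos α) := by
    refine LipschitzWith.of_dist_le_mul fun x y => ?_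
    rw [Real.coe_toNNReal _ (by positivity), Real.dist_eq, Real.dist_eq]
    have e : R x * Real.cos x - R y * Real.cos y =
        (R x - R y) * Real.cos x + R y * (Real.cos x - Real.cos y) := by ring
    have e1 := hRL.dist_le_mul x y
    rw [Real.coe_toNNReal _ hΛ0.le, Real.dist_eq, Real.dist_eq] at e1
    have e2 : 0 ≤ R y := le_trans (by positivity) (le_max_left _ _)
    rw [e]
    refine (abs_add_le _ _).trans ?_
    rw [abs_mul, abs_mul, abs_of_nonneg e2]
    have := Real.abs_cos_le_one x
    have := Real.abs_cos_sub_cos_le x y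
    have := hRle y
    have := abs_nonneg (R x - R y)
    have := abs_nonneg (Real.cos x - Real.cos y)
    nlinarith
  refine measure_mono_null hsub ?_
  rw [← hausdorffMeasure_real] at hnull ⊢
  refine le_antisymm ((hLip.hausdorffMeasure_image_le zero_le_one A).trans ?_) bot_le
  rw [hnull, mul_zero]

/-- The open downward triangle with vertex `a`, slope `κ` and height `r`. -/
def lowerCone (a : ℂ) (κ r : ℝ) : Set ℂ :=
  {w | |w.re - a.re| < κ * (a.im - w.im) ∧ a.im - w.im < r}

theorem lowerCone_scale {a w : ℂ} {κ r t : ℝ} (hw : w ∈ lowerCone a κ r) (hκ : 0 < κ) (ht0 : 0 ≤ t)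
    (ht1 : t < 1) : t * a + (1 - t) * w ∈ lowerCone a κ r := by
  obtain ⟨h1, h2⟩ := hw
  have h0 : 0 < a.im - w.im := by
    by_contra! h
    have := abs_nonneg (w.re - a.re)
    nlinarith
  have e1 : (t * a + (1 - t) * w).re - a.re = (1 - t) * (w.re - a.re) := by
    simp; ring
  have e2 : a.im - (t * a + (1 - t) * w).im = (1 - t) * (a.im - w.im) := by
    simp; ring
  refine ⟨?_, ?_⟩
  · rw [e1, e2, abs_mul, abs_of_pos (by linarith)]
    nlinarith
  · rw [e2]
    nlinarith

/-- A bounded holomorphic function on a domain, vanishing at the vertices of uniform cones in the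
domain, is zero unless the projection of the set of vertices is null. -/
theorem volume_re_image_vertices_eq_zero {A Ω : Set ℂ} {D : ℂ → ℂ} {κ r C : ℝ} (hΩ : IsOpen Ω)
    (hconn : IsPreconnected Ω) (hD : DifferentiableOn ℂ D Ω) (hne : ∃ w ∈ Ω, D w ≠ 0) (hκ : 0 < κ)
    (hr : 0 < r) (hA : ∀ a ∈ A, a ∉ Ω) (hcone : ∀ a ∈ A, lowerCone a κ r ⊆ Ω)
    (hC : ∀ a ∈ A, ∀ w ∈ lowerCone a κ r, ‖D w‖ ≤ C)
    (hlim : ∀ a ∈ A, Tendsto D (𝓝[lowerCone a κ r] a) (𝓝 0)) :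
    volume (Complex.re '' A) = 0 := by
  obtain ⟨δ, hδ, hδr, hδκ⟩ : ∃ δ : ℝ, 0 < δ ∧ 8 * δ ≤ r ∧ 32 * δ ≤ κ * r :=
    ⟨min (r / 8) (κ * r / 32), by positivity, by linarith [min_le_left (r / 8) (κ * r / 32)],
      by linarith [min_le_right (r / 8) (κ * r / 32)]⟩
  set cell : ℤ × ℤ → Set ℂ := fun p => {a ∈ A | ⌊a.re / δ⌋ = p.1 ∧ ⌊a.im / δ⌋ = p.2} with hcell
  have hcover : Complex.re '' A = ⋃ p, Complex.re '' cell p := by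
    rw [← image_iUnion]
    congr 1
    ext a
    simp only [hcell, mem_iUnion]
    exact ⟨fun h => ⟨(_, _), h, rfl, rfl⟩, fun ⟨_, h, _⟩ => h⟩
  rw [hcover]
  refine measure_iUnion_null fun p => ?_
  rcases (cell p).eq_empty_or_nonempty with h0 | ⟨a0, ha0⟩
  · rw [h0]; simp
  have hclose : ∀ a ∈ cell p, |a.re - a0.re| ≤ δ ∧ |a.im - a0.im| ≤ δ := by
    intro a ha
    have h1 := Int.abs_sub_lt_one_of_floor_eq_floor (ha.2.1.trans ha0.2.1.symm)
    have h2 := Int.abs_sub_lt_one_of_floor_eq_floor (ha.2.2.trans ha0.2.2.symm)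
    rw [← sub_div, abs_div, abs_of_pos hδ, div_lt_one hδ] at h1 h2
    exact ⟨h1.le, h2.le⟩
  set w1 : ℂ := ⟨a0.re, a0.im - r / 2⟩ with hw1
  have hsub : ∀ a ∈ cell p, ball w1 (2 * δ) ⊆ lowerCone a κ r := by
    intro a ha w hw
    obtain ⟨h1, h2⟩ := hclose a ha
    rw [mem_ball, dist_eq_norm] at hw
    have h3 := (Complex.abs_re_le_norm _).trans_lt hw
    have h4 := (Complex.abs_im_le_norm _).trans_lt hw
    simp only [hw1, Complex.sub_re, Complex.sub_im] at h3 h4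
    rw [abs_le] at h1 h2
    rw [abs_lt] at h3 h4
    refine ⟨?_, by linarith⟩
    have h5 : r / 8 ≤ a.im - w.im := by linarith
    have h6 : κ * (r / 8) ≤ κ * (a.im - w.im) := mul_le_mul_of_nonneg_left h5 hκ.le
    rw [abs_lt]
    constructor <;> linarith
  obtain ⟨w0, hw0, hDw0⟩ : ∃ w0 ∈ ball w1 δ, D w0 ≠ 0 := by
    by_contra! h
    obtain ⟨w, hw, hDw⟩ := hne
    have hw1Ω : w1 ∈ Ω := hcone a0 ha0.1 (hsub a0 ha0 (mem_ball_self (by linarith)))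
    refine hDw ((hD.analyticOnNhd hΩ).eqOn_zero_of_preconnected_of_eventuallyEq_zero hconn hw1Ω ?_
        hw)
    filter_upwards [ball_mem_nhds w1 hδ] with x hx using h x hx
  have hsub' : ∀ a ∈ cell p, ∀ v ∈ ball (0:ℂ) δ, w0 + v ∈ lowerCone a κ r := by
    intro a ha v hv
    apply hsub a ha
    rw [mem_ball, dist_eq_norm] at hw0 ⊢
    rw [mem_ball_zero_iff] at hv
    calc ‖w0 + v - w1‖ = ‖(w0 - w1) + v‖ := by ring_nf
      _ ≤ ‖w0 - w1‖ + ‖v‖ := norm_add_le _ _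
      _ < _ := by linarith
  have hseg : ∀ (a v : ℂ) (t : ℝ), w0 + (t * (a - w0) + (1 - t) * v) = t * a + (1 - t) * (w0 +
      v) := by
    intros; ring
  have key := volume_re_image_eq_zero (P := (fun a => a - w0) '' cell p) (Ω := {w | w0 + w ∈ Ω})
    (D := fun w => D (w0 + w)) (ρ := δ) (Rm := ‖a0 - w0‖ + 2 * δ) (C := C)
    (by
      refine hD.comp (t := Ω) (by fun_prop) fun w hw => hw) hδ
    (by
      rintro _ ⟨a, ha, rfl⟩
      have h1 := hclose a ha
      have h2 := Complex.norm_le_abs_re_add_abs_im (a - a0)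
      simp only [Complex.sub_re, Complex.sub_im] at h2
      have h3 := norm_add_le (a - a0) (a0 - w0)
      rw [sub_add_sub_cancel] at h3
      linarith)
    (by
      rintro _ ⟨a, ha, rfl⟩ h
      apply hA a ha.1
      have : w0 + (a - w0) ∈ Ω := h
      simpa using this)
    (by
      rintro _ ⟨a, ha, rfl⟩ t ht v hv
      change _ ∈ Ω
      rw [hseg]
      exact hcone a ha.1 (lowerCone_scale (hsub' a ha v hv) hκ ht.1 ht.2))
    (by
      rintro _ ⟨a, ha, rfl⟩ t ht v hv
      simp only [hseg]
      exact hC a ha.1 _ (lowerCone_scale (hsub' a ha v hv) hκ ht.1 ht.2))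
    (by
      rintro _ ⟨a, ha, rfl⟩
      refine (hlim a ha.1).comp (tendsto_nhdsWithin_iff.2 ⟨?_, ?_⟩)
      · have h1 : Continuous fun t : ℝ => w0 + t * (a - w0) := by fun_prop
        have h2 := (h1.tendsto 1).mono_left (nhdsWithin_le_nhds (s := Iio 1))
        simpa using h2
      · filter_upwards [Ioo_mem_nhdsLT (by norm_num : (0:ℝ) < 1)] with t ht
        have := lowerCone_scale (hsub' a ha 0 (mem_ball_self hδ)) hκ ht.1.le ht.2
        rw [← hseg] at this
        simpa using this)
    (by simpa using hDw0)
  have himg : Complex.re '' cell p =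
      (fun x => x + w0.re) '' (Complex.re '' ((fun a => a - w0) '' cell p)) := by
    rw [image_image, image_image]
    simp
  rw [himg, image_add_right, measure_preimage_add_right]
  exact key

theorem LipschitzWith.volume_image_eq_zero {g : ℝ → ℝ} {L : ℝ≥0} (hg : LipschitzWith L g) {A : Set
    ℝ}
    (hA : volume A = 0) : volume (g '' A) = 0 := by
  rw [← hausdorffMeasure_real] at hA ⊢
  refine le_antisymm ((hg.hausdorffMeasure_image_le zero_le_one A).trans ?_) bot_le
  rw [hA, mul_zero]

/-- Almost every value of a Lipschitz function on a compact interval is taken finitely often, with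
nondegenerate growth. -/
theorem LipschitzWith.ae_finite_level_growth {g : ℝ → ℝ} {L : ℝ≥0} (hg : LipschitzWith L g) :
    ∀ᵐ c : ℝ, ∃ F : Finset ℝ, (↑F ⊆ Icc (0:ℝ) 1) ∧ (∀ t ∈ F, g t = c) ∧ ∃ C : ℝ, 0 < C ∧
      ∀ s ∈ Icc (0:ℝ) 1, |g s - c| < 1 / C → ∃ t ∈ F, |s - t| ≤ C * |g s - c| := by
  have h1 : volume (g '' {t | ¬ DifferentiableAt ℝ g t}) = 0 :=
    hg.volume_image_eq_zero hg.ae_differentiableAt_real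
  have h2 : volume (g '' {t | DifferentiableAt ℝ g t ∧ deriv g t = 0}) = 0 := by
    refine addHaar_image_eq_zero_of_det_fderivWithin_eq_zero volume
      (f' := fun x => ContinuousLinearMap.toSpanSingleton ℝ (deriv g x))
      (fun x hx => hx.1.hasDerivAt.hasDerivWithinAt.hasFDerivWithinAt) fun x hx => ?_
    rw [hx.2]
    simp [ContinuousLinearMap.det]
  have h1' := measure_eq_zero_iff_ae_notMem.1 h1
  have h2' := measure_eq_zero_iff_ae_notMem.1 h2
  filter_upwards [h1', h2'] with c hc1 hc2
  have hloc : ∀ t, g t = c → ∃ C : ℝ, 0 < C ∧ ∀ᶠ s in 𝓝 t, |s - t| ≤ C * |g s - c| := by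
    intro t ht
    have hd : DifferentiableAt ℝ g t := by
      by_contra h; exact hc1 ⟨t, h, ht⟩
    have hd0 : deriv g t ≠ 0 := fun h => hc2 ⟨t, ⟨hd, h⟩, ht⟩
    refine ⟨2 / |deriv g t|, by positivity, ?_⟩
    have h3 := hd.hasDerivAt.isLittleO.def (c := |deriv g t| / 2) (by positivity)
    filter_upwards [h3] with s hs
    rw [ht] at hs
    simp only [smul_eq_mul, Real.norm_eq_abs] at hs
    have h4 : |(s - t) * deriv g t| ≤ |g s - c| + |g s - c - (s - t) * deriv g t| := by
      have := abs_sub (g s - c) (g s - c - (s - t) * deriv g t)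
      rwa [sub_sub_cancel] at this
    rw [abs_mul] at h4
    rw [div_mul_eq_mul_div, le_div_iff₀ (abs_pos.2 hd0)]
    linarith
  set K : Set ℝ := {t ∈ Icc (0:ℝ) 1 | g t = c} with hK
  have hKc : IsCompact K := isCompact_Icc.inter_right (isClosed_eq hg.continuous continuous_const)
  choose! Ct hCt hCt' using hloc
  have hloc' : ∀ t ∈ K, ∃ U ∈ 𝓝 t, ∀ s ∈ U, |s - t| ≤ Ct t * |g s - c| := fun t ht =>
    ⟨_, hCt' t ht.2, fun s hs => hs⟩
  choose! U hU hUs using hloc'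
  have hfin : K.Finite := by
    by_contra hinf
    obtain ⟨z, hz, hacc⟩ := Set.Infinite.exists_accPt_of_subset_isCompact hinf hKc subset_rfl
    rw [accPt_iff_frequently] at hacc
    obtain ⟨y, ⟨hyz, hyK⟩, hyU⟩ := (hacc.and_eventually (hU z hz)).exists
    have := hUs z hz y hyU
    rw [hyK.2, sub_self, abs_zero, mul_zero, abs_nonpos_iff, sub_eq_zero] at this
    exact hyz this
  refine ⟨hfin.toFinset, fun t ht => ((hfin.mem_toFinset).1 (Finset.mem_coe.1 ht)).1,
    fun t ht => ((hfin.mem_toFinset).1 ht).2, ?_⟩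
  set W : Set ℝ := ⋃ t ∈ K, interior (U t) with hW
  have hWo : IsOpen W := isOpen_biUnion fun t _ => isOpen_interior
  obtain ⟨δ, hδ, hδ'⟩ : ∃ δ : ℝ, 0 < δ ∧ ∀ s ∈ Icc (0:ℝ) 1 \ W, δ ≤ |g s - c| := by
    rcases (Icc (0:ℝ) 1 \ W).eq_empty_or_nonempty with h0 | h0
    · exact ⟨1, one_pos, fun s hs => by rw [h0] at hs; exact hs.elim⟩
    · obtain ⟨s0, hs0, hmin⟩ := (isCompact_Icc.diff hWo).exists_isMinOn h0
        (f := fun s => |g s - c|) (by have := hg.continuous; fun_prop)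
      refine ⟨|g s0 - c|, abs_pos.2 fun h => ?_, fun s hs => hmin hs⟩
      have hs0K : s0 ∈ K := ⟨hs0.1, sub_eq_zero.1 h⟩
      exact hs0.2 (mem_biUnion hs0K (mem_interior_iff_mem_nhds.2 (hU s0 hs0K)))
  refine ⟨∑ t ∈ hfin.toFinset, Ct t + 1 / δ, ?_, fun s hs hsc => ?_⟩
  · have : 0 ≤ ∑ t ∈ hfin.toFinset, Ct t :=
      Finset.sum_nonneg fun t ht => (hCt t ((hfin.mem_toFinset.1 ht).2)).le
    positivity
  · have hsum : 0 ≤ ∑ t ∈ hfin.toFinset, Ct t :=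
      Finset.sum_nonneg fun t ht => (hCt t ((hfin.mem_toFinset.1 ht).2)).le
    have hsW : s ∈ W := by
      by_contra h
      have h3 := hδ' s ⟨hs, h⟩
      have h4 : 1 / (∑ t ∈ hfin.toFinset, Ct t + 1 / δ) ≤ δ := by
        rw [div_le_iff₀ (by positivity), mul_add, mul_one_div_cancel hδ.ne']
        nlinarith
      linarith
    simp only [hW, mem_iUnion] at hsW
    obtain ⟨t, ht, hst⟩ := hsW
    refine ⟨t, hfin.mem_toFinset.2 ht, (hUs t ht s (interior_subset hst)).trans ?_⟩
    gcongr
    have h5 : Ct t ≤ ∑ t ∈ hfin.toFinset, Ct t :=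
      Finset.single_le_sum (f := Ct) (fun t ht => (hCt t ((hfin.mem_toFinset.1 ht).2)).le)
        (hfin.mem_toFinset.2 ht)
    have : 0 < 1 / δ := by positivity
    linarith

section
variable {T σ : Type*} {γ : T → σ → ℂ} {x : σ → ℂ}

/-- The points at which every polynomial is bounded by its modulus at some point of a curve. -/
def hullPts (γ : T → σ → ℂ) : Set (σ → ℂ) :=
  {x | ∀ p : MvPolynomial σ ℂ, ∃ s, ‖MvPolynomial.eval x p‖ ≤ ‖MvPolynomial.eval (γ s) p‖}

theorem norm_eval_le_of_mem_hullPts (hx : x ∈ hullPts γ) {p : MvPolynomial σ ℂ} {C : ℝ}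
    (h : ∀ s, ‖MvPolynomial.eval (γ s) p‖ ≤ C) : ‖MvPolynomial.eval x p‖ ≤ C := by
  obtain ⟨s, hs⟩ := hx p
  exact hs.trans (h s)

theorem re_eval_nonneg_of_mem_hullPts (hx : x ∈ hullPts γ) {p : MvPolynomial σ ℂ} {B : ℝ}
    (hB : ∀ s, ‖MvPolynomial.eval (γ s) p‖ ≤ B) (h : ∀ s, 0 ≤ (MvPolynomial.eval (γ s) p).re) :
    0 ≤ (MvPolynomial.eval x p).re := by
  by_contra! hneg
  set e := -(MvPolynomial.eval x p).re with he
  have he0 : 0 < e := by linarith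
  have hB0 : 0 ≤ B := (norm_nonneg _).trans (hB (hx p).choose)
  set t : ℝ := B ^ 2 / e + B + 1 with ht
  have htB : B < t := by
    have : 0 ≤ B ^ 2 / e := by positivity
    linarith
  have hte : B ^ 2 < t * e := by
    have : (B ^ 2 / e) * e = B ^ 2 := by field_simp
    nlinarith
  obtain ⟨s, hs⟩ := hx (MvPolynomial.C (t : ℂ) - p)
  simp only [map_sub, MvPolynomial.eval_C] at hs
  have h1 : t + e ≤ ‖(t : ℂ) - MvPolynomial.eval x p‖ := by
    refine le_trans ?_ (Complex.re_le_norm _)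
    simp [he]
  have h2 : ‖(t : ℂ) - MvPolynomial.eval (γ s) p‖ ^ 2 ≤ t ^ 2 + B ^ 2 := by
    rw [← Complex.normSq_eq_norm_sq, Complex.normSq_apply]
    have h3 := hB s
    have h4 : ‖MvPolynomial.eval (γ s) p‖ ^ 2 ≤ B ^ 2 := by gcongr
    rw [← Complex.normSq_eq_norm_sq, Complex.normSq_apply] at h4
    simp only [Complex.sub_re, Complex.ofReal_re, Complex.sub_im, Complex.ofReal_im, zero_sub]
    have h5 : 0 ≤ t := by linarith
    have := mul_nonneg h5 (h s)
    nlinarith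
  have h6 : (t + e) ^ 2 ≤ t ^ 2 + B ^ 2 := by
    refine le_trans ?_ h2
    have : 0 ≤ t + e := by linarith
    gcongr
    exact h1.trans hs
  nlinarith

theorem MvPolynomial.eval_real_smul (x : σ → ℂ) (c : ℝ) (p : MvPolynomial σ ℂ) :
    MvPolynomial.eval x (c • p) = c * MvPolynomial.eval x p := by
  rw [← smul_one_smul ℂ c p, MvPolynomial.smul_eval]
  simp

variable [TopologicalSpace T]

theorem continuous_eval_comp (hγ : Continuous γ) (p : MvPolynomial σ ℂ) :
    Continuous fun s => MvPolynomial.eval (γ s) p :=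
  (MvPolynomial.continuous_eval p).comp hγ

variable [CompactSpace T]

theorem exists_norm_eval_le (hγ : Continuous γ) (p : MvPolynomial σ ℂ) :
    ∃ B, 0 ≤ B ∧ ∀ s, ‖MvPolynomial.eval (γ s) p‖ ≤ B := by
  obtain ⟨B, hB⟩ := isCompact_univ.exists_bound_of_continuousOn (continuous_eval_comp hγ
      p).continuousOn
  exact ⟨max B 0, le_max_right _ _, fun s => (hB s (mem_univ s)).trans (le_max_left _ _)⟩

variable [T2Space T] [MeasurableSpace T] [BorelSpace T]

/-- Points of the polynomial hull have representing probability measures. -/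
theorem exists_representing_measure (hγ : Continuous γ) (hx : x ∈ hullPts γ) :
    ∃ μ : Measure T, IsProbabilityMeasure μ ∧
      ∀ p : MvPolynomial σ ℂ, ∫ s, MvPolynomial.eval (γ s) p ∂μ = MvPolynomial.eval x p := by
  classical
  let A : MvPolynomial σ ℂ →ₗ[ℝ] C_c(T, ℝ) :=
    { toFun := fun p => CompactlySupportedContinuousMap.continuousMapEquiv
        ⟨fun s => (MvPolynomial.eval (γ s) p).re,
          Complex.continuous_re.comp (continuous_eval_comp hγ p)⟩
      map_add' := fun p q => by ext s; simp [CompactlySupportedContinuousMap.continuousMapEquiv]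
      map_smul' := fun c p => by
        ext s
        simp [CompactlySupportedContinuousMap.continuousMapEquiv, MvPolynomial.eval_real_smul] }
  have hA : ∀ p s, A p s = (MvPolynomial.eval (γ s) p).re := fun p s => rfl
  let Λ : MvPolynomial σ ℂ →ₗ[ℝ] ℝ :=
    { toFun := fun p => (MvPolynomial.eval x p).re
      map_add' := fun p q => by simp
      map_smul' := fun c p => by simp [MvPolynomial.eval_real_smul] }
  have hpos : ∀ p, 0 ≤ A p → 0 ≤ Λ p := by
    intro p hp
    obtain ⟨B, _, hB⟩ := exists_norm_eval_le hγ p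
    exact re_eval_nonneg_of_mem_hullPts hx hB fun s => hp s
  have hker : Λ ∈ LinearMap.range A.dualMap := by
    rw [LinearMap.range_dualMap_eq_dualAnnihilator_ker, Submodule.mem_dualAnnihilator]
    intro p hp
    rw [LinearMap.mem_ker] at hp
    have h1 := hpos p hp.ge
    have h2 := hpos (-p) (by rw [map_neg, hp, neg_zero])
    rw [map_neg] at h2
    linarith
  obtain ⟨φ, hφ⟩ := hker
  have hφ' : ∀ p, φ (A p) = Λ p := fun p => by rw [← hφ]; rfl
  let P : PointedCone ℝ C_c(T, ℝ) :=
    { carrier := {f | ∀ s, 0 ≤ f s}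
      add_mem' := fun hf hg s => add_nonneg (hf s) (hg s)
      zero_mem' := fun s => le_rfl
      smul_mem' := fun c f hf s => mul_nonneg c.2 (hf s) }
  obtain ⟨g, hg1, hg2⟩ := riesz_extension P
    ⟨LinearMap.range A, φ.comp (LinearMap.range A).subtype⟩
    (by
      rintro ⟨_, p, rfl⟩ hp
      change 0 ≤ φ (A p)
      rw [hφ']
      exact hpos p hp)
    (by
      intro y
      obtain ⟨B, hB⟩ := isCompact_univ.exists_bound_of_continuousOn y.continuous.continuousOn
      refine ⟨⟨A (MvPolynomial.C (B : ℂ)), _, rfl⟩, ?_⟩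
      intro s
      have := hB s (mem_univ s)
      rw [Real.norm_eq_abs, abs_le] at this
      simp only [CompactlySupportedContinuousMap.coe_add, Pi.add_apply, hA, MvPolynomial.eval_C,
        Complex.ofReal_re]
      have h1 : -B ≤ y s := this.1
      linarith)
  let G : C_c(T, ℝ) →ₚ[ℝ] ℝ := PositiveLinearMap.mk₀ g fun f hf => hg2 f hf
  have hG : ∀ p, G (A p) = (MvPolynomial.eval x p).re := fun p =>
    (hg1 ⟨A p, p, rfl⟩).trans (hφ' p)
  set μ := RealRMK.rieszMeasure G with hμ
  have hInteg : ∀ p, ∫ s, (MvPolynomial.eval (γ s) p).re ∂μ = (MvPolynomial.eval x p).re := by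
    intro p
    rw [← hG, ← RealRMK.integral_rieszMeasure]
    rfl
  have hI : ∀ p, Integrable (fun s => MvPolynomial.eval (γ s) p) μ := fun p =>
    (continuous_eval_comp hγ p).integrable_of_hasCompactSupport (HasCompactSupport.of_compactSpace
        _)
  refine ⟨μ, ⟨?_⟩, fun p => ?_⟩
  · have := hInteg 1
    simp only [map_one, Complex.one_re, integral_const, smul_eq_mul, mul_one] at this
    rw [measureReal_def] at this
    rw [← ENNReal.ofReal_toReal (measure_ne_top μ univ), this, ENNReal.ofReal_one]
  · apply Complex.ext
    · rw [← hInteg p]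
      exact (integral_re (hI p)).symm
    · have h1 := hInteg (MvPolynomial.C (-Complex.I) * p)
      simp only [map_mul, MvPolynomial.eval_C, Complex.mul_re, Complex.neg_re, Complex.I_re,
        Complex.neg_im, Complex.I_im] at h1
      simp only [neg_zero, zero_mul, zero_sub, neg_mul, one_mul, neg_neg] at h1
      rw [← h1]
      exact (integral_im (hI p)).symm
end

/-- A compact family of points, representing measures for its hull, and a polynomial `f`. -/
structure HullData (T σ : Type*) [TopologicalSpace T] [MeasurableSpace T] where
  /-- the points of the family -/
  γ : T → σ → ℂ
  continuous_γ : Continuous γ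
  /-- the representing measures -/
  μ : hullPts γ → Measure T
  prob : ∀ x, IsProbabilityMeasure (μ x)
  repr : ∀ x p, ∫ s, MvPolynomial.eval (γ s) p ∂μ x = MvPolynomial.eval (x : σ → ℂ) p
  /-- the polynomial defining the projection -/
  f : MvPolynomial σ ℂ

attribute [instance] HullData.prob

namespace HullData

section
variable {T σ : Type*} [TopologicalSpace T] [MeasurableSpace T] (h : HullData T σ)

/-- The hull. -/
abbrev K : Type _ := hullPts h.γ

/-- The projection on the family. -/
noncomputable def fγ (s : T) : ℂ := MvPolynomial.eval (h.γ s) h.f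

/-- The projection on the hull. -/
noncomputable def fK (x : h.K) : ℂ := MvPolynomial.eval (x : σ → ℂ) h.f

/-- The image of the family under the projection. -/
def curve : Set ℂ := range h.fγ

/-- The resolvent functionals. -/
noncomputable def Φ (x : h.K) (w : ℂ) (p : MvPolynomial σ ℂ) : ℂ :=
  ∫ s, MvPolynomial.eval (h.γ s) p * ((h.fγ s - h.fK x) / (h.fγ s - w)) ∂h.μ x

theorem continuous_eval (p : MvPolynomial σ ℂ) : Continuous fun s => MvPolynomial.eval (h.γ s) p :=
  continuous_eval_comp h.continuous_γ p

theorem continuous_fγ : Continuous h.fγ := h.continuous_eval h.f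

theorem sub_ne_zero_of_notMem {w : ℂ} (hw : w ∉ h.curve) (s : T) : h.fγ s - w ≠ 0 :=
  fun hs => hw ⟨s, sub_eq_zero.1 hs⟩

variable {h} in
theorem continuous_kernel {w : ℂ} (hw : w ∉ h.curve) (x : h.K) (p : MvPolynomial σ ℂ) : Continuous
    fun s => MvPolynomial.eval (h.γ s) p * ((h.fγ s - h.fK x) / (h.fγ s - w)) :=
  (h.continuous_eval p).mul ((h.continuous_fγ.sub continuous_const).div
    (h.continuous_fγ.sub continuous_const) (h.sub_ne_zero_of_notMem hw))

theorem Φ_C_mul (x : h.K) (w c : ℂ) (p : MvPolynomial σ ℂ) :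
    h.Φ x w (MvPolynomial.C c * p) = c * h.Φ x w p := by
  rw [Φ, Φ, ← integral_const_mul]
  simp only [map_mul, MvPolynomial.eval_C, mul_assoc]

theorem Φ_zero (x : h.K) (w : ℂ) : h.Φ x w 0 = 0 := by simp [Φ]

theorem Φ_fiber (x : h.K) (hx : h.fK x ∉ h.curve) (p : MvPolynomial σ ℂ) :
    h.Φ x (h.fK x) p = MvPolynomial.eval (x : σ → ℂ) p := by
  rw [← h.repr, Φ]
  congr 1
  ext s
  rw [div_self (h.sub_ne_zero_of_notMem hx s), mul_one]

theorem Φ_mul_sub {w : ℂ} (hw : w ∉ h.curve) (x : h.K) (p : MvPolynomial σ ℂ) :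
    h.Φ x w (p * (h.f - MvPolynomial.C w)) = 0 := by
  have h1 : ∀ s, MvPolynomial.eval (h.γ s) (p * (h.f - MvPolynomial.C w)) *
      ((h.fγ s - h.fK x) / (h.fγ s - w)) =
      MvPolynomial.eval (h.γ s) (p * (h.f - MvPolynomial.C (h.fK x))) := by
    intro s
    have := h.sub_ne_zero_of_notMem hw s
    simp only [map_mul, map_sub, MvPolynomial.eval_C]
    change _ * (h.fγ s - w) * _ = _ * (h.fγ s - h.fK x)
    field_simp
  rw [Φ]
  simp only [h1]
  rw [h.repr]
  simp [fK]

theorem norm_fK_le {B : ℝ} (hB : ∀ s, ‖h.fγ s‖ ≤ B) (x : h.K) : ‖h.fK x‖ ≤ B :=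
  norm_eval_le_of_mem_hullPts x.2 hB

variable [CompactSpace T]

theorem isCompact_curve : IsCompact h.curve := isCompact_range h.continuous_fγ

theorem isOpen_compl_curve [T2Space T] : IsOpen h.curveᶜ := h.isCompact_curve.isClosed.isOpen_compl

theorem exists_bound (p : MvPolynomial σ ℂ) : ∃ B, 0 ≤ B ∧ ∀ s, ‖MvPolynomial.eval (h.γ s) p‖ ≤ B :=
  exists_norm_eval_le h.continuous_γ p

variable [BorelSpace T]

theorem integrable_of_continuous {g : T → ℂ} (hg : Continuous g) (x : h.K) :
    Integrable g (h.μ x) :=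
  hg.integrable_of_hasCompactSupport (HasCompactSupport.of_compactSpace _)

theorem Φ_add {w : ℂ} (hw : w ∉ h.curve) (x : h.K) (p q : MvPolynomial σ ℂ) :
    h.Φ x w (p + q) = h.Φ x w p + h.Φ x w q := by
  rw [Φ, Φ, Φ, ← integral_add (h.integrable_of_continuous (continuous_kernel hw x p) x)
    (h.integrable_of_continuous (continuous_kernel hw x q) x)]
  simp only [map_add, add_mul]

/-- The resolvent functional as a linear map. -/
noncomputable def Φₗ {w : ℂ} (hw : w ∉ h.curve) (x : h.K) : MvPolynomial σ ℂ →ₗ[ℂ] ℂ where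
  toFun := h.Φ x w
  map_add' := h.Φ_add hw x
  map_smul' c p := by rw [MvPolynomial.smul_eq_C_mul, h.Φ_C_mul]; rfl

theorem Φ_sub {w : ℂ} (hw : w ∉ h.curve) (x : h.K) (p q : MvPolynomial σ ℂ) :
    h.Φ x w (p - q) = h.Φ x w p - h.Φ x w q := (h.Φₗ hw x).map_sub p q

theorem Φ_sum {ι : Type*} {w : ℂ} (hw : w ∉ h.curve) (x : h.K) (s : Finset ι)
    (p : ι → MvPolynomial σ ℂ) : h.Φ x w (∑ i ∈ s, p i) = ∑ i ∈ s, h.Φ x w (p i) :=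
  map_sum (h.Φₗ hw x) p s

theorem norm_Φ_le {w : ℂ} (hw : w ∉ h.curve) (x : h.K) {p : MvPolynomial σ ℂ} {A B : ℝ}
    (hA : ∀ s, ‖MvPolynomial.eval (h.γ s) p‖ ≤ A) (hB : ∀ s, ‖h.fγ s‖ ≤ B) :
    ‖h.Φ x w p‖ ≤ A * (2 * B) * ∫ s, ‖h.fγ s - w‖⁻¹ ∂h.μ x := by
  rw [Φ, ← integral_const_mul]
  have hc : Continuous fun s => ‖h.fγ s - w‖⁻¹ :=
    (h.continuous_fγ.sub continuous_const).norm.inv₀ fun s =>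
      norm_ne_zero_iff.2 (h.sub_ne_zero_of_notMem hw s)
  refine norm_integral_le_of_norm_le ((continuous_const.mul hc).integrable_of_hasCompactSupport
    (HasCompactSupport.of_compactSpace _)) (Eventually.of_forall fun s => ?_)
  rw [norm_mul, norm_div, div_eq_mul_inv, ← mul_assoc]
  have h1 := h.norm_fK_le hB x
  have h2 := norm_sub_le (h.fγ s) (h.fK x)
  have h3 := hB s
  have h4 := hA s
  gcongr
  · exact (norm_nonneg _).trans h4
  · linarith

theorem differentiableOn_Φ (x : h.K) (p : MvPolynomial σ ℂ) :
    DifferentiableOn ℂ (fun w => h.Φ x w p) h.curveᶜ := by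
  intro w hw
  refine DifferentiableAt.differentiableWithinAt ?_
  have hXc := h.isCompact_curve.isClosed
  obtain ⟨δ, hδ, hball⟩ := Metric.isOpen_iff.1 hXc.isOpen_compl w hw
  obtain ⟨A, hA0, hA⟩ := h.exists_bound p
  obtain ⟨B, hB0, hB⟩ := h.exists_bound h.f
  have hlow : ∀ v ∈ ball w (δ / 2), ∀ s, δ / 2 ≤ ‖h.fγ s - v‖ := by
    intro v hv s
    have h1 : δ ≤ ‖h.fγ s - w‖ := by
      by_contra! hlt
      exact hball (by rwa [mem_ball, dist_eq_norm]) ⟨s, rfl⟩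
    rw [mem_ball, dist_eq_norm] at hv
    have := norm_add_le (h.fγ s - v) (v - w)
    rw [sub_add_sub_cancel] at this
    linarith
  have hsub : ball w (δ / 2) ⊆ h.curveᶜ := (ball_subset_ball (by linarith)).trans hball
  have key := hasDerivAt_integral_of_dominated_loc_of_deriv_le (μ := h.μ x) (𝕜 := ℂ)
    (F := fun v s => MvPolynomial.eval (h.γ s) p * ((h.fγ s - h.fK x) / (h.fγ s - v)))
    (F' := fun v s => MvPolynomial.eval (h.γ s) p * ((h.fγ s - h.fK x) / (h.fγ s - v) ^ 2))
    (x₀ := w) (s := ball w (δ / 2)) (bound := fun _ => A * ((2 * B) / (δ / 2) ^ 2))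
    (ball_mem_nhds w (by linarith))
    (by
      filter_upwards [ball_mem_nhds w (half_pos hδ)] with v hv
      exact (continuous_kernel (hsub hv) x p).aestronglyMeasurable_of_compactSpace)
    (h.integrable_of_continuous (continuous_kernel hw x p) x)
    (((h.continuous_eval p).mul ((h.continuous_fγ.sub continuous_const).div
      ((h.continuous_fγ.sub continuous_const).pow 2) fun s =>
        pow_ne_zero 2 (h.sub_ne_zero_of_notMem hw s))).aestronglyMeasurable_of_compactSpace)
    (Eventually.of_forall fun s v hv => by
      have h1 := hlow v hv s
      have h2 := h.norm_fK_le hB x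
      have h3 := norm_sub_le (h.fγ s) (h.fK x)
      have h4 : ‖h.fγ s‖ ≤ B := hB s
      rw [norm_mul, norm_div, norm_pow]
      gcongr
      · exact hA s
      · linarith)
    (integrable_const _)
    (Eventually.of_forall fun s v hv => by
      have h1 := h.sub_ne_zero_of_notMem (hsub hv) s
      have h2 : HasDerivAt (fun v : ℂ => h.fγ s - v) (-1) v := by
        simpa using (hasDerivAt_id v).const_sub (h.fγ s)
      have h3 := ((hasDerivAt_const v (h.fγ s - h.fK x)).div h2 h1).const_mul
        (MvPolynomial.eval (h.γ s) p)
      refine h3.congr_deriv ?_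
      simp)
  exact key.2.differentiableAt

end
end HullData

theorem exists_ne_zero_forall_sum_eq_zero {ι : Type*} {m : ℕ} (v : ι → Fin m → ℂ)
    (hv : ∀ r : Fin m → ι, (Matrix.of fun i j => v (r i) j).det = 0) :
    ∃ c : Fin m → ℂ, c ≠ 0 ∧ ∀ i, ∑ j, c j * v i j = 0 := by
  classical
  by_cases htop : Submodule.span ℂ (range v) = ⊤
  · exfalso
    obtain ⟨b, hb, hspan, hli⟩ := exists_linearIndependent ℂ (range v)
    rw [htop] at hspan
    have hbasis := Module.Basis.mk hli (by simp [hspan])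
    have hfin : Finite b := Module.Finite.finite_basis hbasis
    have := Fintype.ofFinite b
    have hcard : Fintype.card b = Fintype.card (Fin m) := by
      rw [← Module.finrank_eq_card_basis hbasis]
      simp
    obtain ⟨e⟩ := Fintype.card_eq.1 hcard
    have hr : ∀ i : Fin m, ∃ k, v k = (e.symm i : Fin m → ℂ) := fun i => hb (e.symm i).2
    choose r hr using hr
    have h1 : LinearIndependent ℂ (Matrix.of fun i j => v (r i) j).row := by
      have h2 : (Matrix.of fun i j => v (r i) j).row = Subtype.val ∘ e.symm := by
        ext i j
        simp [Matrix.row, hr i]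
      rw [h2]
      exact hli.comp e.symm e.symm.injective
    rw [Matrix.linearIndependent_rows_iff_isUnit, Matrix.isUnit_iff_isUnit_det, hv r] at h1
    simp at h1
  · obtain ⟨φ, hφ, hle⟩ := Submodule.exists_le_ker_of_lt_top _ (lt_top_iff_ne_top.2 htop)
    refine ⟨fun j => φ (Pi.single j 1), fun h0 => hφ ?_, fun i => ?_⟩
    · refine LinearMap.pi_ext' fun j => LinearMap.ext_ring ?_
      simpa using congrFun h0 j
    · have h1 : φ (v i) = 0 := hle (Submodule.subset_span ⟨i, rfl⟩)
      rw [← Finset.univ_sum_single (v i), map_sum] at h1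
      rw [← h1]
      refine Finset.sum_congr rfl fun j _ => ?_
      have : (Pi.single j (v i j) : Fin m → ℂ) = v i j • Pi.single j 1 := by
        rw [← Pi.single_smul]; simp
      rw [this, map_smul, smul_eq_mul, mul_comm]

theorem Ideal.exists_mul_notMem_of_prod_mul_mem {R ι : Type*} [CommRing R] (I : Ideal R)
    (s : Finset ι) (a : ι → R) {q : R} (hq : q ∉ I) (hs : (∏ i ∈ s, a i) * q ∈ I) :
    ∃ i ∈ s, ∃ r, r * q ∉ I ∧ a i * (r * q) ∈ I := by
  classical
  induction s using Finset.induction_on with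
  | empty => simp [hq] at hs
  | insert i s hi ih =>
    by_cases h1 : (∏ i ∈ s, a i) * q ∈ I
    · obtain ⟨j, hj, r⟩ := ih h1
      exact ⟨j, Finset.mem_insert_of_mem hj, r⟩
    · refine ⟨i, Finset.mem_insert_self _ _, _, h1, ?_⟩
      rwa [← mul_assoc, ← Finset.prod_insert hi]

theorem Multiset.exists_fin_map_eq {α : Type*} (m : Multiset α) {D : ℕ} (hm : m.card = D) :
    ∃ ζ : Fin D → α, Finset.univ.val.map ζ = m := by
  subst hm
  obtain ⟨l, rfl⟩ := Quot.exists_rep m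
  refine ⟨l.get, ?_⟩
  exact (Fin.univ_val_map l.get).trans (congrArg _ (List.ofFn_get l))

namespace HullData

section
variable {T σ : Type*} [TopologicalSpace T] [MeasurableSpace T] (h : HullData T σ)
variable [CompactSpace T] [BorelSpace T]

/-- The polynomials annihilated by all the resolvent functionals at a point. -/
noncomputable def I {w : ℂ} (hw : w ∉ h.curve) : Ideal (MvPolynomial σ ℂ) where
  carrier := {q | ∀ x p, h.Φ x w (p * q) = 0}
  add_mem' {a b} ha hb x p := by rw [mul_add, h.Φ_add hw, ha, hb, add_zero]
  zero_mem' x p := by rw [mul_zero, h.Φ_zero]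
  smul_mem' c q hq x p := by rw [smul_eq_mul, ← mul_assoc]; exact hq x (p * c)

variable {h} in
theorem mem_I {w : ℂ} {hw : w ∉ h.curve} {q : MvPolynomial σ ℂ} :
    q ∈ h.I hw ↔ ∀ x p, h.Φ x w (p * q) = 0 := Iff.rfl

variable {h} in
theorem eval_eq_zero_of_mem_I {w : ℂ} {hw : w ∉ h.curve} {q : MvPolynomial σ ℂ} (hq : q ∈ h.I hw)
    {x : h.K} (hx : h.fK x = w) : MvPolynomial.eval (x : σ → ℂ) q = 0 := by
  subst hx
  rw [← h.Φ_fiber x hw, ← one_mul q]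
  exact hq x 1

variable {h} in
theorem mem_I_of_sub_mul_mem {w : ℂ} {hw : w ∉ h.curve} {H q : MvPolynomial σ ℂ} {B : ℝ}
    (hB : ∀ s, ‖MvPolynomial.eval (h.γ s) H‖ ≤ B) {ζ : ℂ} (hζ : B < ‖ζ‖)
    (hq : (H - MvPolynomial.C ζ) * q ∈ h.I hw) : q ∈ h.I hw := by
  intro x p
  have := nonempty_of_isProbabilityMeasure (h.μ x)
  have hB0 : 0 ≤ B := (norm_nonneg _).trans (hB (Classical.arbitrary T))
  have hζ0 : ζ ≠ 0 := norm_pos_iff.1 (hB0.trans_lt hζ)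
  have hstep : ∀ n : ℕ, h.Φ x w (p * q * H ^ n) = ζ ^ n * h.Φ x w (p * q) := by
    intro n
    induction n with
    | zero => simp
    | succ n ih =>
      have h1 := hq x (p * H ^ n)
      have h2 : p * H ^ n * ((H - MvPolynomial.C ζ) * q) =
        p * q * H ^ (n + 1) - MvPolynomial.C ζ * (p * q * H ^ n) := by ring
      rw [h2, h.Φ_sub hw, h.Φ_C_mul, sub_eq_zero, ih] at h1
      rw [h1]; ring
  obtain ⟨A, hA0, hA⟩ := h.exists_bound (p * q)
  obtain ⟨Bf, hBf0, hBf⟩ := h.exists_bound h.f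
  set J := ∫ s, ‖h.fγ s - w‖⁻¹ ∂h.μ x
  have hbd : ∀ n : ℕ, ‖h.Φ x w (p * q)‖ ≤ A * (2 * Bf) * J * (B / ‖ζ‖) ^ n := by
    intro n
    have h1 := h.norm_Φ_le hw x (p := p * q * H ^ n) (A := A * B ^ n) (fun s => by
      rw [map_mul, map_pow, norm_mul, norm_pow]
      gcongr
      · exact hA s
      · exact hB s) hBf
    rw [hstep, norm_mul, norm_pow] at h1
    have h2 : 0 < ‖ζ‖ ^ n := by positivity
    rw [div_pow, mul_div_assoc', le_div_iff₀ h2]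
    linarith
  have hlim : Tendsto (fun n : ℕ => A * (2 * Bf) * J * (B / ‖ζ‖) ^ n) atTop (𝓝 0) := by
    rw [← mul_zero (A * (2 * Bf) * J)]
    refine (tendsto_pow_atTop_nhds_zero_of_lt_one (by positivity) ?_).const_mul _
    rwa [div_lt_one (hB0.trans_lt hζ)]
  exact norm_le_zero_iff.1 (ge_of_tendsto' hlim hbd)

variable {h} in
theorem filter_prod_mul_mem_I {w : ℂ} {hw : w ∉ h.curve} {H : MvPolynomial σ ℂ} {B : ℝ}
    (hB : ∀ s, ‖MvPolynomial.eval (h.γ s) H‖ ≤ B) (m : Multiset ℂ) (q : MvPolynomial σ ℂ)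
    (hq : (m.map fun ζ => H - MvPolynomial.C ζ).prod * q ∈ h.I hw) :
    ((m.filter fun ζ => ‖ζ‖ ≤ B).map fun ζ => H - MvPolynomial.C ζ).prod * q ∈ h.I hw := by
  induction m using Multiset.induction_on generalizing q with
  | empty => simpa using hq
  | cons ζ m ih =>
    rw [Multiset.map_cons, Multiset.prod_cons] at hq
    by_cases hζ : ‖ζ‖ ≤ B
    · rw [Multiset.filter_cons_of_pos (p := fun ζ : ℂ => ‖ζ‖ ≤ B) _ hζ, Multiset.map_cons,
          Multiset.prod_cons,
        mul_right_comm, mul_comm]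
      refine ih _ ?_
      convert hq using 1
      ring
    · rw [Multiset.filter_cons_of_neg (p := fun ζ : ℂ => ‖ζ‖ ≤ B) _ hζ]
      refine ih _ (mem_I_of_sub_mul_mem hB (not_le.1 hζ) ?_)
      rwa [← mul_assoc]

/-- The determinants which vanish when a power of `H` is a combination of the lower ones. -/
noncomputable def det (H : MvPolynomial σ ℂ) {m : ℕ} (x : Fin m → h.K)
    (p : Fin m → MvPolynomial σ ℂ) (w : ℂ) : ℂ :=
  (Matrix.of fun i j : Fin m => h.Φ (x i) w (p i * H ^ (j : ℕ))).det

theorem Φ_mul_sum_pow {w : ℂ} (hw : w ∉ h.curve) (x : h.K) (p H : MvPolynomial σ ℂ) {m : ℕ}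
    (c : Fin m → ℂ) : h.Φ x w (p * ∑ j, MvPolynomial.C (c j) * H ^ (j : ℕ)) =
      ∑ j, c j * h.Φ x w (p * H ^ (j : ℕ)) := by
  rw [Finset.mul_sum, h.Φ_sum hw]
  refine Finset.sum_congr rfl fun j _ => ?_
  rw [← h.Φ_C_mul, mul_left_comm]

theorem exists_roots_of_det_eq_zero {w : ℂ} (hw : w ∉ h.curve) {H : MvPolynomial σ ℂ} {B : ℝ}
    (hB0 : 0 ≤ B) (hB : ∀ s, ‖MvPolynomial.eval (h.γ s) H‖ ≤ B) {D : ℕ}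
    (hdet : ∀ (x : Fin (D + 1) → h.K) p, h.det H x p w = 0) :
    ∃ ζ : Fin D → ℂ, (∀ i, ‖ζ i‖ ≤ B) ∧ ∏ i, (H - MvPolynomial.C (ζ i)) ∈ h.I hw := by
  obtain ⟨c, hc0, hc⟩ := exists_ne_zero_forall_sum_eq_zero
    (fun (i : h.K × MvPolynomial σ ℂ) (j : Fin (D + 1)) => h.Φ i.1 w (i.2 * H ^ (j : ℕ)))
    (fun r => hdet (fun i => (r i).1) (fun i => (r i).2))
  set Q : Polynomial ℂ := ∑ j : Fin (D + 1), Polynomial.C (c j) * Polynomial.X ^ (j : ℕ) with hQ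
  have hcoeff : ∀ j : Fin (D + 1), Q.coeff j = c j := by
    intro j
    simp only [hQ, Polynomial.finsetSum_coeff, Polynomial.coeff_C_mul_X_pow]
    simp [Fin.val_inj]
  have hQ0 : Q ≠ 0 := by
    rintro h0
    refine hc0 (funext fun j => ?_)
    rw [← hcoeff, h0]; rfl
  have hdeg : Q.natDegree ≤ D :=
    Polynomial.natDegree_sum_le_of_forall_le _ _ fun j _ =>
      (Polynomial.natDegree_C_mul_X_pow_le _ _).trans (by omega)
  have hmem : Polynomial.aeval H Q ∈ h.I hw := by
    intro x p
    have : Polynomial.aeval H Q = ∑ j : Fin (D + 1), MvPolynomial.C (c j) * H ^ (j : ℕ) := by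
      simp [hQ, MvPolynomial.algebraMap_eq]
    rw [this, h.Φ_mul_sum_pow hw, hc (x, p)]
  have hsplit := IsAlgClosed.splits Q
  have hroots := hsplit.eq_prod_roots
  have hcard : Q.roots.card ≤ D := Q.card_roots'.trans hdeg
  rw [hroots, map_mul, map_multiset_prod, Multiset.map_map, Polynomial.aeval_C] at hmem
  have hlc : IsUnit (algebraMap ℂ (MvPolynomial σ ℂ) Q.leadingCoeff) :=
    (IsUnit.mk0 _ (Polynomial.leadingCoeff_ne_zero.2 hQ0)).map _
  rw [Ideal.unit_mul_mem_iff_mem _ hlc] at hmem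
  have hmem2 : (Q.roots.map fun ζ => H - MvPolynomial.C ζ).prod * 1 ∈ h.I hw := by
    rw [mul_one]
    convert hmem using 4
    simp [MvPolynomial.algebraMap_eq]
  have hmem3 := filter_prod_mul_mem_I hB _ _ hmem2
  set m := Q.roots.filter fun ζ => ‖ζ‖ ≤ B with hm
  have hmc : m.card ≤ D := (Multiset.card_le_card (Multiset.filter_le _ _)).trans hcard
  obtain ⟨ζ, hζ⟩ := Multiset.exists_fin_map_eq (m + Multiset.replicate (D - m.card) 0) (D := D)
    (by simp [hmc])
  refine ⟨ζ, fun i => ?_, ?_⟩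
  · have : ζ i ∈ m + Multiset.replicate (D - m.card) 0 := by
      rw [← hζ]; exact Multiset.mem_map_of_mem _ (Finset.mem_univ_val i)
    rcases Multiset.mem_add.1 this with h1 | h1
    · exact (Multiset.mem_filter.1 h1).2
    · rw [Multiset.eq_of_mem_replicate h1]; simpa using hB0
  · have : ∏ i, (H - MvPolynomial.C (ζ i)) =
        ((Finset.univ.val.map ζ).map fun ζ => H - MvPolynomial.C ζ).prod := by
      rw [Multiset.map_map]; rfl
    rw [this, hζ, Multiset.map_add, Multiset.prod_add]
    rw [mul_one] at hmem3
    exact Ideal.mul_mem_right _ _ hmem3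

theorem det_eq_zero_of_mem {w : ℂ} (hw : w ∉ h.curve) {H : MvPolynomial σ ℂ} {m : ℕ}
    {c : Fin m → ℂ} (hc0 : c ≠ 0) (hc : ∑ j, MvPolynomial.C (c j) * H ^ (j : ℕ) ∈ h.I hw)
    (x : Fin m → h.K) (p : Fin m → MvPolynomial σ ℂ) : h.det H x p w = 0 := by
  refine Matrix.exists_mulVec_eq_zero_iff.1 ⟨c, hc0, funext fun i => ?_⟩
  have := hc (x i) (p i)
  rw [h.Φ_mul_sum_pow hw] at this
  simpa [Matrix.mulVec, dotProduct, mul_comm] using this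

theorem exists_mem_K_of_notMem_I [Fintype σ] {w : ℂ} (hw : w ∉ h.curve) {D : ℕ}
    {ξ : σ → Fin D → ℂ}
    (hξ : ∀ i, ∏ j, (MvPolynomial.X i - MvPolynomial.C (ξ i j)) ∈ h.I hw)
    {H q : MvPolynomial σ ℂ} {ζ : ℂ} (hq : q ∉ h.I hw)
    (hH : (H - MvPolynomial.C ζ) * q ∈ h.I hw) :
    ∃ x : h.K, h.fK x = w ∧ MvPolynomial.eval (x : σ → ℂ) H = ζ := by
  classical
  have hind : ∀ s : Finset σ, ∃ r, ∃ z : σ → ℂ, r * q ∉ h.I hw ∧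
      ∀ i ∈ s, (MvPolynomial.X i - MvPolynomial.C (z i)) * (r * q) ∈ h.I hw := by
    intro s
    induction s using Finset.induction_on with
    | empty => exact ⟨1, 0, by simpa using hq, by simp⟩
    | insert i s hi ih =>
      obtain ⟨r, z, hr, hz⟩ := ih
      obtain ⟨j, -, r', hr', hj⟩ := (h.I hw).exists_mul_notMem_of_prod_mul_mem Finset.univ
        (fun j => MvPolynomial.X i - MvPolynomial.C (ξ i j)) hr
        (Ideal.mul_mem_right _ _ (hξ i))
      refine ⟨r' * r, Function.update z i (ξ i j), by rwa [mul_assoc], fun k hk => ?_⟩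
      rcases Finset.mem_insert.1 hk with rfl | hk
      · simpa [mul_assoc] using hj
      · have hki : k ≠ i := fun hki => hi (hki ▸ hk)
        rw [Function.update_of_ne hki, mul_assoc r', mul_left_comm]
        exact Ideal.mul_mem_left _ _ (hz k hk)
  obtain ⟨r, z, hr, hz⟩ := hind Finset.univ
  have hr' := hr
  rw [mem_I] at hr'
  push Not at hr'
  obtain ⟨x₀, p₀, h0⟩ := hr'
  have hchar : ∀ P : MvPolynomial σ ℂ,
      (P - MvPolynomial.C (MvPolynomial.eval z P)) * (r * q) ∈ h.I hw := by
    intro P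
    induction P using MvPolynomial.induction_on with
    | C a => simp
    | add a b ha hb =>
      have := Ideal.add_mem _ ha hb
      convert this using 1
      simp only [map_add]
      ring
    | mul_X a i ha =>
      have := Ideal.add_mem _ (Ideal.mul_mem_left _ (MvPolynomial.X i) ha)
        (Ideal.mul_mem_left _ (MvPolynomial.C (MvPolynomial.eval z a)) (hz i (Finset.mem_univ i)))
      convert this using 1
      simp only [map_mul, MvPolynomial.eval_X]
      ring
  have hΦ : ∀ P : MvPolynomial σ ℂ, h.Φ x₀ w (p₀ * (r * q) * P) =
      MvPolynomial.eval z P * h.Φ x₀ w (p₀ * (r * q)) := by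
    intro P
    have h1 := hchar P x₀ p₀
    have h2 : p₀ * ((P - MvPolynomial.C (MvPolynomial.eval z P)) * (r * q)) =
      p₀ * (r * q) * P - MvPolynomial.C (MvPolynomial.eval z P) * (p₀ * (r * q)) := by ring
    rwa [h2, h.Φ_sub hw, h.Φ_C_mul, sub_eq_zero] at h1
  have hscal : ∀ P : MvPolynomial σ ℂ, P * (r * q) ∈ h.I hw → MvPolynomial.eval z P = 0 := by
    intro P hP
    have h1 := hP x₀ p₀
    rw [mul_comm P, ← mul_assoc, hΦ] at h1
    exact (mul_eq_zero.1 h1).resolve_right h0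
  have hz : z ∈ hullPts h.γ := by
    intro P
    by_contra! hlt
    have hne := nonempty_of_isProbabilityMeasure (h.μ x₀)
    obtain ⟨s, -, hs⟩ := isCompact_univ.exists_isMaxOn (univ_nonempty (α := T))
      (h.continuous_eval P).norm.continuousOn
    have hlt' := hlt s
    have h2 := hchar P
    exact hr (mem_I_of_sub_mul_mem (fun t => hs (mem_univ t)) hlt' h2)
  refine ⟨⟨z, hz⟩, ?_, ?_⟩
  · have h1 : (h.f - MvPolynomial.C w) * (r * q) ∈ h.I hw := by
      intro x p
      rw [mul_comm (h.f - _), ← mul_assoc]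
      exact h.Φ_mul_sub hw x _
    have := hscal _ h1
    rwa [map_sub, MvPolynomial.eval_C, sub_eq_zero] at this
  · have h1 : (H - MvPolynomial.C ζ) * (r * q) ∈ h.I hw := by
      rw [mul_left_comm]
      exact Ideal.mul_mem_left _ _ hH
    have := hscal _ h1
    rwa [map_sub, MvPolynomial.eval_C, sub_eq_zero] at this

end
end HullData

theorem coeff_prod_X_sub_C_eq_one {D : ℕ} (ζ : Fin D → ℂ) :
    (∏ i, (Polynomial.X - Polynomial.C (ζ i))).coeff D = 1 := by
  have h1 := (Polynomial.monic_prod_X_sub_C ζ Finset.univ).coeff_natDegree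
  rwa [Polynomial.natDegree_finsetProd_X_sub_C_eq_card, Finset.card_univ, Fintype.card_fin] at h1

theorem prod_sub_algebraMap_eq_sum {R : Type*} [CommRing R] [Algebra ℂ R] {D : ℕ}
    (ζ : Fin D → ℂ) (H : R) : ∏ i, (H - algebraMap ℂ R (ζ i)) = ∑ j : Fin (D + 1),
      algebraMap ℂ R ((∏ i, (Polynomial.X - Polynomial.C (ζ i))).coeff j) * H ^ (j : ℕ) := by
  set P : Polynomial ℂ := ∏ i, (Polynomial.X - Polynomial.C (ζ i)) with hP
  have hdeg : P.natDegree = D := by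
    rw [hP, Polynomial.natDegree_finsetProd_X_sub_C_eq_card]
    simp
  have h1 : Polynomial.aeval H P = ∏ i, (H - algebraMap ℂ R (ζ i)) := by
    simp [hP]
  rw [← h1, Polynomial.aeval_eq_sum_range, hdeg, ← Fin.sum_univ_eq_sum_range
    (fun j => P.coeff j • H ^ j)]
  simp [Algebra.smul_def]

theorem exists_prod_sub_C_eq_sum {R : Type*} [CommRing R] [Algebra ℂ R] {D : ℕ} (ζ : Fin D → ℂ)
    (H : R) : ∃ c : Fin (D + 1) → ℂ, c (Fin.last D) = 1 ∧
      ∏ i, (H - algebraMap ℂ R (ζ i)) = ∑ j, algebraMap ℂ R (c j) * H ^ (j : ℕ) :=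
  ⟨_, by simpa using coeff_prod_X_sub_C_eq_one ζ, prod_sub_algebraMap_eq_sum ζ H⟩

theorem norm_det_le_of_last {m : ℕ} {M : Matrix (Fin (m + 1)) (Fin (m + 1)) ℂ} {b ε : ℝ}
    (hε : 0 < ε) (h1 : ∀ i j, j ≠ Fin.last m → ‖M i j‖ ≤ b)
    (h2 : ∀ i, ‖M i (Fin.last m)‖ ≤ b * ε) : ‖M.det‖ ≤ (m + 1).factorial * b ^ (m + 1) * ε := by
  set v : Fin (m + 1) → ℂ := fun j => if j = Fin.last m then (ε : ℂ)⁻¹ else 1 with hv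
  have hdet := Matrix.det_mul_row v M
  have hprod : ∏ j, v j = (ε : ℂ)⁻¹ := by simp [hv]
  have hle := Matrix.det_le (A := Matrix.of fun i j => v j * M i j)
    (abv := (IsAbsoluteValue.toAbsoluteValue (norm : ℂ → ℝ))) (x := b) (fun i j => by
      change ‖v j * M i j‖ ≤ b
      by_cases hj : j = Fin.last m
      · subst hj
        have := h2 i
        simp only [hv, if_true, norm_mul, norm_inv, Complex.norm_real, Real.norm_eq_abs,
          abs_of_pos hε]
        rw [inv_mul_le_iff₀ hε]
        linarith
      · simpa [hv, hj] using h1 i j hj)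
  rw [hdet, hprod] at hle
  change ‖(ε : ℂ)⁻¹ * M.det‖ ≤ _ at hle
  rw [norm_mul, norm_inv, Complex.norm_real, Real.norm_eq_abs, abs_of_pos hε,
    inv_mul_le_iff₀ hε, Fintype.card_fin, nsmul_eq_mul] at hle
  linarith

namespace HullData

section
variable {T σ : Type*} [TopologicalSpace T] [MeasurableSpace T] (h : HullData T σ)

/-- The family crosses the vertical line at `a` transversally, with controlled constants. -/
def GoodPt (n : ℕ) (a : ℂ) : Prop :=
  ∃ t : Fin n → T, ∀ s, ‖h.fγ s - a‖ < 1 / n →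
    ‖h.fγ s - a‖ ≤ n * |(h.fγ s).re - a.re| ∧
      ∃ k, ∀ i, ‖h.γ s i - h.γ (t k) i‖ ≤ n * ‖h.fγ s - a‖

variable {h} in
theorem GoodPt.add_le {n : ℕ} {a w : ℂ} (hn : 0 < n) (ha : h.GoodPt n a)
    (h1 : |w.re - a.re| ≤ 1 / (4 * n) * |w.im - a.im|) (h2 : |w.im - a.im| ≤ 1 / (6 * n)) (s : T) :
    ‖h.fγ s - a‖ + ‖w - a‖ ≤ 8 * n * ‖h.fγ s - w‖ := by
  obtain ⟨t, ht⟩ := ha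
  have hn1 : (1 : ℝ) ≤ n := by exact_mod_cast hn
  have hn0 : (0 : ℝ) < n := by linarith
  have hv : ‖w - a‖ ≤ |w.re - a.re| + |w.im - a.im| := by
    simpa using Complex.norm_le_abs_re_add_abs_im (w - a)
  have hvim : |w.im - a.im| ≤ ‖w - a‖ := by simpa using Complex.abs_im_le_norm (w - a)
  have htri : ‖h.fγ s - a‖ ≤ ‖h.fγ s - w‖ + ‖w - a‖ := by
    simpa using norm_add_le (h.fγ s - w) (w - a)
  have htri' : ‖w - a‖ ≤ ‖h.fγ s - w‖ + ‖h.fγ s - a‖ := by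
    have := norm_sub_le (h.fγ s - a) (h.fγ s - w)
    rw [sub_sub_sub_cancel_left] at this
    linarith
  have hre : |(h.fγ s).re - a.re| ≤ ‖h.fγ s - w‖ + |w.re - a.re| := by
    have h3 : |(h.fγ s).re - w.re| ≤ ‖h.fγ s - w‖ := by
      simpa using Complex.abs_re_le_norm (h.fγ s - w)
    have := abs_add_le ((h.fγ s).re - w.re) (w.re - a.re)
    rw [sub_add_sub_cancel] at this
    linarith
  by_cases hs : ‖h.fγ s - a‖ < 1 / n
  · have h3 := (ht s hs).1
    have h4 : n * |w.re - a.re| ≤ 1 / 4 * ‖w - a‖ := by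
      have : n * |w.re - a.re| ≤ n * (1 / (4 * n) * |w.im - a.im|) := by gcongr
      have h5 : n * (1 / (4 * n) * |w.im - a.im|) = 1 / 4 * |w.im - a.im| := by field_simp
      linarith
    have h6 : n * |(h.fγ s).re - a.re| ≤ n * (‖h.fγ s - w‖ + |w.re - a.re|) := by gcongr
    have h7 : ‖h.fγ s - w‖ ≤ n * ‖h.fγ s - w‖ := le_mul_of_one_le_left (norm_nonneg _) hn1
    linarith
  · push Not at hs
    have h3 : ‖w - a‖ ≤ 1 / (3 * n) := by
      have h4 : |w.re - a.re| ≤ 1 * |w.im - a.im| := by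
        refine h1.trans ?_
        gcongr
        rw [div_le_one (by positivity)]
        linarith
      have h5 : 1 / (3 * n : ℝ) = 1 / (6 * n) + 1 / (6 * n) := by field_simp; norm_num
      linarith
    have h6 : 1 / (3 * n : ℝ) = 1 / 3 * (1 / n) := by field_simp
    have h7 : ‖h.fγ s - w‖ ≤ n * ‖h.fγ s - w‖ := le_mul_of_one_le_left (norm_nonneg _) hn1
    linarith

variable {h} in
theorem GoodPt.norm_prod_le {n : ℕ} {a : ℂ} (hn : 0 < n) {t : Fin n → T} (i : σ) {s : T}
    (ht : ‖h.fγ s - a‖ < 1 / n → ∃ k, ∀ i, ‖h.γ s i - h.γ (t k) i‖ ≤ n * ‖h.fγ s - a‖)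
    {B : ℝ} (hB : ∀ s, ‖h.γ s i‖ ≤ B) :
    ‖∏ k, (h.γ s i - h.γ (t k) i)‖ ≤ (2 * B + 1) ^ n * n * ‖h.fγ s - a‖ := by
  have hn0 : (0 : ℝ) < n := by exact_mod_cast hn
  have hB0 : 0 ≤ B := (norm_nonneg _).trans (hB s)
  have hfac : ∀ k, ‖h.γ s i - h.γ (t k) i‖ ≤ 2 * B + 1 := fun k => by
    have := norm_sub_le (h.γ s i) (h.γ (t k) i)
    linarith [hB s, hB (t k)]
  rw [norm_prod]
  by_cases hs : ‖h.fγ s - a‖ < 1 / n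
  · obtain ⟨k, hk⟩ := ht hs
    rw [← Finset.mul_prod_erase _ _ (Finset.mem_univ k)]
    have h1 : ∏ j ∈ Finset.univ.erase k, ‖h.γ s i - h.γ (t j) i‖ ≤ (2 * B + 1) ^ n := by
      calc _ ≤ ∏ j ∈ Finset.univ.erase k, (2 * B + 1) :=
            Finset.prod_le_prod (fun _ _ => norm_nonneg _) fun j _ => hfac j
        _ = (2 * B + 1) ^ (n - 1) := by simp
        _ ≤ _ := pow_le_pow_right₀ (by linarith) (by omega)
    calc _ ≤ (n * ‖h.fγ s - a‖) * (2 * B + 1) ^ n := by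
          gcongr
          exact hk i
      _ = _ := by ring
  · push Not at hs
    have h1 : 1 ≤ n * ‖h.fγ s - a‖ := by
      rw [div_le_iff₀ hn0] at hs; linarith
    calc ∏ k, ‖h.γ s i - h.γ (t k) i‖ ≤ ∏ k : Fin n, (2 * B + 1) :=
          Finset.prod_le_prod (fun _ _ => norm_nonneg _) fun j _ => hfac j
      _ = (2 * B + 1) ^ n * 1 := by simp
      _ ≤ (2 * B + 1) ^ n * (n * ‖h.fγ s - a‖) := by gcongr
      _ = _ := by ring

variable [CompactSpace T] [BorelSpace T]

theorem det_eq_zero_of_le {w : ℂ} (hw : w ∉ h.curve) {H : MvPolynomial σ ℂ} {D D' : ℕ} (hD : D ≤ D')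
    (hdet : ∀ (x : Fin (D + 1) → h.K) p, h.det H x p w = 0) (x : Fin (D' + 1) → h.K)
    (p : Fin (D' + 1) → MvPolynomial σ ℂ) : h.det H x p w = 0 := by
  obtain ⟨B, hB0, hB⟩ := h.exists_bound H
  obtain ⟨ζ, -, hζ⟩ := h.exists_roots_of_det_eq_zero hw hB0 hB hdet
  obtain ⟨k, rfl⟩ := Nat.exists_eq_add_of_le hD
  obtain ⟨c, hc1, hc⟩ := exists_prod_sub_C_eq_sum (Fin.append ζ (0 : Fin k → ℂ)) H
  refine h.det_eq_zero_of_mem hw (c := c) (fun h0 => ?_) ?_ x p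
  · rw [h0] at hc1; simp at hc1
  · rw [← MvPolynomial.algebraMap_eq, ← hc, Fin.prod_univ_add]
    refine Ideal.mul_mem_right _ _ ?_
    simpa [MvPolynomial.algebraMap_eq] using hζ

theorem differentiableOn_det (H : MvPolynomial σ ℂ) {m : ℕ} (x : Fin m → h.K)
    (p : Fin m → MvPolynomial σ ℂ) : DifferentiableOn ℂ (h.det H x p) h.curveᶜ := by
  have : h.det H x p = fun w => ∑ τ : Equiv.Perm (Fin m), Equiv.Perm.sign τ •
      ∏ i, h.Φ (x (τ i)) w (p (τ i) * H ^ (i : ℕ)) := by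
    ext w
    rw [det, Matrix.det_apply]
    rfl
  rw [this]
  refine DifferentiableOn.fun_sum fun τ _ => DifferentiableOn.const_smul
    (DifferentiableOn.fun_finsetProd fun i _ => h.differentiableOn_Φ _ _) _

end
end HullData

theorem norm_integral_le_of_mul_rpow_le {T : Type*} [MeasurableSpace T] {μ : Measure T}
    {F : T → ℂ} {r : T → ℝ} (hr : ∀ s, 0 ≤ r s) {e A N : ℝ} (he : 0 < e) (hA : 0 < A)
    (hN0 : 0 ≤ N) (hF : ∀ s, ‖F s‖ * r s ^ e ≤ A)
    (hN : ∫⁻ s, ENNReal.ofReal (r s) ^ (-e) ∂μ ≤ ENNReal.ofReal N) : ‖∫ s, F s ∂μ‖ ≤ A * N := by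
  have h1 : ‖∫ s, F s ∂μ‖ₑ ≤ ENNReal.ofReal (A * N) := by
    refine (enorm_integral_le_lintegral_enorm F).trans ?_
    calc ∫⁻ s, ‖F s‖ₑ ∂μ ≤ ∫⁻ s, ENNReal.ofReal A * ENNReal.ofReal (r s) ^ (-e) ∂μ := by
          refine lintegral_mono fun s => ?_
          rcases (hr s).eq_or_lt with h0 | h0
          · rw [← h0, ENNReal.ofReal_zero, ENNReal.zero_rpow_of_neg (by linarith),
              ENNReal.mul_top (by simpa using hA)]
            exact le_top
          · rw [ENNReal.ofReal_rpow_of_pos h0, ← ENNReal.ofReal_mul hA.le, ← ofReal_norm]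
            refine ENNReal.ofReal_le_ofReal ?_
            rw [Real.rpow_neg h0.le, ← div_eq_mul_inv, le_div_iff₀ (by positivity)]
            exact hF s
      _ = ENNReal.ofReal A * ∫⁻ s, ENNReal.ofReal (r s) ^ (-e) ∂μ :=
          lintegral_const_mul' _ _ ENNReal.ofReal_ne_top
      _ ≤ ENNReal.ofReal A * ENNReal.ofReal N := by gcongr
      _ = _ := (ENNReal.ofReal_mul hA.le).symm
  rw [← ofReal_norm] at h1
  exact (ENNReal.ofReal_le_ofReal_iff (by positivity)).1 h1

theorem rpow_le_add_mul_rpow {r U V e : ℝ} (hr : 0 ≤ r) (hrU : r ≤ U) (hV : 0 < V) (he : 0 < e)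
    (he1 : e < 1) : r ^ e ≤ (U + V) * V ^ (e - 1) := by
  have hUV : 0 < U + V := by linarith
  calc r ^ e ≤ (U + V) ^ e := Real.rpow_le_rpow hr (by linarith) he.le
    _ = (U + V) * (U + V) ^ (e - 1) := by
        rw [Real.rpow_sub_one hUV.ne']; field_simp
    _ ≤ (U + V) * V ^ (e - 1) := by
        refine mul_le_mul_of_nonneg_left ?_ hUV.le
        exact Real.rpow_le_rpow_of_nonpos hV (le_add_of_nonneg_left (hr.trans hrU)) (sub_nonpos.2
            he1.le)

namespace HullData

section
variable {T σ : Type*} [TopologicalSpace T] [MeasurableSpace T] (h : HullData T σ)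

theorem norm_Φ_le_of_cone {a w : ℂ} {R : ℝ} (hR : 0 < R) (hwa : w ≠ a)
    (hw : ∀ s, ‖h.fγ s - a‖ + ‖w - a‖ ≤ R * ‖h.fγ s - w‖) (x : h.K) {p : MvPolynomial σ ℂ}
    {A B N e : ℝ} (hA0 : 0 < A) (hA : ∀ s, ‖MvPolynomial.eval (h.γ s) p‖ ≤ A) (hB0 : 0 < B)
    (hB : ∀ s, ‖h.fγ s‖ ≤ B) (he : 0 < e) (he1 : e < 1) (hN0 : 0 ≤ N)
    (hN : ∫⁻ s, ENNReal.ofReal |(h.fγ s).re - a.re| ^ (-e) ∂h.μ x ≤ ENNReal.ofReal N) :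
    ‖h.Φ x w p‖ ≤ A * (2 * B) * R * ‖w - a‖ ^ (e - 1) * N := by
  have hV : 0 < ‖w - a‖ := norm_pos_iff.2 (sub_ne_zero.2 hwa)
  refine norm_integral_le_of_mul_rpow_le (fun s => abs_nonneg _) he (by positivity) hN0
    (fun s => ?_) hN
  have h0 : 0 < ‖h.fγ s - w‖ := by
    have := hw s
    by_contra! hle
    have h1 : ‖h.fγ s - w‖ = 0 := le_antisymm hle (norm_nonneg _)
    rw [h1, mul_zero] at this
    linarith [norm_nonneg (h.fγ s - a)]
  have h1 : |(h.fγ s).re - a.re| ≤ ‖h.fγ s - a‖ := by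
    simpa using Complex.abs_re_le_norm (h.fγ s - a)
  have h2 := rpow_le_add_mul_rpow (abs_nonneg _) h1 hV he he1
  have h3 : ‖h.fγ s - h.fK x‖ ≤ 2 * B := by
    have := norm_sub_le (h.fγ s) (h.fK x)
    linarith [hB s, h.norm_fK_le hB x]
  rw [norm_mul, norm_div, ← mul_div_assoc, div_mul_eq_mul_div, div_le_iff₀ h0]
  calc _ ≤ A * (2 * B) * ((R * ‖h.fγ s - w‖) * ‖w - a‖ ^ (e - 1)) := by
        gcongr
        · exact hA s
        · exact h2.trans (by gcongr; exact hw s)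
    _ = _ := by ring

variable [CompactSpace T] [BorelSpace T]

theorem norm_Φ_sub_Φ_le_of_cone {a w w' : ℂ} {R : ℝ} (hR : 0 < R) (hwa : w ≠ a)
    (hwX : w ∉ h.curve) (hwX' : w' ∉ h.curve) (hww' : w' - a = -(w - a))
    (hw : ∀ s, ‖h.fγ s - a‖ + ‖w - a‖ ≤ R * ‖h.fγ s - w‖)
    (hw' : ∀ s, ‖h.fγ s - a‖ + ‖w - a‖ ≤ R * ‖h.fγ s - w'‖) (x : h.K) {p : MvPolynomial σ ℂ}
    {A B N e : ℝ} (hA0 : 0 < A)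
    (hA : ∀ s, ‖MvPolynomial.eval (h.γ s) p‖ ≤ A * ‖h.fγ s - a‖) (hB0 : 0 < B)
    (hB : ∀ s, ‖h.fγ s‖ ≤ B) (he : 0 < e) (he1 : e < 1) (hN0 : 0 ≤ N)
    (hN : ∫⁻ s, ENNReal.ofReal |(h.fγ s).re - a.re| ^ (-e) ∂h.μ x ≤ ENNReal.ofReal N) :
    ‖h.Φ x w p - h.Φ x w' p‖ ≤ A * (2 * B) * (2 * R ^ 2) * ‖w - a‖ ^ (e - 1) * ‖w - a‖ * N := by
  have hV : 0 < ‖w - a‖ := norm_pos_iff.2 (sub_ne_zero.2 hwa)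
  rw [Φ, Φ, ← integral_sub (h.integrable_of_continuous (continuous_kernel hwX x p) x)
    (h.integrable_of_continuous (continuous_kernel hwX' x p) x)]
  refine norm_integral_le_of_mul_rpow_le (fun s => abs_nonneg _) he (by positivity) hN0
    (fun s => ?_) hN
  have h0 := h.sub_ne_zero_of_notMem hwX s
  have h0' := h.sub_ne_zero_of_notMem hwX' s
  have h1 : |(h.fγ s).re - a.re| ≤ ‖h.fγ s - a‖ := by
    simpa using Complex.abs_re_le_norm (h.fγ s - a)
  have h2 := rpow_le_add_mul_rpow (abs_nonneg _) h1 hV he he1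
  have h3 : ‖h.fγ s - h.fK x‖ ≤ 2 * B := by
    have := norm_sub_le (h.fγ s) (h.fK x)
    linarith [hB s, h.norm_fK_le hB x]
  have h4 : MvPolynomial.eval (h.γ s) p * ((h.fγ s - h.fK x) / (h.fγ s - w)) -
      MvPolynomial.eval (h.γ s) p * ((h.fγ s - h.fK x) / (h.fγ s - w')) =
      MvPolynomial.eval (h.γ s) p * (h.fγ s - h.fK x) * (2 * (w - a)) /
        ((h.fγ s - w) * (h.fγ s - w')) := by
    have h5 : 2 * (w - a) = w - w' := by linear_combination hww'
    rw [h5]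
    field_simp
    ring
  have hU := norm_nonneg (h.fγ s - a)
  have hW : 0 < ‖h.fγ s - w‖ := norm_pos_iff.2 h0
  have hW' : 0 < ‖h.fγ s - w'‖ := norm_pos_iff.2 h0'
  have hle : ‖h.fγ s - a‖ ≤ R * ‖h.fγ s - w'‖ := by linarith [hw' s]
  rw [h4, norm_div, div_mul_eq_mul_div, div_le_iff₀ (norm_pos_iff.2 (mul_ne_zero h0 h0'))]
  simp only [norm_mul, Complex.norm_two]
  calc _ ≤ (A * (R * ‖h.fγ s - w'‖)) * (2 * B) * (2 * ‖w - a‖) *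
        ((R * ‖h.fγ s - w‖) * ‖w - a‖ ^ (e - 1)) := by
        gcongr
        · exact (hA s).trans (by gcongr)
        · exact h2.trans (by gcongr; exact hw s)
    _ = _ := by ring

end

section
variable {T σ : Type*} [TopologicalSpace T] [MeasurableSpace T] (h : HullData T σ)

/-- The lower cone associated with a good point. -/
def lc (n : ℕ) (a : ℂ) : Set ℂ := lowerCone a (1 / (4 * n)) (1 / (6 * n))

theorem lc_ne {n : ℕ} {a w : ℂ} (hw : w ∈ lc n a) : w ≠ a := by
  rintro rfl
  have := hw.1
  simp at this

variable {h} in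
theorem GoodPt.add_le_of_mem_lc {n : ℕ} {a w : ℂ} (hn : 0 < n) (ha : h.GoodPt n a)
    (hw : w ∈ lc n a) (s : T) : ‖h.fγ s - a‖ + ‖w - a‖ ≤ 8 * n * ‖h.fγ s - w‖ := by
  have h1 := hw.1
  have h2 := hw.2
  have hn0 : (0 : ℝ) < n := by exact_mod_cast hn
  have h3 : 0 < a.im - w.im := by
    by_contra! hle
    have : 1 / (4 * (n : ℝ)) * (a.im - w.im) ≤ 0 :=
      mul_nonpos_of_nonneg_of_nonpos (by positivity) hle
    linarith [abs_nonneg (w.re - a.re)]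
  have h4 : |w.im - a.im| = a.im - w.im := by rw [abs_sub_comm, abs_of_pos h3]
  exact ha.add_le hn (by rw [h4]; exact h1.le) (by rw [h4]; exact h2.le) s

variable {h} in
theorem GoodPt.add_le_of_mem_uc {n : ℕ} {a w : ℂ} (hn : 0 < n) (ha : h.GoodPt n a)
    (hw : 2 * a - w ∈ lc n a) (s : T) : ‖h.fγ s - a‖ + ‖w - a‖ ≤ 8 * n * ‖h.fγ s - w‖ := by
  have h1 := hw.1
  have h2 := hw.2
  have hn0 : (0 : ℝ) < n := by exact_mod_cast hn
  simp only [Complex.sub_re, Complex.mul_re, Complex.re_ofNat, Complex.im_ofNat, zero_mul, sub_zero,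
    Complex.sub_im, Complex.mul_im, add_zero] at h1 h2
  have h5 : |2 * a.re - w.re - a.re| = |w.re - a.re| := by
    rw [abs_sub_comm w.re]; congr 1; ring
  have h6 : a.im - (2 * a.im - w.im) = w.im - a.im := by ring
  rw [h5, h6] at h1
  rw [h6] at h2
  have h3 : 0 < w.im - a.im := by
    by_contra! hle
    have : 1 / (4 * (n : ℝ)) * (w.im - a.im) ≤ 0 :=
      mul_nonpos_of_nonneg_of_nonpos (by positivity) hle
    linarith [abs_nonneg (w.re - a.re)]
  have h4 : |w.im - a.im| = w.im - a.im := abs_of_pos h3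
  exact ha.add_le hn (by rw [h4]; exact h1.le) (by rw [h4]; exact h2.le) s

theorem notMem_X_of_add_le {a w : ℂ} {R : ℝ} (hwa : w ≠ a)
    (hw : ∀ s, ‖h.fγ s - a‖ + ‖w - a‖ ≤ R * ‖h.fγ s - w‖) : w ∉ h.curve := by
  rintro ⟨s, rfl⟩
  have := hw s
  rw [sub_self, norm_zero, mul_zero] at this
  have h1 : 0 < ‖h.fγ s - a‖ := norm_pos_iff.2 (sub_ne_zero.2 hwa)
  linarith

variable {h} in
theorem GoodPt.lc_subset {n : ℕ} {a : ℂ} (hn : 0 < n) (ha : h.GoodPt n a) : lc n a ⊆ h.curveᶜ :=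
  fun _ hw => h.notMem_X_of_add_le (lc_ne hw) (ha.add_le_of_mem_lc hn hw)

variable {h} in
theorem GoodPt.uc_subset {n : ℕ} {a w : ℂ} (hn : 0 < n) (ha : h.GoodPt n a)
    (hw : 2 * a - w ∈ lc n a) : w ∉ h.curve :=
  h.notMem_X_of_add_le (fun hwa => lc_ne hw (by rw [hwa]; ring)) (ha.add_le_of_mem_uc hn hw)

variable [CompactSpace T] [BorelSpace T]

theorem exists_norm_det_le_of_cone {n : ℕ} (hn : 0 < n) (i : σ) (x : Fin (n + n + 1) → h.K)
    (p : Fin (n + n + 1) → MvPolynomial σ ℂ) {N : ℝ} (hN0 : 0 ≤ N) : ∃ C, 0 ≤ C ∧ ∀ a, h.GoodPt n a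
        →
      (∀ w, 2 * a - w ∈ lc n a → ∀ (y : Fin (n + 1) → h.K) q, h.det (.X i) y q w = 0) →
      (∀ k, ∫⁻ s, ENNReal.ofReal |(h.fγ s).re - a.re| ^ (-(1 - 1 / (2 * (n + n + 1 : ℝ)))) ∂h.μ (x
          k)
        ≤ ENNReal.ofReal N) →
      ∀ w ∈ lc n a, ‖h.det (.X i) x p w‖ ≤ C * ‖w - a‖ ^ (1 / 2 : ℝ) := by
  have hn0 : (0 : ℝ) < n := by exact_mod_cast hn
  obtain ⟨B, hB0, hB⟩ := h.exists_bound (.X i)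
  simp only [MvPolynomial.eval_X] at hB
  obtain ⟨Bf, hBf0, hBf⟩ := h.exists_bound h.f
  have hAp : ∃ A, 0 < A ∧ ∀ k s, ‖MvPolynomial.eval (h.γ s) (p k)‖ ≤ A := by
    choose A hA0 hA using fun k => h.exists_bound (p k)
    have hsum := Finset.sum_nonneg fun k (_ : k ∈ Finset.univ) => hA0 k
    refine ⟨∑ k, A k + 1, by linarith,
      fun k s => (hA k s).trans ?_⟩
    have := Finset.single_le_sum (fun k _ => hA0 k) (Finset.mem_univ k)
    linarith
  obtain ⟨A, hA0, hA⟩ := hAp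
  set e : ℝ := 1 - 1 / (2 * (n + n + 1 : ℝ)) with he_def
  have he : 0 < e := by
    rw [he_def, sub_pos, div_lt_one (by positivity)]
    linarith
  have he1 : e < 1 := by
    rw [he_def]
    have : 0 < 1 / (2 * (n + n + 1 : ℝ)) := by positivity
    linarith
  set R : ℝ := 8 * n with hR_def
  have hR : 0 < R := by positivity
  set Bf' := Bf + 1
  have hBf'0 : 0 < Bf' := by positivity
  have hBf' : ∀ s, ‖h.fγ s‖ ≤ Bf' := fun s => (hBf s).trans (by simp [Bf'])
  set C1 : ℝ := (A * (B + 1) ^ (n + n)) * (2 * Bf') * R * N with hC1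
  set C2 : ℝ := (A * ((2 * B + 1) ^ n * ((2 * B + 1) ^ n * n))) * (2 * Bf') * (2 * R ^ 2) * N with
      hC2
  have hC10 : 0 ≤ C1 := by positivity
  have hC20 : 0 ≤ C2 := by positivity
  refine ⟨(n + n + 1).factorial * (C1 + C2) ^ (n + n + 1), by positivity, fun a ha hup hN w hw =>
      ?_⟩
  have hwa := lc_ne hw
  have hV : 0 < ‖w - a‖ := norm_pos_iff.2 (sub_ne_zero.2 hwa)
  set w' := 2 * a - w with hw'_def
  have hw' : 2 * a - w' ∈ lc n a := by
    have : 2 * a - w' = w := by rw [hw'_def]; ring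
    rwa [this]
  have hww' : w' - a = -(w - a) := by rw [hw'_def]; ring
  have hwX : w ∉ h.curve := ha.lc_subset hn hw
  have hwX' : w' ∉ h.curve := ha.uc_subset hn hw'
  have hc := ha.add_le_of_mem_lc hn hw
  have hc' : ∀ s, ‖h.fγ s - a‖ + ‖w - a‖ ≤ R * ‖h.fγ s - w'‖ := by
    have := ha.add_le_of_mem_uc hn hw'
    rwa [hww', norm_neg] at this
  obtain ⟨ζ, hζB, hζ⟩ := h.exists_roots_of_det_eq_zero hwX' hB0
    (by simpa using hB) (hup w' hw')
  obtain ⟨t, ht⟩ := ha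
  obtain ⟨c, hc1, hcsum⟩ := exists_prod_sub_C_eq_sum
    (Fin.append ζ fun k => h.γ (t k) i) (MvPolynomial.X i : MvPolynomial σ ℂ)
  set Ψ : MvPolynomial σ ℂ := ∑ j, algebraMap ℂ (MvPolynomial σ ℂ) (c j) * MvPolynomial.X i ^ (j :
      ℕ)
    with hΨ
  have hΨI : Ψ ∈ h.I hwX' := by
    rw [← hcsum, Fin.prod_univ_add]
    refine Ideal.mul_mem_right _ _ ?_
    simpa [MvPolynomial.algebraMap_eq] using hζ
  have hΨle : ∀ s, ‖MvPolynomial.eval (h.γ s) Ψ‖ ≤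
      ((2 * B + 1) ^ n * ((2 * B + 1) ^ n * n)) * ‖h.fγ s - a‖ := by
    intro s
    rw [← hcsum, Fin.prod_univ_add]
    simp only [Fin.append_left, Fin.append_right, map_mul, map_prod, map_sub, MvPolynomial.eval_X,
      MvPolynomial.algebraMap_eq, MvPolynomial.eval_C]
    rw [norm_mul, mul_assoc]
    have h1 : ‖∏ k, (h.γ s i - ζ k)‖ ≤ (2 * B + 1) ^ n := by
      rw [norm_prod]
      refine (Finset.prod_le_prod (fun _ _ => norm_nonneg _) (g := fun _ => 2 * B + 1)
        fun k _ => ?_).trans (by simp)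
      have := norm_sub_le (h.γ s i) (ζ k)
      linarith [hB s, hζB k]
    have h2 := GoodPt.norm_prod_le (h := h) hn (t := t) i (s := s) (fun hs => (ht s hs).2) hB
    gcongr
  set q := ‖w - a‖ ^ (e - 1) with hq
  have hq0 : 0 < q := by positivity
  have hentry : ∀ k (j : Fin (n + n + 1)), ‖h.Φ (x k) w (p k * .X i ^ (j : ℕ))‖ ≤ C1 * q := by
    intro k j
    have hA' : ∀ s, ‖MvPolynomial.eval (h.γ s) (p k * .X i ^ (j : ℕ))‖ ≤ A * (B + 1) ^ (n + n) := by
      intro s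
      rw [map_mul, map_pow, MvPolynomial.eval_X, norm_mul, norm_pow]
      gcongr
      · exact hA k s
      · calc ‖h.γ s i‖ ^ (j : ℕ) ≤ (B + 1) ^ (j : ℕ) := by
              gcongr
              linarith [hB s]
          _ ≤ _ := pow_le_pow_right₀ (by linarith) (by omega)
    have := h.norm_Φ_le_of_cone hR hwa hc (x k) (by positivity) hA' hBf'0 hBf' he he1 hN0 (hN k)
    exact this.trans_eq (by rw [hC1]; ring)
  have hlast : ∀ k, ‖h.Φ (x k) w (p k * Ψ)‖ ≤ C2 * q * ‖w - a‖ := by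
    intro k
    have h0 : h.Φ (x k) w' (p k * Ψ) = 0 := hΨI (x k) (p k)
    rw [← sub_zero (h.Φ (x k) w (p k * Ψ)), ← h0]
    have hA' : ∀ s, ‖MvPolynomial.eval (h.γ s) (p k * Ψ)‖ ≤
        (A * ((2 * B + 1) ^ n * ((2 * B + 1) ^ n * n))) * ‖h.fγ s - a‖ := by
      intro s
      rw [map_mul, norm_mul, mul_assoc]
      gcongr
      · exact hA k s
      · exact hΨle s
    have := h.norm_Φ_sub_Φ_le_of_cone hR hwa hwX hwX' hww' hc hc' (x k) (by positivity) hA' hBf'0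
      hBf' he he1 hN0 (hN k)
    exact this.trans_eq (by rw [hC2]; ring)
  set M : Matrix (Fin (n + n + 1)) (Fin (n + n + 1)) ℂ :=
    Matrix.of fun k j => h.Φ (x k) w (p k * .X i ^ (j : ℕ)) with hM
  have hdet : (M.updateCol (Fin.last (n + n)) fun k => ∑ j, c j • M k j).det = M.det := by
    rw [Matrix.det_updateCol_sum, hc1, one_smul]
  change ‖M.det‖ ≤ _
  rw [← hdet]
  refine (norm_det_le_of_last (b := (C1 + C2) * q) hV ?_ ?_).trans ?_
  · intro k j hj
    rw [Matrix.updateCol_ne hj]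
    refine (hentry k j).trans ?_
    gcongr
    linarith
  · intro k
    rw [Matrix.updateCol_self]
    have : ∑ j, c j • M k j = h.Φ (x k) w (p k * Ψ) := by
      rw [hΨ, MvPolynomial.algebraMap_eq, h.Φ_mul_sum_pow hwX]
      rfl
    rw [this]
    refine (hlast k).trans ?_
    gcongr
    linarith
  · rw [mul_pow, ← mul_assoc, mul_assoc _ (q ^ (n + n + 1))]
    gcongr
    refine le_of_eq ?_
    rw [hq, ← Real.rpow_natCast, ← Real.rpow_mul hV.le, ← Real.rpow_add_one hV.ne']
    congr 1
    rw [he_def]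
    push_cast
    field_simp
    ring

end
end HullData

theorem lintegral_abs_rpow_neg_lt_top {e : ℝ} (he1 : e < 1) :
    ∫⁻ u in Ioc (-1 : ℝ) 1, ENNReal.ofReal |u| ^ (-e) < ⊤ := by
  have h1 : IntervalIntegrable (fun u : ℝ => |u| ^ (-e)) volume 0 1 := by
    refine (intervalIntegral.intervalIntegrable_rpow' (r := -e) (by linarith)).congr ?_
    intro u hu
    rw [uIoc_of_le zero_le_one] at hu
    change u ^ (-e) = |u| ^ (-e)
    rw [abs_of_pos hu.1]
  have h2 : IntervalIntegrable (fun u : ℝ => |u| ^ (-e)) volume (-1) 0 := by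
    have := (IntervalIntegrable.iff_comp_neg (by simp)).1 h1
    simp only [abs_neg, neg_zero] at this
    exact this.symm
  have h3 := (h2.trans h1).1
  refine lt_of_le_of_lt (le_of_eq ?_) h3.lintegral_lt_top
  refine setLIntegral_congr_fun_ae measurableSet_Ioc ?_
  have : ∀ᵐ u : ℝ, u ≠ 0 := by
    rw [ae_iff]; simp
  filter_upwards [this] with u hu _
  rw [ENNReal.ofReal_rpow_of_pos (abs_pos.2 hu)]

theorem ae_lintegral_abs_sub_rpow_neg_lt_top {T : Type*} [MeasurableSpace T] (μ : Measure T)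
    [IsFiniteMeasure μ] {g : T → ℝ} (hg : Measurable g) {e : ℝ} (he : 0 < e) (he1 : e < 1) :
    ∀ᵐ c : ℝ, ∫⁻ s, ENNReal.ofReal |g s - c| ^ (-e) ∂μ < ⊤ := by
  have hkey : ∀ M : ℕ, ∀ᵐ c ∂(volume.restrict (Icc (-M : ℝ) M)),
      ∫⁻ s, ENNReal.ofReal |g s - c| ^ (-e) ∂μ < ⊤ := by
    intro M
    have hmeas : Measurable (Function.uncurry fun (c : ℝ) (s : T) =>
        ENNReal.ofReal |g s - c| ^ (-e)) := by
      have h0 : Measurable fun p : ℝ × T => g p.2 - p.1 := (hg.comp measurable_snd).sub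
          measurable_fst
      exact ((continuous_abs.measurable.comp h0).ennreal_ofReal).pow_const _
    refine ae_lt_top (Measurable.lintegral_prod_right hmeas) ?_
    rw [lintegral_lintegral_swap hmeas.aemeasurable]
    set J := ∫⁻ u in Ioc (-1 : ℝ) 1, ENNReal.ofReal |u| ^ (-e) with hJ
    have hJt : J < ⊤ := lintegral_abs_rpow_neg_lt_top he1
    have hle : ∀ s, ∫⁻ c in Icc (-M : ℝ) M, ENNReal.ofReal |g s - c| ^ (-e) ≤
        volume (Icc (-M : ℝ) M) + J := by
      intro s
      set φ : ℝ → ℝ≥0∞ := (Ioc (-1 : ℝ) 1).indicator fun u => ENNReal.ofReal |u| ^ (-e) with hφ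
      have hφm : Measurable φ := by
        refine Measurable.indicator ?_ measurableSet_Ioc
        exact (continuous_abs.measurable.ennreal_ofReal).pow_const _
      calc ∫⁻ c in Icc (-M : ℝ) M, ENNReal.ofReal |g s - c| ^ (-e)
          ≤ ∫⁻ c in Icc (-M : ℝ) M, (1 + φ (g s - c)) := by
            refine lintegral_mono fun c => ?_
            by_cases hc : g s - c ∈ Ioc (-1 : ℝ) 1
            · simp only [hφ, indicator_of_mem hc]
              exact le_add_self
            · simp only [hφ, indicator_of_notMem hc, add_zero]
              refine ENNReal.rpow_le_one_of_one_le_of_neg ?_ (by linarith)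
              rw [ENNReal.one_le_ofReal]
              by_contra! hlt
              rw [abs_lt] at hlt
              exact hc ⟨hlt.1, hlt.2.le⟩
        _ = volume (Icc (-M : ℝ) M) + ∫⁻ c in Icc (-M : ℝ) M, φ (g s - c) := by
            rw [lintegral_add_left measurable_const]
            simp
        _ ≤ volume (Icc (-M : ℝ) M) + ∫⁻ c, φ (g s - c) := by
            gcongr
            exact Measure.restrict_le_self
        _ = volume (Icc (-M : ℝ) M) + J := by
            rw [lintegral_sub_left_eq_self φ, hφ, lintegral_indicator measurableSet_Ioc]
    refine ((lintegral_mono hle).trans_lt ?_).ne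
    rw [lintegral_const]
    refine ENNReal.mul_lt_top (ENNReal.add_lt_top.2 ⟨?_, hJt⟩) (measure_lt_top _ _)
    simp
  have hall : ∀ᵐ c : ℝ, ∀ M : ℕ, c ∈ Icc (-M : ℝ) M →
      ∫⁻ s, ENNReal.ofReal |g s - c| ^ (-e) ∂μ < ⊤ :=
    ae_all_iff.2 fun M => (ae_restrict_iff' measurableSet_Icc).1 (hkey M)
  filter_upwards [hall] with c hc
  obtain ⟨M, hM⟩ := exists_nat_ge |c|
  exact hc M (abs_le.1 hM)

theorem convex_lowerCone (a : ℂ) (κ r : ℝ) : Convex ℝ (lowerCone a κ r) := by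
  intro v hv w hw s t hs ht hst
  obtain ⟨hv1, hv2⟩ := hv
  obtain ⟨hw1, hw2⟩ := hw
  rw [abs_lt] at hv1 hw1
  have hre : (s • v + t • w).re - a.re = s * (v.re - a.re) + t * (w.re - a.re) := by
    simp; linear_combination a.re * hst
  have him : a.im - (s • v + t • w).im = s * (a.im - v.im) + t * (a.im - w.im) := by
    simp; linear_combination (-a.im) * hst
  refine ⟨?_, ?_⟩
  · rw [hre, him, abs_lt]
    rcases hs.eq_or_lt with rfl | hs
    · have : t = 1 := by linarith
      subst this
      constructor <;> linarith
    · constructor <;> nlinarith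
  · rw [him]
    rcases hs.eq_or_lt with rfl | hs
    · have : t = 1 := by linarith
      subst this
      linarith
    · have h1 := mul_lt_mul_of_pos_left hv2 hs
      have h2 := mul_le_mul_of_nonneg_left hw2.le ht
      have h3 : s * r + t * r = r := by rw [← add_mul, hst, one_mul]
      linarith

theorem isOpen_lowerCone (a : ℂ) (κ r : ℝ) : IsOpen (lowerCone a κ r) := by
  refine IsOpen.and ?_ ?_
  · exact isOpen_lt (Complex.continuous_re.sub continuous_const).abs
      (continuous_const.mul (continuous_const.sub Complex.continuous_im))
  · exact isOpen_lt (continuous_const.sub Complex.continuous_im) continuous_const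

namespace HullData

theorem vertical_mem_lc {n : ℕ} (hn : 0 < n) {c τ t : ℝ} (h1 : t < τ) (h2 : τ - t < 1 / (6 * n)) :
    (⟨c, t⟩ : ℂ) ∈ lc n ⟨c, τ⟩ := by
  have hn0 : (0 : ℝ) < n := by exact_mod_cast hn
  refine ⟨?_, h2⟩
  simp only [sub_self, abs_zero]
  have : 0 < τ - t := by linarith
  positivity

theorem lc_mono {n n' : ℕ} (hn : 0 < n) (hnn : n ≤ n') (a : ℂ) : lc n' a ⊆ lc n a := by
  have hn0 : (0 : ℝ) < n := by exact_mod_cast hn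
  have hnn' : (n : ℝ) ≤ n' := by exact_mod_cast hnn
  rintro w ⟨h1, h2⟩
  have h3 : 0 < a.im - w.im := by
    by_contra! hle
    have : 1 / (4 * (n' : ℝ)) * (a.im - w.im) ≤ 0 :=
      mul_nonpos_of_nonneg_of_nonpos (by positivity) hle
    linarith [abs_nonneg (w.re - a.re)]
  refine ⟨h1.trans_le ?_, h2.trans_le ?_⟩ <;> gcongr

theorem norm_sub_le_one_of_mem_lc {n : ℕ} (hn : 0 < n) {a w : ℂ} (hw : w ∈ lc n a) :
    ‖w - a‖ ≤ 1 := by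
  obtain ⟨h1, h2⟩ := lc_mono one_pos hn a hw
  have h3 : ‖w - a‖ ≤ |w.re - a.re| + |w.im - a.im| := by
    simpa using Complex.norm_le_abs_re_add_abs_im (w - a)
  norm_num at h1 h2
  have h4 : |w.im - a.im| = a.im - w.im := by
    rw [abs_sub_comm, abs_of_pos]
    linarith [abs_nonneg (w.re - a.re)]
  rw [h4] at h3
  linarith

section
variable {T σ : Type*} [TopologicalSpace T] [MeasurableSpace T] (h : HullData T σ)

variable {h} in
theorem GoodPt.mono {n n' : ℕ} (hn : 0 < n) (hnn : n ≤ n') {a : ℂ} (ha : h.GoodPt n a) :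
    h.GoodPt n' a := by
  obtain ⟨t, ht⟩ := ha
  have hn0 : (0 : ℝ) < n := by exact_mod_cast hn
  have hnn' : (n : ℝ) ≤ n' := by exact_mod_cast hnn
  refine ⟨fun k => if hk : (k : ℕ) < n then t ⟨k, hk⟩ else t ⟨0, hn⟩, fun s hs => ?_⟩
  obtain ⟨h1, k, h2⟩ := ht s (hs.trans_le (by gcongr))
  refine ⟨h1.trans (by gcongr), ⟨k, k.2.trans_le hnn⟩, fun i => ?_⟩
  simp only [k.2, dif_pos]
  exact (h2 i).trans (by gcongr)

theorem isOpen_component [CompactSpace T] [T2Space T] (w : ℂ) :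
    IsOpen (connectedComponentIn h.curveᶜ w) :=
  h.isOpen_compl_curve.connectedComponentIn

variable [CompactSpace T] [BorelSpace T]

/-- The powers of a coordinate are dependent, to order `D`, over a component. -/
def Tame (i : σ) (D : ℕ) (w : ℂ) : Prop :=
  ∀ v ∈ connectedComponentIn h.curveᶜ w, ∀ (x : Fin (D + 1) → h.K) p, h.det (.X i) x p v = 0

theorem Φ_eq_zero_of_lt {B : ℝ} (hB : ∀ s, ‖h.fγ s‖ ≤ B) {w : ℂ} (hw : B < ‖w‖) :
    w ∉ h.curve ∧ ∀ x p, h.Φ x w p = 0 := by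
  have hwX : w ∉ h.curve := by
    rintro ⟨s, rfl⟩
    exact absurd (hB s) (not_le.2 hw)
  refine ⟨hwX, fun x p => ?_⟩
  have h1 : (h.f - MvPolynomial.C w) * 1 ∈ h.I hwX := by
    intro x p
    rw [mul_one]
    exact h.Φ_mul_sub hwX x p
  have h2 := mem_I_of_sub_mul_mem hB hw h1 x p
  rwa [mul_one] at h2

variable [T2Space T]

theorem tame_zero_of_lt {B : ℝ} (hB : ∀ s, ‖h.fγ s‖ ≤ B) {w : ℂ} (hw : B < ‖w‖) (i : σ) :
    h.Tame i 0 w := by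
  intro v hv x p
  have hwX := (h.Φ_eq_zero_of_lt hB hw).1
  refine (((h.differentiableOn_det (.X i) x p).mono (connectedComponentIn_subset _ _)).analyticOnNhd
    (h.isOpen_component w)).eqOn_zero_of_preconnected_of_eventuallyEq_zero
      isPreconnected_connectedComponentIn (mem_connectedComponentIn hwX) ?_ hv
  filter_upwards [continuous_norm.continuousAt.eventually (lt_mem_nhds hw)] with u hu
  exact (Matrix.det_fin_one _).trans ((h.Φ_eq_zero_of_lt hB hu).2 _ _)

theorem volume_re_image_component_eq_zero {n : ℕ} (hn : 0 < n) (i : σ) {q : ℂ}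
    (hq : ¬ h.Tame i (n + n) q) :
    volume (Complex.re '' {a | a ∈ h.curve ∧ h.GoodPt n a ∧ lc n a ⊆ connectedComponentIn h.curveᶜ
        q ∧
      ∀ w, 2 * a - w ∈ lc n a → ∀ (y : Fin (n + 1) → h.K) q, h.det (.X i) y q w = 0}) = 0 := by
  have hn0 : (0 : ℝ) < n := by exact_mod_cast hn
  simp only [Tame] at hq
  push Not at hq
  obtain ⟨v, hv, x, p, hne⟩ := hq
  set A := {a | a ∈ h.curve ∧ h.GoodPt n a ∧ lc n a ⊆ connectedComponentIn h.curveᶜ q ∧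
      ∀ w, 2 * a - w ∈ lc n a → ∀ (y : Fin (n + 1) → h.K) q, h.det (.X i) y q w = 0} with hA
  set J : Fin (n + n + 1) → ℝ → ℝ≥0∞ := fun k c =>
    ∫⁻ s, ENNReal.ofReal |(h.fγ s).re - c| ^ (-(1 - 1 / (2 * (n + n + 1 : ℝ)))) ∂h.μ (x k) with hJ
  have hJfin : ∀ᵐ c : ℝ, ∀ k, J k c < ⊤ := by
    refine ae_all_iff.2 fun k => ae_lintegral_abs_sub_rpow_neg_lt_top (h.μ (x k))
      (Complex.continuous_re.comp h.continuous_fγ).measurable ?_ ?_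
    · rw [sub_pos, div_lt_one (by positivity)]
      linarith
    · have : 0 < 1 / (2 * (n + n + 1 : ℝ)) := by positivity
      linarith
  have hnull : ∀ N : ℕ, volume (Complex.re '' {a ∈ A | ∀ k, J k a.re ≤ ENNReal.ofReal N}) = 0 := by
    intro N
    obtain ⟨C, hC0, hC⟩ := h.exists_norm_det_le_of_cone hn i x p (N := N) (Nat.cast_nonneg N)
    refine volume_re_image_vertices_eq_zero (Ω := connectedComponentIn h.curveᶜ q)
      (D := h.det (.X i) x p) (κ := 1 / (4 * n)) (r := 1 / (6 * n)) (C := C)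
      (h.isOpen_component q) isPreconnected_connectedComponentIn
      ((h.differentiableOn_det _ x p).mono (connectedComponentIn_subset _ _)) ⟨v, hv, hne⟩
      (by positivity) (by positivity) (fun a ha haΩ => connectedComponentIn_subset _ _ haΩ ha.1.1)
      (fun a ha => ha.1.2.2.1) (fun a ha w hw => ?_) fun a ha => ?_
    · refine (hC a ha.1.2.1 ha.1.2.2.2 ha.2 w hw).trans ?_
      refine mul_le_of_le_one_right hC0 (Real.rpow_le_one (norm_nonneg _) ?_ (by norm_num))
      exact norm_sub_le_one_of_mem_lc hn hw
    · refine squeeze_zero_norm' (a := fun w => C * ‖w - a‖ ^ (1 / 2 : ℝ)) ?_ ?_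
      · filter_upwards [self_mem_nhdsWithin] with w hw
        exact hC a ha.1.2.1 ha.1.2.2.2 ha.2 w hw
      · have hcont : Continuous fun w : ℂ => C * ‖w - a‖ ^ (1 / 2 : ℝ) :=
          continuous_const.mul ((continuous_id.sub continuous_const).norm.rpow_const
            fun _ => Or.inr (by norm_num))
        have := hcont.tendsto a
        simp only [sub_self, norm_zero] at this
        rw [Real.zero_rpow (by norm_num), mul_zero] at this
        exact this.mono_left nhdsWithin_le_nhds
  refine measure_mono_null (t := (⋃ N : ℕ, Complex.re '' {a ∈ A | ∀ k, J k a.re ≤ ENNReal.ofReal N})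
    ∪ {c | ¬ ∀ k, J k c < ⊤}) ?_ (measure_union_null (measure_iUnion_null hnull) hJfin)
  rintro _ ⟨a, ha, rfl⟩
  by_cases hfin : ∀ k, J k a.re < ⊤
  · left
    obtain ⟨N, hN⟩ := exists_nat_ge (∑ k, (J k a.re).toReal)
    refine mem_iUnion.2 ⟨N, a, ⟨ha, fun k => ?_⟩, rfl⟩
    rw [ENNReal.le_ofReal_iff_toReal_le (hfin k).ne (Nat.cast_nonneg N)]
    exact (Finset.single_le_sum (f := fun k => (J k a.re).toReal)
      (fun _ _ => ENNReal.toReal_nonneg) (Finset.mem_univ k)).trans hN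
  · exact Or.inr hfin

theorem exists_tame (hgood : ∀ᵐ c : ℝ, ∀ a : ℂ, a.re = c → ∃ n, 0 < n ∧ h.GoodPt n a) (i : σ)
    {w : ℂ} (hw : w ∉ h.curve) : ∃ D, h.Tame i D w := by
  by_contra! hbad
  set V : Set ℂ := {w | w ∉ h.curve ∧ ∀ D, ¬ h.Tame i D w} with hV
  have hsame : ∀ {u v}, v ∈ connectedComponentIn h.curveᶜ u → ∀ D, h.Tame i D u ↔ h.Tame i D v := by
    intro u v huv D
    simp only [Tame]
    rw [connectedComponentIn_eq huv]
  have hVopen : IsOpen V := by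
    refine isOpen_iff_mem_nhds.2 fun u hu => ?_
    filter_upwards [(h.isOpen_component u).mem_nhds (mem_connectedComponentIn hu.1)] with v hv
    exact ⟨connectedComponentIn_subset _ _ hv, fun D => by rw [← hsame hv]; exact hu.2 D⟩
  obtain ⟨B, hB0, hB⟩ := h.exists_bound h.f
  have hnull : ∀ᵐ c : ℝ, ∀ n m : ℕ, 0 < n → ¬ h.Tame i (n + n) (TopologicalSpace.denseSeq ℂ m) →
      c ∉ Complex.re '' {a | a ∈ h.curve ∧ h.GoodPt n a ∧
        lc n a ⊆ connectedComponentIn h.curveᶜ (TopologicalSpace.denseSeq ℂ m) ∧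
        ∀ w, 2 * a - w ∈ lc n a → ∀ (y : Fin (n + 1) → h.K) q, h.det (.X i) y q w = 0} := by
    refine ae_all_iff.2 fun n => ae_all_iff.2 fun m => ?_
    by_cases hn : 0 < n
    · by_cases hq : h.Tame i (n + n) (TopologicalSpace.denseSeq ℂ m)
      · exact Eventually.of_forall fun c _ hq' => absurd hq hq'
      · filter_upwards [measure_eq_zero_iff_ae_notMem.1
          (h.volume_re_image_component_eq_zero hn i hq)] with c hc _ _
        exact hc
    · exact Eventually.of_forall fun c hn' => absurd hn' hn
  have hline : ∀ y : ℝ, Continuous fun c : ℝ => (⟨c, y⟩ : ℂ) := fun y => by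
    have : (fun c : ℝ => (⟨c, y⟩ : ℂ)) = fun c : ℝ => (c : ℂ) + y * Complex.I := by
      funext c
      apply Complex.ext <;> simp
    rw [this]
    exact Complex.continuous_ofReal.add continuous_const
  have hvert : ∀ c : ℝ, Continuous fun y : ℝ => (⟨c, y⟩ : ℂ) := fun c => by
    have : (fun y : ℝ => (⟨c, y⟩ : ℂ)) = fun y : ℝ => (c : ℂ) + y * Complex.I := by
      funext y
      apply Complex.ext <;> simp
    rw [this]
    exact continuous_const.add (Complex.continuous_ofReal.mul continuous_const)
  obtain ⟨c, ⟨hcgood, hcnull⟩, hcV⟩ := (Measure.dense_of_ae (hgood.and hnull)).exists_mem_open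
    (hVopen.preimage (hline w.im)) ⟨w.re, ⟨hw, hbad⟩⟩
  set W : Set ℝ := (fun y : ℝ => (⟨c, y⟩ : ℂ)) ⁻¹' V with hW
  have hWopen : IsOpen W := hVopen.preimage (hvert c)
  have hWne : W.Nonempty := ⟨w.im, hcV⟩
  have hWbdd : BddAbove W := by
    refine ⟨B, fun y hy => ?_⟩
    by_contra! hlt
    refine hy.2 0 (h.tame_zero_of_lt hB (hlt.trans_le ?_) i)
    exact (le_abs_self y).trans (Complex.abs_im_le_norm ⟨c, y⟩)
  set τ := sSup W with hτ
  have hle : ∀ y ∈ W, y ≤ τ := fun y hy => le_csSup hWbdd hy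
  have hτW : τ ∉ W := by
    intro hmem
    obtain ⟨ε, hε, hball⟩ := Metric.isOpen_iff.1 hWopen τ hmem
    have : τ + ε / 2 ∈ W := hball (by
      rw [mem_ball, Real.dist_eq, add_sub_cancel_left, abs_of_pos (by linarith)]; linarith)
    linarith [hle _ this]
  have hclose : ∀ ε > 0, ∃ y ∈ W, y < τ ∧ τ - y < ε := by
    intro ε hε
    obtain ⟨y, hy, hlt⟩ := exists_lt_of_lt_csSup hWne (sub_lt_self τ hε)
    exact ⟨y, hy, (hle y hy).lt_of_ne fun heq => hτW (heq ▸ hy), by linarith⟩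
  set a : ℂ := ⟨c, τ⟩ with ha
  have haX : a ∈ h.curve := by
    by_contra haX
    have hopen : IsOpen ((fun y : ℝ => (⟨c, y⟩ : ℂ)) ⁻¹' connectedComponentIn h.curveᶜ a) :=
      (h.isOpen_component a).preimage (hvert c)
    obtain ⟨ε, hε, hball⟩ := Metric.isOpen_iff.1 hopen τ (mem_connectedComponentIn haX)
    obtain ⟨y, hyW, hy1, hy2⟩ := hclose ε hε
    have hyc : (⟨c, y⟩ : ℂ) ∈ connectedComponentIn h.curveᶜ a := hball (by
      rw [mem_ball, Real.dist_eq, abs_sub_comm, abs_of_pos (by linarith)]; exact hy2)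
    exact hτW ⟨haX, fun D => by rw [hsame hyc]; exact hyW.2 D⟩
  obtain ⟨n₀, hn₀, hn₀a⟩ := hcgood a rfl
  have huc : ∀ y, τ < y → y - τ < 1 / (6 * n₀) → 2 * a - (⟨c, y⟩ : ℂ) ∈ lc n₀ a := by
    intro y h1 h2
    have : 2 * a - (⟨c, y⟩ : ℂ) = ⟨c, 2 * τ - y⟩ := by
      apply Complex.ext
      · simp [ha]; ring
      · simp [ha]
    rw [this]
    exact vertical_mem_lc hn₀ (by linarith) (by linarith)
  have hn₀0 : (0 : ℝ) < n₀ := by exact_mod_cast hn₀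
  set y₁ := τ + 1 / (12 * n₀) with hy₁
  have hpos : (0 : ℝ) < 1 / (12 * n₀) := by positivity
  have hy₁mem : 2 * a - (⟨c, y₁⟩ : ℂ) ∈ lc n₀ a := by
    refine huc y₁ (by linarith) ?_
    rw [hy₁, add_sub_cancel_left]
    gcongr
    norm_num
  have hy₁X := hn₀a.uc_subset hn₀ hy₁mem
  have hy₁W : y₁ ∉ W := fun hmem => by linarith [hle _ hmem]
  obtain ⟨D, hD⟩ : ∃ D, h.Tame i D ⟨c, y₁⟩ := by
    by_contra! hno
    exact hy₁W ⟨hy₁X, hno⟩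
  have hucsub : (fun w => 2 * a - w) ⁻¹' lc n₀ a ⊆ connectedComponentIn h.curveᶜ ⟨c, y₁⟩ := by
    refine IsPreconnected.subset_connectedComponentIn ?_ hy₁mem fun w hw => hn₀a.uc_subset hn₀ hw
    have : (fun w => 2 * a - w) ⁻¹' lc n₀ a = (fun w => 2 * a - w) '' lc n₀ a := by
      ext w
      constructor
      · exact fun hw => ⟨2 * a - w, hw, by ring⟩
      · rintro ⟨u, hu, rfl⟩
        change 2 * a - (2 * a - u) ∈ lc n₀ a
        rwa [sub_sub_cancel]
    rw [this]
    exact (convex_lowerCone _ _ _).isPreconnected.image _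
      (continuous_const.sub continuous_id).continuousOn
  set n := max n₀ D with hn
  have hnn₀ : n₀ ≤ n := le_max_left _ _
  have hnpos : 0 < n := hn₀.trans_le hnn₀
  have hn0 : (0 : ℝ) < n := by exact_mod_cast hnpos
  have hna := hn₀a.mono hn₀ hnn₀
  obtain ⟨y₂, hy₂W, hy₂1, hy₂2⟩ := hclose (1 / (6 * n)) (by positivity)
  have hy₂mem : (⟨c, y₂⟩ : ℂ) ∈ lc n a := vertical_mem_lc hnpos hy₂1 hy₂2
  obtain ⟨m, hqlc⟩ := (TopologicalSpace.denseRange_denseSeq ℂ).exists_mem_open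
    (isOpen_lowerCone a (1 / (4 * n)) (1 / (6 * n))) ⟨_, hy₂mem⟩
  have hlcsub : lc n a ⊆ connectedComponentIn h.curveᶜ (TopologicalSpace.denseSeq ℂ m) :=
    (convex_lowerCone _ _ _).isPreconnected.subset_connectedComponentIn hqlc (hna.lc_subset hnpos)
  refine hcnull n m hnpos (fun hq => ?_) ⟨a, ⟨haX, hna, hlcsub, fun w hw y q => ?_⟩, rfl⟩
  · rw [hsame (hlcsub hy₂mem)] at hq
    exact hy₂W.2 _ hq
  · exact h.det_eq_zero_of_le (hna.uc_subset hnpos hw) (le_max_right n₀ D)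
      (hD w (hucsub (lc_mono hn₀ hnn₀ a hw))) y q

end

theorem ae_goodPt {σ : Type*} [Fintype σ] (h : HullData (Icc (0 : ℝ) 1) σ) {L M : ℝ≥0}
    (hγ : LipschitzWith L h.γ) (hf : LipschitzWith M h.fγ) :
    ∀ᵐ c : ℝ, ∀ a : ℂ, a.re = c → ∃ n, 0 < n ∧ h.GoodPt n a := by
  set g : ℝ → ℝ := fun s => (h.fγ (projIcc 0 1 zero_le_one s)).re with hg
  have hgl : LipschitzWith M g := by
    refine LipschitzWith.of_dist_le_mul fun s s' => ?_
    have h1 := hf.dist_le_mul (projIcc 0 1 zero_le_one s) (projIcc 0 1 zero_le_one s')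
    have h2 : dist (projIcc (0 : ℝ) 1 zero_le_one s) (projIcc 0 1 zero_le_one s') ≤ dist s s' := by
      simpa using (LipschitzWith.projIcc (zero_le_one (α := ℝ))).dist_le_mul s s'
    calc dist (g s) (g s') ≤ dist (h.fγ (projIcc 0 1 zero_le_one s))
          (h.fγ (projIcc 0 1 zero_le_one s')) := by
          rw [Real.dist_eq, dist_eq_norm, hg, ← Complex.sub_re]
          exact Complex.abs_re_le_norm _
      _ ≤ M * dist s s' := h1.trans (mul_le_mul_of_nonneg_left h2 M.2)
  filter_upwards [hgl.ae_finite_level_growth] with c ⟨F, hF01, hFc, C, hC, hgrow⟩ a hac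
  have hgs : ∀ s : Icc (0 : ℝ) 1, g s = (h.fγ s).re := fun s => by rw [hg]; simp
  have hfin : ∃ ε > 0, ∀ t ∈ F, ∀ ht : t ∈ Icc (0 : ℝ) 1, h.fγ ⟨t, ht⟩ ≠ a →
      ε ≤ ‖h.fγ ⟨t, ht⟩ - a‖ := by
    have : ∀ᶠ ε in 𝓝[>] (0 : ℝ), ∀ t ∈ F, ∀ ht : t ∈ Icc (0 : ℝ) 1, h.fγ ⟨t, ht⟩ ≠ a →
        ε ≤ ‖h.fγ ⟨t, ht⟩ - a‖ := by
      refine (Finset.eventually_all F).2 fun t _ => ?_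
      by_cases ht : t ∈ Icc (0 : ℝ) 1
      · by_cases hne : h.fγ ⟨t, ht⟩ = a
        · exact Eventually.of_forall fun ε _ hne' => absurd hne hne'
        · filter_upwards [Ioc_mem_nhdsGT (norm_pos_iff.2 (sub_ne_zero.2 hne))] with ε hε _ _
          exact hε.2
      · exact Eventually.of_forall fun ε ht' => absurd ht' ht
    obtain ⟨ε, hε, hε0⟩ := (this.and self_mem_nhdsWithin).exists
    exact ⟨ε, hε0, hε⟩
  obtain ⟨ε, hε, hsep⟩ := hfin
  obtain ⟨n, hn⟩ := exists_nat_gt (max (max (C * (1 + M) + 1) (L * C)) (max ((1 + M * C) / ε)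
      F.card))
  simp only [max_lt_iff] at hn
  obtain ⟨⟨hn1, hn2⟩, hn3, hn4⟩ := hn
  have hn0 : (0 : ℝ) < n := lt_of_le_of_lt (by positivity) hn4
  have hnn : 0 < n := by exact_mod_cast hn0
  have hFn : F.card ≤ n := by exact_mod_cast hn4.le
  classical
  let e : F ≃ Fin F.card := F.equivFin
  refine ⟨n, hnn, fun k => if hk : (k : ℕ) < F.card then
    ⟨(e.symm ⟨k, hk⟩ : ℝ), hF01 (e.symm ⟨k, hk⟩).2⟩ else ⟨0, by simp⟩, fun s hs => ?_⟩
  have hM0 : (0 : ℝ) ≤ M := M.2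
  have hre : |g s - c| ≤ ‖h.fγ s - a‖ := by
    rw [hgs, ← hac, ← Complex.sub_re]
    exact Complex.abs_re_le_norm _
  have hCn : C < n := by nlinarith
  obtain ⟨t, htF, hst⟩ := hgrow s s.2 (hre.trans_lt (hs.trans (one_div_lt_one_div_of_lt hC hCn)))
  have ht01 := hF01 htF
  set t' : Icc (0 : ℝ) 1 := ⟨t, ht01⟩ with ht'
  have hd : dist s t' = |(s : ℝ) - t| := by rw [Subtype.dist_eq, Real.dist_eq]
  have hfst : ‖h.fγ s - h.fγ t'‖ ≤ M * (C * |g s - c|) := by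
    rw [← dist_eq_norm]
    exact (hf.dist_le_mul s t').trans (mul_le_mul_of_nonneg_left (hd ▸ hst) hM0)
  have hft : h.fγ t' = a := by
    by_contra hne
    have h1 := hsep t htF ht01 hne
    have h2 : ‖h.fγ t' - a‖ ≤ ‖h.fγ s - h.fγ t'‖ + ‖h.fγ s - a‖ := by
      rw [norm_sub_rev (h.fγ s)]
      exact norm_sub_le_norm_sub_add_norm_sub _ _ _
    have h3 : M * (C * |g s - c|) ≤ M * (C * ‖h.fγ s - a‖) := by gcongr
    have h4 : ε ≤ (1 + M * C) * ‖h.fγ s - a‖ := by linarith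
    have h5 : (1 + M * C) * ‖h.fγ s - a‖ ≤ (1 + M * C) * (1 / n) := by gcongr
    rw [div_lt_iff₀ hε] at hn3
    have h6 : (1 + M * C) * (1 / n) < ε := by
      rw [mul_one_div, div_lt_iff₀ hn0]; linarith
    linarith
  refine ⟨?_, ⟨e ⟨t, htF⟩, (e ⟨t, htF⟩).2.trans_le hFn⟩, fun i => ?_⟩
  · rw [← hft] at hac ⊢
    rw [hac, ← hgs]
    refine hfst.trans ?_
    rw [← mul_assoc]
    gcongr
    nlinarith
  · simp only [(e ⟨t, htF⟩).2, dif_pos, Fin.eta, Equiv.symm_apply_apply]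
    have h1 := (dist_le_pi_dist (h.γ s) (h.γ t') i).trans (hγ.dist_le_mul s t')
    rw [dist_eq_norm] at h1
    refine h1.trans ?_
    calc (L : ℝ) * dist s t' ≤ L * (C * ‖h.fγ s - a‖) := by
          rw [hd]
          exact mul_le_mul_of_nonneg_left (hst.trans (by gcongr)) L.2
      _ ≤ n * ‖h.fγ s - a‖ := by rw [← mul_assoc]; gcongr

section
variable {T σ : Type*} [TopologicalSpace T] [MeasurableSpace T] (h : HullData T σ)
theorem finite_fiber_of_forall [Finite σ] {w : ℂ}
    (hfin : ∀ i, {z : ℂ | ∃ x : h.K, h.fK x = w ∧ (x : σ → ℂ) i = z}.Finite) :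
    {x : h.K | h.fK x = w}.Finite := by
  refine Set.Finite.of_finite_image (f := Subtype.val) ?_ Subtype.val_injective.injOn
  refine (Set.Finite.pi' hfin).subset ?_
  rintro _ ⟨x, hx, rfl⟩ i
  exact ⟨x, hx, rfl⟩

theorem uc_subset_component {n : ℕ} {a u : ℂ} (hn : 0 < n) (ha : h.GoodPt n a)
    (hu : 2 * a - u ∈ lc n a) {w : ℂ} (hw : 2 * a - w ∈ lc n a) :
    w ∈ connectedComponentIn h.curveᶜ u := by
  refine IsPreconnected.subset_connectedComponentIn (s := (fun w => 2 * a - w) ⁻¹' lc n a) ?_ hu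
    (fun w hw => ha.uc_subset hn hw) hw
  have : (fun w => 2 * a - w) ⁻¹' lc n a = (fun w => 2 * a - w) '' lc n a := by
    ext w
    constructor
    · exact fun hw => ⟨2 * a - w, hw, by ring⟩
    · rintro ⟨u, hu, rfl⟩
      change 2 * a - (2 * a - u) ∈ lc n a
      rwa [sub_sub_cancel]
  rw [this]
  exact (convex_lowerCone _ _ _).isPreconnected.image _
    (continuous_const.sub continuous_id).continuousOn

variable [CompactSpace T] [BorelSpace T]

variable {h} in
theorem Tame.exists_roots {i : σ} {D : ℕ} {w : ℂ} (hD : h.Tame i D w) (hw : w ∉ h.curve) {B : ℝ}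
    (hB0 : 0 ≤ B) (hB : ∀ s, ‖h.γ s i‖ ≤ B) :
    ∃ ζ : Fin D → ℂ, (∀ k, ‖ζ k‖ ≤ B) ∧
      ∏ k, (MvPolynomial.X i - MvPolynomial.C (ζ k)) ∈ h.I hw :=
  h.exists_roots_of_det_eq_zero hw hB0 (by simpa using hB)
    (hD w (mem_connectedComponentIn hw))

variable {h} in
theorem exists_eq_of_prod_mem_I {i : σ} {D : ℕ} {w : ℂ} {hw : w ∉ h.curve} {ζ : Fin D → ℂ}
    (hζ : ∏ k, (MvPolynomial.X i - MvPolynomial.C (ζ k)) ∈ h.I hw) {x : h.K} (hx : h.fK x = w) :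
    ∃ k, (x : σ → ℂ) i = ζ k := by
  have := eval_eq_zero_of_mem_I hζ hx
  rw [map_prod, Finset.prod_eq_zero_iff] at this
  obtain ⟨k, -, hk⟩ := this
  exact ⟨k, by simpa [sub_eq_zero] using hk⟩

theorem finite_fiber_of_goodPt [Finite σ] [T2Space T]
    (hgood : ∀ᵐ c : ℝ, ∀ a : ℂ, a.re = c → ∃ n, 0 < n ∧ h.GoodPt n a) {n : ℕ} {a : ℂ}
    (hn : 0 < n) (ha : h.GoodPt n a) : {x : h.K | h.fK x = a}.Finite := by
  refine h.finite_fiber_of_forall fun i => ?_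
  obtain ⟨B, hB0, hB'⟩ := h.exists_bound (.X i)
  have hB : ∀ s, ‖h.γ s i‖ ≤ B := by simpa using hB'
  have hn0 : (0 : ℝ) < n := by exact_mod_cast hn
  set ε : ℕ → ℝ := fun k => 1 / (6 * n) / (k + 2) with hε
  have hε0 : ∀ k, 0 < ε k := fun k => by positivity
  have hε1 : ∀ k, ε k < 1 / (6 * n) := fun k =>
    div_lt_self (by positivity) (by linarith [(Nat.cast_nonneg k : (0 : ℝ) ≤ k)])
  have hεlim : Tendsto ε atTop (𝓝 0) := by
    refine Tendsto.const_div_atTop ?_ _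
    exact tendsto_atTop_add_const_right _ _ tendsto_natCast_atTop_atTop
  set w : ℕ → ℂ := fun k => ⟨a.re, a.im + ε k⟩ with hw
  have hwuc : ∀ k, 2 * a - w k ∈ lc n a := fun k => by
    have : 2 * a - w k = ⟨a.re, a.im - ε k⟩ := by
      apply Complex.ext <;> simp [hw] <;> ring
    rw [this]
    exact vertical_mem_lc hn (by linarith [hε0 k]) (by linarith [hε1 k])
  have hwX : ∀ k, w k ∉ h.curve := fun k => ha.uc_subset hn (hwuc k)
  have hwlim : Tendsto w atTop (𝓝 a) := by
    have : w = fun k => a + (ε k : ℂ) * Complex.I := by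
      funext k
      apply Complex.ext <;> simp [hw]
    rw [this]
    have h2 := ((Complex.continuous_ofReal.tendsto 0).comp hεlim).mul_const Complex.I
    simpa using h2.const_add a
  obtain ⟨D, hD⟩ := h.exists_tame hgood i (hwX 0)
  have hroots : ∀ k, ∃ ζ : Fin D → ℂ, (∀ j, ‖ζ j‖ ≤ B) ∧
      ∏ j, (MvPolynomial.X i - MvPolynomial.C (ζ j)) ∈ h.I (hwX k) := fun k =>
    h.exists_roots_of_det_eq_zero (hwX k) hB0 hB'
      (hD _ (h.uc_subset_component hn ha (hwuc 0) (hwuc k)))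
  choose ζ hζB hζI using hroots
  obtain ⟨ξ, -, φ, hφ, hlim⟩ := (isCompact_univ_pi fun _ : Fin D =>
    isCompact_closedBall (0 : ℂ) B).tendsto_subseq (x := ζ) fun k => by
      rw [mem_univ_pi]
      exact fun j => mem_closedBall_zero_iff.2 (hζB k j)
  obtain ⟨t, ht⟩ := id ha
  set Q : MvPolynomial σ ℂ := ∏ k, (MvPolynomial.X i - MvPolynomial.C (h.γ (t k) i)) with hQ
  have key : ∀ x : h.K, h.fK x = a →
      MvPolynomial.eval (x : σ → ℂ) (Q * ∏ j, (MvPolynomial.X i - MvPolynomial.C (ξ j))) = 0 := by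
    intro x hx
    obtain ⟨BQ, hBQ0, hBQ⟩ := h.exists_bound Q
    have hΦ : ∀ k, h.Φ x (w (φ k))
        (Q * ∏ j, (MvPolynomial.X i - MvPolynomial.C (ζ (φ k) j))) = 0 := fun k => hζI (φ k) x Q
    have hcoord : ∀ j, Tendsto (fun k => ζ (φ k) j) atTop (𝓝 (ξ j)) := fun j =>
      tendsto_pi_nhds.1 hlim j
    have hwφ : Tendsto (fun k => w (φ k)) atTop (𝓝 a) := hwlim.comp hφ.tendsto_atTop
    set F : ℕ → T → ℂ := fun k s => MvPolynomial.eval (h.γ s)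
        (Q * ∏ j, (MvPolynomial.X i - MvPolynomial.C (ζ (φ k) j))) *
          ((h.fγ s - h.fK x) / (h.fγ s - w (φ k))) with hF
    have hmeas : ∀ k, AEStronglyMeasurable (F k) (h.μ x) := fun k =>
      Continuous.aestronglyMeasurable (continuous_kernel (hwX (φ k)) x
        (Q * ∏ j, (MvPolynomial.X i - MvPolynomial.C (ζ (φ k) j))))
    have hbound : ∀ k s, ‖F k s‖ ≤ BQ * (B + B) ^ D * (8 * n) := by
      intro k s
      rw [hF, norm_mul, map_mul, norm_mul]
      have h8 := ha.add_le_of_mem_uc hn (hwuc (φ k)) s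
      have h1 : ‖(h.fγ s - h.fK x) / (h.fγ s - w (φ k))‖ ≤ 8 * n := by
        rw [hx, norm_div, div_le_iff₀ (norm_pos_iff.2 (h.sub_ne_zero_of_notMem (hwX _) s))]
        linarith [norm_nonneg (w (φ k) - a)]
      have h2 : ‖MvPolynomial.eval (h.γ s)
          (∏ j, (MvPolynomial.X i - MvPolynomial.C (ζ (φ k) j)))‖ ≤ (B + B) ^ D := by
        rw [map_prod, norm_prod]
        refine (Finset.prod_le_prod (g := fun _ => B + B) (fun _ _ => norm_nonneg _)
          fun j _ => ?_).trans_eq (by simp)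
        simpa using (norm_sub_le _ _).trans (add_le_add (hB s) (hζB (φ k) j))
      exact mul_le_mul (mul_le_mul (hBQ s) h2 (norm_nonneg _) hBQ0) h1 (norm_nonneg _)
        (by positivity)
    have hpt : ∀ s, Tendsto (fun k => F k s) atTop (𝓝 (MvPolynomial.eval (h.γ s)
        (Q * ∏ j, (MvPolynomial.X i - MvPolynomial.C (ξ j))))) := by
      intro s
      have h1 : Tendsto (fun k => MvPolynomial.eval (h.γ s)
          (Q * ∏ j, (MvPolynomial.X i - MvPolynomial.C (ζ (φ k) j)))) atTop
          (𝓝 (MvPolynomial.eval (h.γ s) (Q * ∏ j, (MvPolynomial.X i - MvPolynomial.C (ξ j))))) := by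
        simp only [map_mul, map_prod, map_sub, MvPolynomial.eval_X, MvPolynomial.eval_C]
        exact tendsto_const_nhds.mul (tendsto_finsetProd _ fun j _ =>
          tendsto_const_nhds.sub (hcoord j))
      by_cases hs : h.fγ s = a
      · obtain ⟨k, hk⟩ := (ht s (by rw [hs]; simpa using hn)).2
        have hk' : h.γ s i = h.γ (t k) i := by
          have := hk i
          rw [hs, sub_self, norm_zero, mul_zero] at this
          exact sub_eq_zero.1 (norm_eq_zero.1 (le_antisymm this (norm_nonneg _)))
        have hQ0 : MvPolynomial.eval (h.γ s) Q = 0 := by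
          rw [hQ, map_prod]
          refine Finset.prod_eq_zero (Finset.mem_univ k) ?_
          simp [hk']
        simp [hF, hQ0]
      · have h2 : Tendsto (fun k => (h.fγ s - h.fK x) / (h.fγ s - w (φ k))) atTop (𝓝 1) := by
          have := (tendsto_const_nhds (x := h.fγ s - a)).div
            ((tendsto_const_nhds (x := h.fγ s)).sub hwφ) (sub_ne_zero.2 hs)
          rwa [div_self (sub_ne_zero.2 hs), ← hx] at this
        simpa [hF] using h1.mul h2
    have hconv := tendsto_integral_of_dominated_convergence (fun _ => BQ * (B + B) ^ D * (8 * n))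
      hmeas (integrable_const _) (fun k => Eventually.of_forall (hbound k))
      (Eventually.of_forall hpt)
    rw [h.repr] at hconv
    refine tendsto_nhds_unique hconv (tendsto_const_nhds.congr fun k => (hΦ k).symm)
  refine ((Set.finite_range fun k => h.γ (t k) i).union (Set.finite_range ξ)).subset ?_
  rintro _ ⟨x, hx, rfl⟩
  have := key x hx
  rw [map_mul, mul_eq_zero, hQ, map_prod, map_prod, Finset.prod_eq_zero_iff,
    Finset.prod_eq_zero_iff] at this
  rcases this with ⟨k, -, hk⟩ | ⟨k, -, hk⟩
  · exact Or.inl ⟨k, (sub_eq_zero.1 (by simpa using hk)).symm⟩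
  · exact Or.inr ⟨k, (sub_eq_zero.1 (by simpa using hk)).symm⟩

end
end HullData

theorem Set.countable_of_forall_eventually_nhdsNE {α : Type*} [TopologicalSpace α]
    [SecondCountableTopology α] {s : Set α} (hs : ∀ x ∈ s, ∀ᶠ y in 𝓝[≠] x, y ∉ s) :
    s.Countable := by
  obtain ⟨t, -, htc, hst⟩ := TopologicalSpace.countable_cover_nhdsWithin
    (f := fun x => {y | y ∈ s → y = x}) (s := s) fun x hx => by
      refine mem_nhdsWithin_of_mem_nhds ?_
      filter_upwards [eventually_nhdsWithin_iff.1 (hs x hx)] with y hy hys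
      by_contra hne
      exact hy hne hys
  refine htc.mono fun y hy => ?_
  obtain ⟨x, hx, hyx⟩ := mem_iUnion₂.1 (hst hy)
  rw [hyx hy]
  exact hx

/-- Bounded holomorphic functions extend over closed discrete sets. -/
theorem DifferentiableOn.exists_extension_of_bounded {Ω Z : Set ℂ} {g : ℂ → ℂ} {C : ℝ}
    (hΩ : IsOpen Ω) (hZ : ∀ w ∈ Ω, ∀ᶠ v in 𝓝[≠] w, v ∉ Z) (hg : DifferentiableOn ℂ g (Ω \ Z))
    (hC : ∀ w ∈ Ω \ Z, ‖g w‖ ≤ C) :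
    ∃ G : ℂ → ℂ, DifferentiableOn ℂ G Ω ∧ EqOn G g (Ω \ Z) ∧ ∀ w ∈ Ω, ‖G w‖ ≤ C := by
  classical
  suffices ∃ G : ℂ → ℂ, DifferentiableOn ℂ G Ω ∧ EqOn G g (Ω \ Z) by
    obtain ⟨G, hG, hGg⟩ := this
    refine ⟨G, hG, hGg, fun w hw => ?_⟩
    refine le_of_tendsto (((hG.differentiableAt (hΩ.mem_nhds
        hw)).continuousAt.norm.tendsto).mono_left
      nhdsWithin_le_nhds : Tendsto _ (𝓝[≠] w) _) ?_
    filter_upwards [hZ w hw, nhdsWithin_le_nhds (hΩ.mem_nhds hw)] with v hv hvΩ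
    rw [hGg ⟨hvΩ, hv⟩]
    exact hC v ⟨hvΩ, hv⟩
  refine ⟨fun w => if w ∈ Z then limUnder (𝓝[≠] w) g else g w, fun w hw => ?_, fun w hw => ?_⟩
  · have h1 : ∀ᶠ v in 𝓝 w, v ≠ w → v ∉ Z := eventually_nhdsWithin_iff.1 (hZ w hw)
    obtain ⟨U, hUsub, hU, hwU⟩ :=
      _root_.mem_nhds_iff.1 (h1.and (hΩ.mem_nhds hw))
    have hsub : U \ {w} ⊆ Ω \ Z := fun v hv => ⟨(hUsub hv.1).2, (hUsub hv.1).1 hv.2⟩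
    refine DifferentiableAt.differentiableWithinAt ?_
    by_cases hwZ : w ∈ Z
    · have hdiff := Complex.differentiableOn_update_limUnder_of_bddAbove (hU.mem_nhds hwU)
        (hg.mono hsub) ⟨C, by rintro _ ⟨v, hv, rfl⟩; exact hC v (hsub hv)⟩
      refine (hdiff.differentiableAt (hU.mem_nhds hwU)).congr_of_eventuallyEq ?_
      filter_upwards [hU.mem_nhds hwU] with v hv
      by_cases hvw : v = w
      · subst hvw
        simp [hwZ]
      · have hvZ : v ∉ Z := (hUsub hv).1 hvw
        simp [hvZ, hvw]
    · have hsub' : U ⊆ Ω \ Z := fun v hv => by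
        by_cases hvw : v = w
        · subst hvw; exact ⟨hw, hwZ⟩
        · exact hsub ⟨hv, hvw⟩
      refine ((hg.mono hsub').differentiableAt (hU.mem_nhds hwU)).congr_of_eventuallyEq ?_
      filter_upwards [hU.mem_nhds hwU] with v hv
      simp [(hsub' hv).2]
  · simp [hw.2]

/-- Symmetric functions of the roots are holomorphic if the coefficients are. -/
theorem differentiableOn_eval_of_isSymmetric {d : ℕ} {V : Set ℂ} {ζ : ℂ → Fin d → ℂ}
    (hζ : ∀ j, DifferentiableOn ℂ
      (fun w => (∏ k, (Polynomial.X - Polynomial.C (ζ w k))).coeff j) V)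
    {G : MvPolynomial (Fin d) ℂ} (hG : G.IsSymmetric) :
    DifferentiableOn ℂ (fun w => MvPolynomial.eval (ζ w) G) V := by
  have hes : ∀ k : Fin d, DifferentiableOn ℂ
      (fun w => MvPolynomial.eval (ζ w) (MvPolynomial.esymm (Fin d) ℂ (k + 1))) V := by
    intro k
    have hk : (k : ℕ) + 1 ≤ d := k.2
    have : ∀ w, MvPolynomial.eval (ζ w) (MvPolynomial.esymm (Fin d) ℂ (k + 1)) =
        (-1) ^ ((k : ℕ) + 1) *
          (∏ k, (Polynomial.X - Polynomial.C (ζ w k))).coeff (d - ((k : ℕ) + 1)) := by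
      intro w
      have h1 := Multiset.prod_X_sub_C_coeff (Finset.univ.val.map (ζ w)) (k := d - ((k : ℕ) + 1))
        (by simp)
      have h2 := MvPolynomial.aeval_esymm_eq_multiset_esymm (R := ℂ) (Fin d) ((k : ℕ) + 1) (ζ w)
      rw [Multiset.map_map] at h1
      have h3 : d - (d - ((k : ℕ) + 1)) = (k : ℕ) + 1 := by omega
      have h4 : (∏ k, (Polynomial.X - Polynomial.C (ζ w k))) = (Multiset.map
        ((fun t => Polynomial.X - Polynomial.C t) ∘ ζ w) Finset.univ.val).prod := rfl
      rw [h4, h1]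
      simp only [Multiset.card_map, Finset.card_val, Finset.card_univ, Fintype.card_fin, h3]
      rw [← h2, ← mul_assoc]
      rw [← MvPolynomial.coe_aeval_eq_eval, ← mul_pow, neg_one_mul, neg_neg, one_pow, one_mul]
      rfl
    simp only [this]
    exact (hζ _).const_mul _
  obtain ⟨q, hq⟩ := MvPolynomial.esymmAlgHom_fin_surjective (m := d) (n := d) ℂ le_rfl ⟨G, hG⟩
  have hq' : MvPolynomial.aeval (fun i : Fin d => MvPolynomial.esymm (Fin d) ℂ (i + 1)) q = G := by
    rw [← MvPolynomial.esymmAlgHom_apply, hq]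
  rw [← hq']
  clear hq hq' hG
  induction q using MvPolynomial.induction_on with
  | C r => simp
  | add p q hp hq =>
    simp only [map_add]
    exact hp.add hq
  | mul_X p i hp =>
    simp only [map_mul, MvPolynomial.aeval_X]
    exact hp.mul (hes i)

/-- The sum over all `p`-tuples of indices of the products of differences. -/
noncomputable def tupleDisc (d p : ℕ) : MvPolynomial (Fin d) ℂ :=
  ∑ e : Fin p → Fin d, ∏ ij ∈ (Finset.univ : Finset (Fin p)).offDiag,
    (MvPolynomial.X (e ij.1) - MvPolynomial.X (e ij.2))

theorem tupleDisc_isSymmetric (d p : ℕ) : (tupleDisc d p).IsSymmetric := by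
  intro τ
  rw [tupleDisc, map_sum]
  refine Fintype.sum_equiv ((Equiv.refl (Fin p)).arrowCongr τ) _ _ fun e => ?_
  simp [map_prod]

theorem eval_tupleDisc {d p : ℕ} (ζ : Fin d → ℂ) : MvPolynomial.eval ζ (tupleDisc d p) =
    ∑ e : Fin p → Fin d, ∏ ij ∈ (Finset.univ : Finset (Fin p)).offDiag,
      (ζ (e ij.1) - ζ (e ij.2)) := by
  simp [tupleDisc, map_sum, map_prod]

theorem prod_offDiag_eq_zero {d p : ℕ} {ζ : Fin d → ℂ} {e : Fin p → Fin d}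
    (he : ¬ Function.Injective (ζ ∘ e)) :
    ∏ ij ∈ (Finset.univ : Finset (Fin p)).offDiag, (ζ (e ij.1) - ζ (e ij.2)) = 0 := by
  simp only [Function.Injective, Function.comp] at he
  push Not at he
  obtain ⟨i, j, hij, hne⟩ := he
  exact Finset.prod_eq_zero (i := (i, j)) (by simp [hne]) (by simp [hij])

theorem norm_eval_tupleDisc_le {d p : ℕ} {ζ : Fin d → ℂ} {B : ℝ} (hB : ∀ k, ‖ζ k‖ ≤ B)
    (hp : (Finset.univ.image ζ).card ≤ p) {k l : Fin d} (hkl : ζ k ≠ ζ l) :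
    ‖MvPolynomial.eval ζ (tupleDisc d p)‖ ≤ d ^ p * (2 * B + 1) ^ (p * p) * ‖ζ k - ζ l‖ := by
  have hB0 : 0 ≤ B := (norm_nonneg _).trans (hB k)
  have hfac : ∀ i j, ‖ζ i - ζ j‖ ≤ 2 * B + 1 := fun i j => by
    linarith [norm_sub_le (ζ i) (ζ j), hB i, hB j]
  rw [eval_tupleDisc]
  refine (norm_sum_le _ _).trans ((Finset.sum_le_card_nsmul _ _
    ((2 * B + 1) ^ (p * p) * ‖ζ k - ζ l‖) fun e _ => ?_).trans_eq ?_)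
  · by_cases he : Function.Injective (ζ ∘ e)
    · have himg : Finset.univ.image (ζ ∘ e) = Finset.univ.image ζ := by
        refine Finset.eq_of_subset_of_card_le (fun z hz => ?_) ?_
        · simp only [Finset.mem_image, Finset.mem_univ, true_and, Function.comp] at hz ⊢
          exact hz.elim fun i hi => ⟨e i, hi⟩
        · rw [Finset.card_image_of_injective _ he]
          simpa using hp
      have hmem : ∀ k, ∃ i, ζ (e i) = ζ k := fun k => by
        have : ζ k ∈ Finset.univ.image (ζ ∘ e) := by rw [himg]; simp
        simpa using this
      obtain ⟨i, hi⟩ := hmem k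
      obtain ⟨j, hj⟩ := hmem l
      have hij : i ≠ j := by rintro rfl; exact hkl (hi.symm.trans hj)
      have hmemij : (i, j) ∈ (Finset.univ : Finset (Fin p)).offDiag := by simp [hij]
      rw [norm_prod, ← Finset.mul_prod_erase _ _ hmemij, mul_comm]
      simp only [hi, hj]
      refine mul_le_mul_of_nonneg_right ?_ (norm_nonneg _)
      refine (Finset.prod_le_prod (g := fun _ => 2 * B + 1) (fun _ _ => norm_nonneg _)
        fun _ _ => hfac _ _).trans ?_
      rw [Finset.prod_const]
      refine pow_le_pow_right₀ (by linarith) ?_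
      refine (Finset.card_erase_le).trans ?_
      rw [Finset.offDiag_card]
      simp
    · rw [prod_offDiag_eq_zero he, norm_zero]
      positivity
  · simp [mul_assoc]

theorem eval_tupleDisc_ne_zero {d p : ℕ} {ζ : Fin d → ℂ}
    (hp : (Finset.univ.image ζ).card = p) : MvPolynomial.eval ζ (tupleDisc d p) ≠ 0 := by
  classical
  set R := Finset.univ.image ζ with hR
  set V := ∏ ab ∈ R.offDiag, (ab.1 - ab.2) with hV
  have hV0 : V ≠ 0 := by
    refine Finset.prod_ne_zero_iff.2 fun ab hab => ?_
    exact sub_ne_zero.2 (Finset.mem_offDiag.1 hab).2.2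
  have hterm : ∀ e : Fin p → Fin d, ∏ ij ∈ (Finset.univ : Finset (Fin p)).offDiag,
      (ζ (e ij.1) - ζ (e ij.2)) = if Function.Injective (ζ ∘ e) then V else 0 := by
    intro e
    split_ifs with he
    · have himg : Finset.univ.image (ζ ∘ e) = R := by
        refine Finset.eq_of_subset_of_card_le (fun z hz => ?_) ?_
        · simp only [hR, Finset.mem_image, Finset.mem_univ, true_and, Function.comp] at hz ⊢
          exact hz.elim fun i hi => ⟨e i, hi⟩
        · rw [Finset.card_image_of_injective _ he]
          simp [hp]
      refine Finset.prod_nbij (fun ij => (ζ (e ij.1), ζ (e ij.2))) (fun ij hij => ?_)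
        (fun a _ b _ hab => ?_) (fun ab hab => ?_) fun _ _ => rfl
      · rw [Finset.mem_offDiag] at hij ⊢
        exact ⟨by simp [hR], by simp [hR], fun h => hij.2.2 (he h)⟩
      · simp only [Prod.mk.injEq] at hab
        exact Prod.ext (he hab.1) (he hab.2)
      · rw [Finset.mem_coe, Finset.mem_offDiag, ← himg] at hab
        simp only [Finset.mem_image, Finset.mem_univ, true_and, Function.comp] at hab
        obtain ⟨⟨i, hi⟩, ⟨j, hj⟩, hne⟩ := hab
        refine ⟨(i, j), ?_, Prod.ext hi hj⟩
        simp only [Finset.coe_offDiag, Finset.coe_univ, mem_offDiag, mem_univ, true_and]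
        rintro rfl
        exact hne (hi.symm.trans hj)
    · exact prod_offDiag_eq_zero he
  rw [eval_tupleDisc]
  simp only [hterm]
  rw [← Finset.sum_filter, Finset.sum_const, nsmul_eq_mul]
  refine mul_ne_zero (Nat.cast_ne_zero.2 (Finset.card_ne_zero.2 ?_)) hV0
  have hsec : ∀ z : R, ∃ k, ζ k = z := fun z =>
    (Finset.mem_image.1 z.2).imp fun _ hk => hk.2
  choose s hs using hsec
  let E := (R.equivFinOfCardEq hp).symm
  refine ⟨fun i => s (E i), ?_⟩
  rw [Finset.mem_filter]
  refine ⟨Finset.mem_univ _, fun i j hij => ?_⟩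
  simp only [Function.comp, hs] at hij
  exact E.injective (Subtype.ext hij)

theorem DifferentiableOn.matrix_det {m : ℕ} {A : ℂ → Matrix (Fin m) (Fin m) ℂ} {V : Set ℂ}
    (hA : ∀ i j, DifferentiableOn ℂ (fun w => A w i j) V) :
    DifferentiableOn ℂ (fun w => (A w).det) V := by
  simp only [Matrix.det_apply]
  exact DifferentiableOn.fun_sum fun τ _ => DifferentiableOn.const_smul
    (DifferentiableOn.fun_finsetProd fun i _ => hA _ _) _

/-- Cramer's rule for holomorphic systems of equations. -/
theorem differentiableOn_of_mulVec_eq {m : ℕ} {A : ℂ → Matrix (Fin m) (Fin m) ℂ}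
    {b c : ℂ → Fin m → ℂ} {V : Set ℂ} (hA : ∀ i j, DifferentiableOn ℂ (fun w => A w i j) V)
    (hb : ∀ i, DifferentiableOn ℂ (fun w => b w i) V) (hdet : ∀ w ∈ V, (A w).det ≠ 0)
    (hc : ∀ w ∈ V, (A w).mulVec (c w) = b w) (j : Fin m) :
    DifferentiableOn ℂ (fun w => c w j) V := by
  have h1 : DifferentiableOn ℂ (fun w => ((A w).updateCol j (b w)).det / (A w).det) V := by
    refine DifferentiableOn.div (.matrix_det fun i k => ?_) (.matrix_det hA) hdet
    by_cases hk : k = j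
    · subst hk
      simpa using hb i
    · simpa [Matrix.updateCol_ne hk] using hA i k
  refine h1.congr fun w hw => ?_
  rw [eq_div_iff (hdet w hw), ← Matrix.cramer_apply, Matrix.cramer_eq_adjugate_mulVec, ← hc w hw,
    Matrix.mulVec_mulVec, Matrix.adjugate_mul, Matrix.smul_mulVec, Matrix.one_mulVec]
  simp [mul_comm]

namespace HullData

section
variable {T σ : Type*} [TopologicalSpace T] [MeasurableSpace T] (h : HullData T σ)
variable [CompactSpace T] [BorelSpace T]

variable {h} in
theorem exists_mem_K_of_root [Fintype σ] {w : ℂ} (hw : w ∉ h.curve)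
    (htame : ∀ i, ∃ D, h.Tame i D w) {i : σ} {d : ℕ} {x : Fin d → h.K}
    {p : Fin d → MvPolynomial σ ℂ} (hdet : h.det (.X i) x p w ≠ 0) {ζ : Fin d → ℂ}
    (hζ : ∏ k, (MvPolynomial.X i - MvPolynomial.C (ζ k)) ∈ h.I hw) (k : Fin d) :
    ∃ x : h.K, h.fK x = w ∧ (x : σ → ℂ) i = ζ k := by
  choose D hD using htame
  have hroots : ∀ j, ∃ ξ : Fin (∑ j, D j) → ℂ,
      ∏ k, (MvPolynomial.X j - MvPolynomial.C (ξ k)) ∈ h.I hw := fun j => by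
    obtain ⟨B, hB0, hB⟩ := h.exists_bound (.X j)
    obtain ⟨ξ, -, hξ⟩ := h.exists_roots_of_det_eq_zero hw hB0 hB
      (h.det_eq_zero_of_le hw (Finset.single_le_sum (fun _ _ => Nat.zero_le _) (Finset.mem_univ j))
        (hD j w (mem_connectedComponentIn hw)))
    exact ⟨ξ, hξ⟩
  choose ξ hξ using hroots
  obtain _ | d := d
  · exact k.elim0
  obtain ⟨c, hc1, hc⟩ := exists_prod_sub_C_eq_sum (fun l => ζ (k.succAbove l))
    (MvPolynomial.X i : MvPolynomial σ ℂ)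
  rw [MvPolynomial.algebraMap_eq] at hc
  obtain ⟨y, hy, hyi⟩ := h.exists_mem_K_of_notMem_I hw hξ (H := .X i) (ζ := ζ k)
    (q := ∏ l, (MvPolynomial.X i - MvPolynomial.C (ζ (k.succAbove l)))) (fun hmem => by
      rw [hc] at hmem
      exact hdet (h.det_eq_zero_of_mem hw (fun h0 => by simp [h0] at hc1) hmem x p))
    (by rwa [Fin.prod_univ_succAbove _ k] at hζ)
  exact ⟨y, hy, by simpa using hyi⟩

theorem exists_discriminant [Fintype σ] [T2Space T] {w₀ : ℂ} (hw₀ : w₀ ∉ h.curve)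
    (htame : ∀ i, ∃ D, h.Tame i D w₀) (i : σ) :
    ∃ (d : ℕ) (G : MvPolynomial (Fin d) ℂ) (Δ : ℂ → ℂ) (Z : Set ℂ) (C : ℝ),
      DifferentiableOn ℂ Δ (connectedComponentIn h.curveᶜ w₀) ∧
      (∃ w ∈ connectedComponentIn h.curveᶜ w₀, Δ w ≠ 0) ∧
      (∀ w ∈ connectedComponentIn h.curveᶜ w₀, ∀ᶠ v in 𝓝[≠] w, v ∉ Z) ∧
      (∀ w ∈ connectedComponentIn h.curveᶜ w₀, ‖Δ w‖ ≤ C) ∧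
      ∀ w ∈ connectedComponentIn h.curveᶜ w₀ \ Z,
        (∀ x y : h.K, h.fK x = w → h.fK y = w → (x : σ → ℂ) i ≠ (y : σ → ℂ) i →
          ‖Δ w‖ ≤ C * ‖(x : σ → ℂ) i - (y : σ → ℂ) i‖) ∧
        ∃ ζ : Fin d → ℂ, (∀ k, ∃ x : h.K, h.fK x = w ∧ (x : σ → ℂ) i = ζ k) ∧
          Δ w = MvPolynomial.eval ζ G := by
  classical
  set Ω := connectedComponentIn h.curveᶜ w₀ with hΩ
  have hΩopen : IsOpen Ω := h.isOpen_component w₀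
  have hΩconn : IsPreconnected Ω := isPreconnected_connectedComponentIn
  have hΩX : ∀ w ∈ Ω, w ∉ h.curve := fun w hw => connectedComponentIn_subset _ _ hw
  have hsame : ∀ w ∈ Ω, ∀ j, ∃ D, h.Tame j D w := fun w hw j => by
    obtain ⟨D, hD⟩ := htame j
    exact ⟨D, fun v hv => hD v (by rwa [← connectedComponentIn_eq hw] at hv)⟩
  set d := Nat.find (htame i) with hd
  have hdT : h.Tame i d w₀ := Nat.find_spec (htame i)
  obtain ⟨x, p, v₀, hv₀, hD₀⟩ : ∃ (x : Fin d → h.K) (p : Fin d → MvPolynomial σ ℂ),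
      ∃ v ∈ Ω, h.det (.X i) x p v ≠ 0 := by
    rcases Nat.eq_zero_or_pos d with h0 | h0
    · rw [h0]
      exact ⟨Fin.elim0, Fin.elim0, w₀, mem_connectedComponentIn hw₀, by simp [det]⟩
    · obtain ⟨d', hd'⟩ := Nat.exists_eq_add_of_lt h0
      have hlt : d' < d := by omega
      have := Nat.find_min (htame i) hlt
      simp only [Tame] at this
      push Not at this
      obtain ⟨v, hv, x, p, hne⟩ := this
      have hdd : d = d' + 1 := by omega
      rw [hdd]
      exact ⟨x, p, v, hv, hne⟩
  clear_value d
  set D₀ := h.det (.X i) x p with hD₀def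
  have hD₀diff : DifferentiableOn ℂ D₀ Ω := (h.differentiableOn_det _ x p).mono hΩX
  set Z : Set ℂ := {w | D₀ w = 0} with hZ
  have hZdisc : ∀ w ∈ Ω, ∀ᶠ v in 𝓝[≠] w, v ∉ Z := fun w hw => by
    have han := hD₀diff.analyticOnNhd hΩopen
    rcases (han w hw).eventually_eq_zero_or_eventually_ne_zero with h0 | h0
    · exact absurd (han.eqOn_zero_of_preconnected_of_eventuallyEq_zero hΩconn hw h0 hv₀) hD₀
    · exact h0
  obtain ⟨B, hB0, hB⟩ := h.exists_bound (.X i)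
  have hroots : ∀ w, ∃ ζ : Fin d → ℂ, ∀ hw : w ∈ Ω, (∀ k, ‖ζ k‖ ≤ B) ∧
      ∏ k, (MvPolynomial.X i - MvPolynomial.C (ζ k)) ∈ h.I (hΩX w hw) := fun w => by
    by_cases hw : w ∈ Ω
    · obtain ⟨ζ, hζ1, hζ2⟩ := h.exists_roots_of_det_eq_zero (hΩX w hw) hB0 hB (hdT w hw)
      exact ⟨ζ, fun _ => ⟨hζ1, hζ2⟩⟩
    · exact ⟨0, fun hw' => absurd hw' hw⟩
  choose ζ hζ using hroots
  have hcoeff : ∀ j, DifferentiableOn ℂ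
      (fun w => (∏ k, (Polynomial.X - Polynomial.C (ζ w k))).coeff j) (Ω \ Z) := by
    intro j
    rcases lt_trichotomy j d with hj | rfl | hj
    · refine differentiableOn_of_mulVec_eq (V := Ω \ Z)
        (A := fun w => Matrix.of fun a b => h.Φ (x a) w (p a * .X i ^ (b : ℕ)))
        (b := fun w a => -h.Φ (x a) w (p a * .X i ^ d))
        (c := fun w (j : Fin d) => (∏ k, (Polynomial.X - Polynomial.C (ζ w k))).coeff j)
        (fun a b => (h.differentiableOn_Φ _ _).mono fun w hw => hΩX w hw.1)
        (fun a => ((h.differentiableOn_Φ _ _).mono fun w hw => hΩX w hw.1).neg)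
        (fun w hw => hw.2) (fun w hw => funext fun a => ?_) ⟨j, hj⟩
      have h1 := (hζ w hw.1).2
      have h2 := prod_sub_algebraMap_eq_sum (ζ w) (MvPolynomial.X i : MvPolynomial σ ℂ)
      rw [MvPolynomial.algebraMap_eq] at h2
      rw [h2] at h1
      have h3 := h1 (x a) (p a)
      rw [h.Φ_mul_sum_pow (hΩX w hw.1), Fin.sum_univ_castSucc] at h3
      simp only [Fin.val_last, Fin.val_castSucc, coeff_prod_X_sub_C_eq_one, one_mul] at h3
      rw [← eq_neg_iff_add_eq_zero] at h3
      rw [← h3]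
      simp [Matrix.mulVec, dotProduct, mul_comm]
    · simp only [coeff_prod_X_sub_C_eq_one]
      exact differentiableOn_const _
    · have : ∀ w, (∏ k, (Polynomial.X - Polynomial.C (ζ w k))).coeff j = 0 := fun w =>
        Polynomial.coeff_eq_zero_of_natDegree_lt (by
          rwa [Polynomial.natDegree_finsetProd_X_sub_C_eq_card, Finset.card_univ,
            Fintype.card_fin])
      simp only [this]
      exact differentiableOn_const _
  obtain ⟨w₁, hw₁, hmax⟩ : ∃ w₁ ∈ Ω \ Z, ∀ w ∈ Ω \ Z,
      (Finset.univ.image (ζ w)).card ≤ (Finset.univ.image (ζ w₁)).card := by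
    set S : Set ℕ := (fun w => (Finset.univ.image (ζ w)).card) '' (Ω \ Z) with hS
    have hSb : BddAbove S := ⟨d, by
      rintro _ ⟨w, -, rfl⟩
      exact Finset.card_image_le.trans (by simp)⟩
    obtain ⟨w₁, hw₁, heq⟩ := Nat.sSup_mem (s := S) ⟨_, v₀, ⟨hv₀, hD₀⟩, rfl⟩ hSb
    refine ⟨w₁, hw₁, fun w hw => ?_⟩
    change _ ≤ (fun w => (Finset.univ.image (ζ w)).card) w₁
    rw [heq]
    exact le_csSup hSb ⟨w, hw, rfl⟩
  set q := (Finset.univ.image (ζ w₁)).card with hq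
  set G := tupleDisc d q with hG
  have hGd : DifferentiableOn ℂ (fun w => MvPolynomial.eval (ζ w) G) (Ω \ Z) :=
    differentiableOn_eval_of_isSymmetric hcoeff (tupleDisc_isSymmetric d q)
  obtain ⟨C₁, hC₁⟩ : ∃ C, ∀ ξ : Fin d → ℂ, (∀ k, ‖ξ k‖ ≤ B) → ‖MvPolynomial.eval ξ G‖ ≤ C := by
    obtain ⟨C, hC⟩ := (isCompact_univ_pi fun _ : Fin d =>
      isCompact_closedBall (0 : ℂ) B).exists_bound_of_continuousOn
      (f := fun ξ => MvPolynomial.eval ξ G) (MvPolynomial.continuous_eval G).continuousOn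
    exact ⟨C, fun ξ hξ => hC ξ fun k _ => mem_closedBall_zero_iff.2 (hξ k)⟩
  obtain ⟨Δ, hΔd, hΔeq, hΔb⟩ := hGd.exists_extension_of_bounded hΩopen hZdisc
    fun w hw => hC₁ _ (hζ w hw.1).1
  set C₂ : ℝ := d ^ q * (2 * B + 1) ^ (q * q) with hC₂
  refine ⟨d, G, Δ, Z, max C₁ C₂, hΔd, ⟨w₁, hw₁.1, ?_⟩, hZdisc,
    fun w hw => (hΔb w hw).trans (le_max_left _ _), fun w hw => ⟨fun y z hy hz hne => ?_, ζ w,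
      exists_mem_K_of_root (hΩX w hw.1) (hsame w hw.1) hw.2 (hζ w hw.1).2, hΔeq hw⟩⟩
  · rw [hΔeq hw₁]
    exact eval_tupleDisc_ne_zero rfl
  · obtain ⟨k, hk⟩ := exists_eq_of_prod_mem_I (hζ w hw.1).2 hy
    obtain ⟨l, hl⟩ := exists_eq_of_prod_mem_I (hζ w hw.1).2 hz
    rw [hk, hl] at hne ⊢
    rw [hΔeq hw]
    exact (norm_eval_tupleDisc_le (hζ w hw.1).1 (hmax w hw) hne).trans
      (mul_le_mul_of_nonneg_right (le_max_right _ _) (norm_nonneg _))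

end
end HullData

theorem isCompact_hullPts {T σ : Type*} [TopologicalSpace T] [CompactSpace T] [Nonempty T]
    [Fintype σ] {γ : T → σ → ℂ} (hγ : Continuous γ) : IsCompact (hullPts γ) := by
  have hmax : ∀ p : MvPolynomial σ ℂ, ∃ s, ∀ s', ‖MvPolynomial.eval (γ s') p‖ ≤
      ‖MvPolynomial.eval (γ s) p‖ := fun p => by
    obtain ⟨s, -, hs⟩ := isCompact_univ.exists_isMaxOn univ_nonempty
      (continuous_eval_comp hγ p).norm.continuousOn
    exact ⟨s, fun s' => hs (mem_univ s')⟩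
  choose s hs using hmax
  have heq : hullPts γ = ⋂ p, {x | ‖MvPolynomial.eval x p‖ ≤ ‖MvPolynomial.eval (γ (s p)) p‖} := by
    ext x
    rw [mem_iInter]
    refine forall_congr' fun p => ⟨fun ⟨t, ht⟩ => ht.trans (hs p t), fun h => ⟨s p, h⟩⟩
  refine Metric.isCompact_of_isClosed_isBounded ?_ ?_
  · rw [heq]
    exact isClosed_iInter fun p =>
      isClosed_le (MvPolynomial.continuous_eval p).norm continuous_const
  · refine (Bornology.isBounded_def.2 ?_ : Bornology.IsBounded
      (Set.pi univ fun i => closedBall (0 : ℂ) ‖γ (s (.X i)) i‖)).subset fun x hx i _ => ?_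
    · exact (isCompact_univ_pi fun i => isCompact_closedBall _ _).isBounded
    · obtain ⟨t, ht⟩ := hx (.X i)
      have := ht.trans (hs _ t)
      simpa using this

/-- A continuous function on a convex set with finitely many cluster values at a boundary point,
one of which is zero, tends to zero. -/
theorem tendsto_zero_of_frequently_of_finite {V F : Set ℂ} {a : ℂ} {g : ℂ → ℂ} (hV : Convex ℝ V)
    (hg : ContinuousOn g V) (hF : F.Finite)
    (hclus : ∀ ε > 0, ∀ᶠ w in 𝓝[V] a, ∃ φ ∈ F, ‖g w - φ‖ < ε)
    (hfreq : ∀ ε > 0, ∃ᶠ w in 𝓝[V] a, ‖g w‖ < ε) : Tendsto g (𝓝[V] a) (𝓝 0) := by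
  refine Metric.tendsto_nhds.2 fun ε hε => ?_
  obtain ⟨η, ⟨hη, hηε⟩, hη0⟩ : ∃ η : ℝ, ((∀ φ ∈ F, φ ≠ 0 → 3 * η < ‖φ‖) ∧ η < ε) ∧ 0 < η := by
    have h1 : ∀ᶠ η in 𝓝[>] (0 : ℝ), ∀ φ ∈ F, φ ≠ 0 → 3 * η < ‖φ‖ := by
      refine (eventually_all_finite hF).2 fun φ _ => ?_
      by_cases h0 : φ = 0
      · exact Eventually.of_forall fun _ hne => absurd h0 hne
      · have hpos : 0 < ‖φ‖ / 3 := by positivity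
        filter_upwards [Ioo_mem_nhdsGT hpos] with η hη _
        linarith [hη.2]
    have h2 : ∀ᶠ η in 𝓝[>] (0 : ℝ), η < ε := by
      filter_upwards [Ioo_mem_nhdsGT hε] with η hη
      exact hη.2
    exact ((h1.and h2).and self_mem_nhdsWithin).exists
  have hgap : ∀ᶠ w in 𝓝[V] a, ‖g w‖ < η ∨ 2 * η < ‖g w‖ := by
    filter_upwards [hclus η hη0] with w ⟨φ, hφ, hw⟩
    by_cases h0 : φ = 0
    · left
      rwa [h0, sub_zero] at hw
    · right
      have := hη φ hφ h0
      have h3 := norm_sub_norm_le φ (g w)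
      rw [norm_sub_rev] at h3
      linarith
  obtain ⟨ρ, hρ, hball⟩ := mem_nhdsWithin_iff.1 hgap
  obtain ⟨w₀, hw₀, hw₀V, hw₀b⟩ := ((hfreq η hη0).and_eventually
    (inter_mem self_mem_nhdsWithin (mem_nhdsWithin_of_mem_nhds (ball_mem_nhds a hρ)))).exists
  refine mem_nhdsWithin_iff.2 ⟨ρ, hρ, fun w hw => ?_⟩
  change dist (g w) 0 < ε
  rw [dist_zero_right]
  rcases hball hw with h1 | h1
  · exact h1.trans hηε
  · exfalso
    have hconn : IsPreconnected (ball a ρ ∩ V) := ((convex_ball a ρ).inter hV).isPreconnected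
    obtain ⟨w', hw', heq⟩ := hconn.intermediate_value (f := fun w => ‖g w‖) ⟨hw₀b, hw₀V⟩ hw
      (hg.mono inter_subset_right).norm
      (show 3 / 2 * η ∈ Icc _ _ from ⟨by linarith, by linarith⟩)
    have heq' : ‖g w'‖ = 3 / 2 * η := heq
    rcases hball hw' with h2 | h2 <;> linarith

namespace HullData

section
variable {T σ : Type*} [TopologicalSpace T] [MeasurableSpace T] (h : HullData T σ)
theorem continuous_fK : Continuous h.fK :=
  (MvPolynomial.continuous_eval h.f).comp continuous_subtype_val

theorem eventually_exists_norm_eval_sub_lt [CompactSpace h.K] {d : ℕ}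
    (G : MvPolynomial (Fin d) ℂ) (i : σ) (a : ℂ) {ε : ℝ} (hε : 0 < ε) :
    ∀ᶠ w in 𝓝 a, ∀ x : Fin d → h.K, (∀ k, h.fK (x k) = w) →
      ∃ φ ∈ (fun x : Fin d → h.K => MvPolynomial.eval (fun k => (x k : σ → ℂ) i) G) ''
        {x | ∀ k, h.fK (x k) = a},
        ‖MvPolynomial.eval (fun k => (x k : σ → ℂ) i) G - φ‖ < ε := by
  have hcont : Continuous
      fun x : Fin d → h.K => MvPolynomial.eval (fun k => (x k : σ → ℂ) i) G :=
    (MvPolynomial.continuous_eval G).comp (continuous_pi fun k =>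
      (continuous_apply i).comp (continuous_subtype_val.comp (continuous_apply k)))
  have := isCompact_univ.eventually_forall_of_forall_eventually (x₀ := a)
    (P := fun (w : ℂ) (x : Fin d → h.K) => (∀ k, h.fK (x k) = w) →
      ∃ φ ∈ (fun x : Fin d → h.K => MvPolynomial.eval (fun k => (x k : σ → ℂ) i) G) ''
        {x | ∀ k, h.fK (x k) = a},
        ‖MvPolynomial.eval (fun k => (x k : σ → ℂ) i) G - φ‖ < ε) (K := univ) fun x _ => by
      by_cases hx : ∀ k, h.fK (x k) = a
      · have h1 := (hcont.comp continuous_snd).tendsto (a, x)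
        filter_upwards [Metric.tendsto_nhds.1 h1 ε hε] with z hz _
        exact ⟨_, ⟨x, hx, rfl⟩, by simpa [dist_eq_norm] using hz⟩
      · push Not at hx
        obtain ⟨k, hk⟩ := hx
        have h1 : Continuous fun z : ℂ × (Fin d → h.K) => h.fK (z.2 k) - z.1 :=
          (h.continuous_fK.comp ((continuous_apply k).comp continuous_snd)).sub continuous_fst
        filter_upwards [h1.continuousAt.eventually_ne (sub_ne_zero.2 hk)] with z hz hall
        exact absurd (hall k) (sub_ne_zero.1 hz)
  filter_upwards [this] with w hw x hx using hw x (mem_univ x) hx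

end

section
variable {T σ : Type*} [TopologicalSpace T] [MeasurableSpace T] (h : HullData T σ)

theorem continuous_coord (i : σ) : Continuous fun x : h.K => (x : σ → ℂ) i :=
  (continuous_apply i).comp continuous_subtype_val

theorem eventually_coord_eq_of_ne_zero {i : σ} {Ω Z : Set ℂ} {Δ : ℂ → ℂ} {C : ℝ} (hΩ : IsOpen Ω)
    (hΔ : ContinuousOn Δ Ω)
    (hsep : ∀ w ∈ Ω \ Z, ∀ x y : h.K, h.fK x = w → h.fK y = w →
      (x : σ → ℂ) i ≠ (y : σ → ℂ) i → ‖Δ w‖ ≤ C * ‖(x : σ → ℂ) i - (y : σ → ℂ) i‖)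
    {z : h.K} (hz : h.fK z ∈ Ω) (hne : Δ (h.fK z) ≠ 0)
    (hZ : ∀ w ∈ Ω, w.re = (h.fK z).re → w ∉ Z) :
    ∀ᶠ q : h.K × h.K in 𝓝 (z, z), h.fK q.1 = h.fK q.2 → (h.fK q.1).re = (h.fK z).re →
      (q.1 : σ → ℂ) i = (q.2 : σ → ℂ) i := by
  have h1 : Tendsto (fun q : h.K × h.K => h.fK q.1) (𝓝 (z, z)) (𝓝 (h.fK z)) :=
    (h.continuous_fK.comp continuous_fst).tendsto (z, z)
  have h2 : Tendsto (fun q : h.K × h.K => C * ‖(q.1 : σ → ℂ) i - (q.2 : σ → ℂ) i‖) (𝓝 (z, z))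
      (𝓝 0) := by
    have : Continuous fun q : h.K × h.K => C * ‖(q.1 : σ → ℂ) i - (q.2 : σ → ℂ) i‖ :=
      continuous_const.mul (((h.continuous_coord i).comp continuous_fst).sub
        ((h.continuous_coord i).comp continuous_snd)).norm
    simpa using this.tendsto (z, z)
  have h3 : Tendsto (fun q : h.K × h.K => ‖Δ (h.fK q.1)‖) (𝓝 (z, z)) (𝓝 ‖Δ (h.fK z)‖) :=
    ((hΔ.continuousAt (hΩ.mem_nhds hz)).tendsto.comp h1).norm
  filter_upwards [h1 (hΩ.mem_nhds hz), h2.eventually_lt h3 (norm_pos_iff.2 hne)] with q hq hlt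
    heq hre
  by_contra hcon
  exact absurd (hsep _ ⟨hq, hZ _ hq hre⟩ q.1 q.2 rfl heq.symm hcon) (not_le.2 hlt)

theorem eventually_eq_of_finite_fiber {z : h.K} (hfin : {x : h.K | h.fK x = h.fK z}.Finite) :
    ∀ᶠ x in 𝓝 z, h.fK x = h.fK z → x = z := by
  have : ({x : h.K | h.fK x = h.fK z} \ {z})ᶜ ∈ 𝓝 z :=
    (hfin.subset sdiff_subset).isClosed.isOpen_compl.mem_nhds (by simp)
  filter_upwards [this] with x hx hxz
  by_contra hne
  exact hx ⟨hxz, hne⟩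

theorem eventually_coord_eq_of_not_tendsto [CompactSpace h.K] {i : σ} {Ω Z : Set ℂ} {Δ : ℂ → ℂ}
    {C : ℝ} {d : ℕ} {G : MvPolynomial (Fin d) ℂ} (hΩ : IsOpen Ω) (hΔ : ContinuousOn Δ Ω)
    (hZd : ∀ w ∈ Ω, ∀ᶠ v in 𝓝[≠] w, v ∉ Z)
    (hsep : ∀ w ∈ Ω \ Z, (∀ x y : h.K, h.fK x = w → h.fK y = w →
      (x : σ → ℂ) i ≠ (y : σ → ℂ) i → ‖Δ w‖ ≤ C * ‖(x : σ → ℂ) i - (y : σ → ℂ) i‖) ∧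
      ∃ ζ : Fin d → ℂ, (∀ k, ∃ x : h.K, h.fK x = w ∧ (x : σ → ℂ) i = ζ k) ∧
        Δ w = MvPolynomial.eval ζ G)
    {z : h.K} {n : ℕ} (hn : 0 < n) (hlc : lc n (h.fK z) ⊆ Ω)
    (hlim : ¬ Tendsto Δ (𝓝[lc n (h.fK z)] (h.fK z)) (𝓝 0))
    (hfin : {x : h.K | h.fK x = h.fK z}.Finite)
    (hZ : ∀ w ∈ Ω, w.re = (h.fK z).re → w ∉ Z) :
    ∀ᶠ q : h.K × h.K in 𝓝 (z, z), h.fK q.1 = h.fK q.2 → (h.fK q.1).re = (h.fK z).re →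
      (h.fK q.1).im ≤ (h.fK z).im → (q.1 : σ → ℂ) i = (q.2 : σ → ℂ) i := by
  have hn0 : (0 : ℝ) < n := by exact_mod_cast hn
  have h1 : Tendsto (fun q : h.K × h.K => h.fK q.1) (𝓝 (z, z)) (𝓝 (h.fK z)) :=
    (h.continuous_fK.comp continuous_fst).tendsto (z, z)
  have h2 : Tendsto (fun q : h.K × h.K => C * ‖(q.1 : σ → ℂ) i - (q.2 : σ → ℂ) i‖) (𝓝 (z, z))
      (𝓝 0) := by
    have : Continuous fun q : h.K × h.K => C * ‖(q.1 : σ → ℂ) i - (q.2 : σ → ℂ) i‖ :=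
      continuous_const.mul (((h.continuous_coord i).comp continuous_fst).sub
        ((h.continuous_coord i).comp continuous_snd)).norm
    simpa using this.tendsto (z, z)
  have h3 := h.eventually_eq_of_finite_fiber hfin
  have h4 : ∀ᶠ w in 𝓝 (h.fK z), (h.fK z).im - w.im < 1 / (6 * n) := by
    have : Tendsto (fun w : ℂ => (h.fK z).im - w.im) (𝓝 (h.fK z)) (𝓝 0) := by
      simpa using (continuous_const.sub Complex.continuous_im).tendsto
        (f := fun w : ℂ => (h.fK z).im - w.im) (h.fK z)
    exact this.eventually_lt_const (by positivity)
  by_contra hcon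
  rw [not_eventually] at hcon
  refine hlim (tendsto_zero_of_frequently_of_finite
    (F := (fun x : Fin d → h.K => MvPolynomial.eval (fun k => (x k : σ → ℂ) i) G) ''
      {x | ∀ k, h.fK (x k) = h.fK z})
    (convex_lowerCone _ _ _) (hΔ.mono hlc) ((Set.Finite.pi' fun _ => hfin).image _) ?_ ?_)
  · intro ε hε
    have h5 := (h.eventually_exists_norm_eval_sub_lt G i (h.fK z) (half_pos hε)).eventually_nhds
    filter_upwards [mem_nhdsWithin_of_mem_nhds h5, self_mem_nhdsWithin] with w hw hwlc
    have hwΩ := hlc hwlc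
    obtain ⟨v, hv, hvZ, hvΩ, hvw⟩ := ((Eventually.filter_mono nhdsWithin_le_nhds hw).and
      ((hZd w hwΩ).and ((Eventually.filter_mono nhdsWithin_le_nhds (hΩ.mem_nhds hwΩ)).and
        (Eventually.filter_mono nhdsWithin_le_nhds (Metric.tendsto_nhds.1
          (hΔ.continuousAt (hΩ.mem_nhds hwΩ)).tendsto _ (half_pos hε)))))).exists
    obtain ⟨-, ζ, hζ, hΔv⟩ := hsep v ⟨hvΩ, hvZ⟩
    choose x hx hxζ using hζ
    obtain ⟨φ, hφ, hφx⟩ := hv x hx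
    refine ⟨φ, hφ, ?_⟩
    simp only [hxζ] at hφx
    rw [← hΔv, ← dist_eq_norm] at hφx
    have hvw' : dist (Δ v) (Δ w) < ε / 2 := hvw
    rw [← dist_eq_norm]
    have := dist_triangle_left (Δ w) φ (Δ v)
    linarith
  · intro ε hε
    rw [frequently_nhdsWithin_iff]
    refine h1.frequently ((hcon.and_eventually
      ((h3.prod_inl_nhds z).and ((h3.prod_inr_nhds z).and
        ((h2.eventually_lt_const hε).and (h1.eventually h4))))).mono ?_)
    rintro q ⟨hq, hq1, hq2, hqε, hq4⟩
    push Not at hq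
    obtain ⟨heq, hre, him, hne⟩ := hq
    have hlt : (h.fK q.1).im < (h.fK z).im := by
      refine lt_of_le_of_ne him fun him' => hne ?_
      have := Complex.ext hre him'
      rw [hq1 this, hq2 (heq ▸ this)]
    have hmem : h.fK q.1 ∈ lc n (h.fK z) := by
      have := vertical_mem_lc hn (c := (h.fK z).re) hlt hq4
      have heta : h.fK q.1 = ⟨(h.fK z).re, (h.fK q.1).im⟩ := Complex.ext hre rfl
      rw [heta]
      exact this
    have hΩq := hlc hmem
    exact ⟨((hsep _ ⟨hΩq, hZ _ hΩq hre⟩).1 q.1 q.2 rfl heq.symm hne).trans_lt hqε, hmem⟩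

end
end HullData

/-- The set of zeros of a nonzero holomorphic function on a connected open set, together with a
discrete set, is countable. -/
theorem countable_zeros_union {Ω Z : Set ℂ} {Δ : ℂ → ℂ} (hΩ : IsOpen Ω) (hconn : IsPreconnected Ω)
    (hΔ : DifferentiableOn ℂ Δ Ω) (hne : ∃ w ∈ Ω, Δ w ≠ 0)
    (hZ : ∀ w ∈ Ω, ∀ᶠ v in 𝓝[≠] w, v ∉ Z) : {w ∈ Ω | Δ w = 0 ∨ w ∈ Z}.Countable := by
  refine Set.countable_of_forall_eventually_nhdsNE fun w hw => ?_
  have han := hΔ.analyticOnNhd hΩ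
  have h1 : ∀ᶠ v in 𝓝[≠] w, Δ v ≠ 0 := by
    rcases (han w hw.1).eventually_eq_zero_or_eventually_ne_zero with h0 | h0
    · obtain ⟨v₀, hv₀, hne⟩ := hne
      exact absurd (han.eqOn_zero_of_preconnected_of_eventuallyEq_zero hconn hw.1 h0 hv₀) hne
    · exact h0
  filter_upwards [h1, hZ w hw.1] with v hv1 hv2 hv
  exact hv.2.elim hv1 hv2

namespace HullData

section
variable {T σ : Type*} [TopologicalSpace T] [MeasurableSpace T] (h : HullData T σ)
variable [CompactSpace T] [BorelSpace T]

/-- For almost every vertical line, the fibres of the projection over the line are finite and the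
projection is injective near every point of the hull, below this point. -/
theorem ae_local_injectivity [Fintype σ] [T2Space T] [Nonempty T]
    (hgood : ∀ᵐ c : ℝ, ∀ a : ℂ, a.re = c → ∃ n, 0 < n ∧ h.GoodPt n a) :
    ∀ᵐ c : ℝ, (∀ a : ℂ, a.re = c → {x : h.K | h.fK x = a}.Finite) ∧
      ∀ z : h.K, (h.fK z).re = c → ∀ᶠ q : h.K × h.K in 𝓝 (z, z),
        h.fK q.1 = h.fK q.2 → (h.fK q.1).re = c → (h.fK q.1).im ≤ (h.fK z).im → q.1 = q.2 := by
  have hK : CompactSpace h.K := isCompact_iff_compactSpace.1 (isCompact_hullPts h.continuous_γ)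
  set e := TopologicalSpace.denseSeq ℂ
  have hex := fun (m : ℕ) (hm : e m ∉ h.curve) (i : σ) =>
    h.exists_discriminant hm (fun j => h.exists_tame hgood j hm) i
  choose d G Δ Z C hΔ hne hZ hC hsep using hex
  have hN1 : ∀ᵐ c : ℝ, ∀ m hm i, c ∉ Complex.re ''
      {w ∈ connectedComponentIn h.curveᶜ (e m) | Δ m hm i w = 0 ∨ w ∈ Z m hm i} := by
    refine ae_all_iff.2 fun m => ?_
    by_cases hm : e m ∈ h.curve
    · exact Eventually.of_forall fun c hm' => absurd hm hm'
    · have := ae_all_iff.2 fun i => measure_eq_zero_iff_ae_notMem.1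
        (((countable_zeros_union (h.isOpen_component (e m)) isPreconnected_connectedComponentIn
          (hΔ m hm i) (hne m hm i) (hZ m hm i)).image Complex.re).measure_zero volume)
      filter_upwards [this] with c hc _ i using hc i
  have hN2 : ∀ᵐ c : ℝ, ∀ n : ℕ, 0 < n → ∀ m hm i, c ∉ Complex.re ''
      {a | a ∈ h.curve ∧ lc n a ⊆ connectedComponentIn h.curveᶜ (e m) ∧
        Tendsto (Δ m hm i) (𝓝[lc n a] a) (𝓝 0)} := by
    refine ae_all_iff.2 fun n => ?_
    rcases Nat.eq_zero_or_pos n with hn | hn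
    · exact Eventually.of_forall fun c hn' => absurd hn hn'.ne'
    have hn0 : (0 : ℝ) < n := by exact_mod_cast hn
    refine (ae_all_iff.2 fun m => ?_).mono fun c hc _ => hc
    by_cases hm : e m ∈ h.curve
    · exact Eventually.of_forall fun c hm' => absurd hm hm'
    · have := ae_all_iff.2 fun i => measure_eq_zero_iff_ae_notMem.1
        (volume_re_image_vertices_eq_zero
          (A := {a | a ∈ h.curve ∧ lc n a ⊆ connectedComponentIn h.curveᶜ (e m) ∧
            Tendsto (Δ m hm i) (𝓝[lc n a] a) (𝓝 0)}) (κ := 1 / (4 * n)) (r := 1 / (6 * n))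
          (h.isOpen_component (e m)) isPreconnected_connectedComponentIn
          (hΔ m hm i) (hne m hm i) (by positivity) (by positivity)
          (fun a ha haΩ => connectedComponentIn_subset _ _ haΩ ha.1) (fun a ha => ha.2.1)
          (fun a ha w hw => hC m hm i w (ha.2.1 hw)) fun a ha => ha.2.2)
      filter_upwards [this] with c hc _ i using hc i
  filter_upwards [hgood, hN1, hN2] with c hgc h1 h2
  have hfin : ∀ a : ℂ, a.re = c → {x : h.K | h.fK x = a}.Finite := fun a ha => by
    obtain ⟨n, hn, hna⟩ := hgc a ha
    exact h.finite_fiber_of_goodPt hgood hn hna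
  refine ⟨hfin, fun z hz => ?_⟩
  suffices ∀ i, ∀ᶠ q : h.K × h.K in 𝓝 (z, z), h.fK q.1 = h.fK q.2 → (h.fK q.1).re = (h.fK z).re →
      (h.fK q.1).im ≤ (h.fK z).im → (q.1 : σ → ℂ) i = (q.2 : σ → ℂ) i by
    filter_upwards [eventually_all.2 this] with q hq heq hre him
    exact Subtype.ext (funext fun i => hq i heq (hre.trans hz.symm) him)
  intro i
  have hZ' : ∀ m hm, ∀ w ∈ connectedComponentIn h.curveᶜ (e m), w.re = (h.fK z).re → w ∉ Z m hm i :=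
    fun m hm w hw hre hwZ => h1 m hm i ⟨w, ⟨hw, .inr hwZ⟩, hre.trans hz⟩
  by_cases hzX : h.fK z ∈ h.curve
  · obtain ⟨n, hn, hna⟩ := hgc _ hz
    have hn0 : (0 : ℝ) < n := by exact_mod_cast hn
    have hlne : (lc n (h.fK z)).Nonempty := ⟨_, vertical_mem_lc hn
      (c := (h.fK z).re) (τ := (h.fK z).im) (t := (h.fK z).im - 1 / (12 * n))
      (by have : (0 : ℝ) < 1 / (12 * n) := by positivity
          linarith)
      (by rw [sub_sub_cancel]; gcongr; norm_num)⟩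
    obtain ⟨m, hm⟩ := (TopologicalSpace.denseRange_denseSeq ℂ).exists_mem_open
      (isOpen_lowerCone _ _ _) hlne
    have hmX : e m ∉ h.curve := hna.lc_subset hn hm
    have hlc : lc n (h.fK z) ⊆ connectedComponentIn h.curveᶜ (e m) :=
      (convex_lowerCone _ _ _).isPreconnected.subset_connectedComponentIn hm (hna.lc_subset hn)
    exact h.eventually_coord_eq_of_not_tendsto (h.isOpen_component (e m))
      (hΔ m hmX i).continuousOn (hZ m hmX i) (hsep m hmX i) hn hlc
      (fun hlim => h2 n hn m hmX i ⟨_, ⟨hzX, hlc, hlim⟩, hz⟩) (hfin _ hz) (hZ' m hmX)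
  · obtain ⟨m, hm⟩ := (TopologicalSpace.denseRange_denseSeq ℂ).exists_mem_open
      (h.isOpen_component (h.fK z)) ⟨_, mem_connectedComponentIn hzX⟩
    have hmX : e m ∉ h.curve := connectedComponentIn_subset _ _ hm
    have hzΩ : h.fK z ∈ connectedComponentIn h.curveᶜ (e m) := by
      rw [← connectedComponentIn_eq hm]
      exact mem_connectedComponentIn hzX
    filter_upwards [h.eventually_coord_eq_of_ne_zero (h.isOpen_component (e m))
      (hΔ m hmX i).continuousOn (fun w hw => (hsep m hmX i w hw).1) hzΩ
      (fun h0 => h1 m hmX i ⟨_, ⟨hzΩ, .inl h0⟩, hz⟩) (hZ' m hmX)] with q hq heq hre _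
    exact hq heq hre

end
end HullData

theorem ContinuousOn.exists_continuous_extension {Y : Type*} [TopologicalSpace Y] [NormalSpace Y]
    {A : Set Y} {f : Y → ℂ} (hf : ContinuousOn f A) (hA : IsClosed A) :
    ∃ g : Y → ℂ, Continuous g ∧ EqOn g f A := by
  obtain ⟨g, hg⟩ := ContinuousMap.exists_restrict_eq hA
    (⟨A.domRestrict f, continuousOn_iff_continuous_domRestrict.1 hf⟩ : C(A, ℂ))
  exact ⟨g, g.continuous, fun y hy => by simpa using congrArg (fun φ => φ ⟨y, hy⟩) hg⟩

section
variable {Y : Type*} [TopologicalSpace Y]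

/-- The function `u` has a continuous logarithm on `A`. -/
def HasLogOn (u : Y → ℂ) (A : Set Y) : Prop :=
  ∃ l : Y → ℂ, ContinuousOn l A ∧ ∀ y ∈ A, Complex.exp (l y) = u y

theorem HasLogOn.mono {u : Y → ℂ} {A B : Set Y} (h : HasLogOn u B) (hAB : A ⊆ B) :
    HasLogOn u A := by
  obtain ⟨l, hl, hlu⟩ := h
  exact ⟨l, hl.mono hAB, fun y hy => hlu y (hAB hy)⟩

theorem HasLogOn.exists_isOpen_superset [NormalSpace Y] {u : Y → ℂ} {A : Set Y}
    (h : HasLogOn u A) (hA : IsClosed A) (hu : Continuous u) :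
    ∃ V, IsOpen V ∧ A ⊆ V ∧ HasLogOn u V := by
  obtain ⟨l, hl, hlu⟩ := h
  obtain ⟨L, hL, hLl⟩ := hl.exists_continuous_extension hA
  have hv : Continuous fun y => u y * Complex.exp (-L y) :=
    hu.mul (Complex.continuous_exp.comp hL.neg)
  refine ⟨(fun y => u y * Complex.exp (-L y)) ⁻¹' Complex.slitPlane,
    Complex.isOpen_slitPlane.preimage hv, fun y hy => ?_,
    fun y => L y + Complex.log (u y * Complex.exp (-L y)),
    hL.continuousOn.add (hv.continuousOn.clog fun y hy => hy), fun y hy => ?_⟩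
  · change u y * Complex.exp (-L y) ∈ Complex.slitPlane
    rw [hLl hy, ← hlu y hy, ← Complex.exp_add, add_neg_cancel, Complex.exp_zero]
    exact Complex.one_mem_slitPlane
  · rw [Complex.exp_add, Complex.exp_log (Complex.slitPlane_ne_zero hy), mul_left_comm,
      ← Complex.exp_add, add_neg_cancel, Complex.exp_zero, mul_one]

/-- A logarithm extends across a level of a function which is injective, below this level, near
each of the finitely many points of the level. -/
theorem HasLogOn.of_forall_lt [CompactSpace Y] [T2Space Y] {g : Y → ℝ} {u : Y → ℂ}
    (hg : Continuous g) (hu : Continuous u) (hu0 : ∀ y, u y ≠ 0) {t : ℝ}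
    (hfin : {y | g y = t}.Finite)
    (hinj : ∀ y, g y = t → ∀ᶠ q : Y × Y in 𝓝 (y, y), g q.1 = g q.2 → g q.1 ≤ t → q.1 = q.2)
    (hlt : ∀ s < t, HasLogOn u {y | g y ≤ s}) : HasLogOn u {y | g y ≤ t} := by
  obtain ⟨U, hU, hdisj⟩ := hfin.t2_separation
  have hO : ∀ y, ∃ O : Set Y, g y = t → IsOpen O ∧ y ∈ O ∧ O ⊆ U y ∧
      (∀ x ∈ O, ∀ x' ∈ O, g x = g x' → g x ≤ t → x = x') ∧
      ∀ x ∈ O, u x / u y ∈ Complex.slitPlane := fun y => by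
    by_cases hy : g y = t
    · have h1 := hinj y hy
      rw [nhds_prod_eq] at h1
      obtain ⟨V, hV, hVV⟩ := eventually_prod_self_iff'.1 h1
      have h2 : ∀ᶠ x in 𝓝 y, u x / u y ∈ Complex.slitPlane :=
        (hu.div_const (u y)).continuousAt.eventually_mem (Complex.isOpen_slitPlane.mem_nhds (by
          rw [div_self (hu0 y)]
          exact Complex.one_mem_slitPlane))
      obtain ⟨O, hO, hOo, hyO⟩ := eventually_nhds_iff.1
        (((hU y).2.eventually_mem (hU y).1).and ((eventually_mem_set.2 hV).and h2))
      exact ⟨O, fun _ => ⟨hOo, hyO, fun x hx => (hO x hx).1,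
        fun x hx x' hx' => hVV _ (hO x hx).2.1 _ (hO x' hx').2.1, fun x hx => (hO x hx).2.2⟩⟩
    · exact ⟨∅, fun hy' => absurd hy' hy⟩
  choose O hO using hO
  set W : Set Y := {x | ∃ y, g y = t ∧ x ∈ O y} with hW
  have hWo : IsOpen W := by
    have : W = ⋃ y ∈ {y | g y = t}, O y := by
      ext x
      simp [hW]
    rw [this]
    exact isOpen_biUnion fun y hy => (hO y hy).1
  obtain ⟨s, hst, hs⟩ : ∃ s < t, ∀ y, g y ≤ t → s ≤ g y → y ∈ W := by
    have hcomp : IsCompact ({y | g y ≤ t} \ W) :=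
      (isClosed_le hg continuous_const).isCompact.diff hWo
    rcases ({y | g y ≤ t} \ W).eq_empty_or_nonempty with hemp | hne
    · refine ⟨t - 1, by linarith, fun y hy _ => ?_⟩
      by_contra hyW
      exact (hemp ▸ (⟨hy, hyW⟩ : y ∈ {y | g y ≤ t} \ W) : y ∈ (∅ : Set Y))
    · obtain ⟨m, hm, hmax⟩ := hcomp.exists_isMaxOn hne hg.continuousOn
      have hmt : g m < t := lt_of_le_of_ne hm.1 fun h => hm.2 ⟨m, h, (hO m h).2.1⟩
      refine ⟨(g m + t) / 2, by linarith, fun y hy hys => ?_⟩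
      by_contra hyW
      have : g y ≤ g m := hmax ⟨hy, hyW⟩
      linarith
  obtain ⟨L, hL, hLu⟩ := hlt s hst
  have hc : ∀ y, ∃ c : ℂ, g y = t → Complex.exp c = u y ∧
      ∀ p ∈ O y, g p = s → L p = Complex.log (u p / u y) + c := fun y => by
    by_cases hp : g y = t ∧ ∃ p ∈ O y, g p = s
    · obtain ⟨hy, p, hp, hps⟩ := hp
      refine ⟨L p - Complex.log (u p / u y), fun _ => ⟨?_, fun p' hp' hps' => ?_⟩⟩
      · rw [Complex.exp_sub, hLu p hps.le, Complex.exp_log (div_ne_zero (hu0 p) (hu0 y)),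
          div_div_cancel₀ (hu0 p)]
      · rw [(hO y hy).2.2.2.1 p' hp' p hp (hps'.trans hps.symm) (hps'.trans_le hst.le)]
        ring
    · exact ⟨Complex.log (u y), fun hy => ⟨Complex.exp_log (hu0 y),
        fun p hpO hps => absurd ⟨hy, p, hpO, hps⟩ hp⟩⟩
  choose c hc using hc
  have hj : ∀ x, ∃ y, x ∈ W → g y = t ∧ x ∈ O y := fun x => by
    by_cases hx : x ∈ W
    · obtain ⟨y, hy⟩ := hx
      exact ⟨y, fun _ => hy⟩
    · exact ⟨x, fun hx' => absurd hx' hx⟩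
  choose j hj using hj
  have hjeq : ∀ {x y}, g y = t → x ∈ O y → j x = y := fun {x y} hy hx => by
    obtain ⟨h1, h2⟩ := hj x ⟨y, hy, hx⟩
    exact hdisj.eq h1 hy (not_disjoint_iff.2 ⟨x, (hO _ h1).2.2.1 h2, (hO _ hy).2.2.1 hx⟩)
  set l : Y → ℂ := fun x => Complex.log (u x / u (j x)) + c (j x) with hl
  have hlc : ContinuousOn l W := by
    rintro x ⟨y, hy, hx⟩
    have h1 : ContinuousAt (fun x' => Complex.log (u x' / u y) + c y) x :=
      ((hu.div_const _).continuousAt.clog ((hO y hy).2.2.2.2 x hx)).add continuousAt_const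
    refine (h1.congr ?_).continuousWithinAt
    filter_upwards [(hO y hy).1.mem_nhds hx] with x' hx'
    rw [hl]
    simp only [hjeq hy hx']
  classical
  have hsub : {y | g y ≤ t} = {y | g y ≤ s} ∪ {y | g y ≤ t ∧ s ≤ g y} := by
    ext y
    constructor
    · intro hy
      rcases le_total (g y) s with h | h
      · exact .inl h
      · exact .inr ⟨hy, h⟩
    · rintro (h | h)
      · exact le_trans h hst.le
      · exact h.1
  refine ⟨fun y => if g y ≤ s then L y else l y, ?_, fun y hy => ?_⟩
  · rw [hsub]
    refine ContinuousOn.union_of_isClosed ?_ ?_ (isClosed_le hg continuous_const)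
      ((isClosed_le hg continuous_const).inter (isClosed_le continuous_const hg))
    · exact hL.congr fun y hy => if_pos hy
    · refine (hlc.mono fun y hy => hs y hy.1 hy.2).congr fun y hy => ?_
      by_cases hys : g y ≤ s
      · obtain ⟨h1, h2⟩ := hj y (hs y hy.1 hy.2)
        rw [if_pos hys]
        exact (hc _ h1).2 y h2 (le_antisymm hys hy.2)
      · exact if_neg hys
  · by_cases hys : g y ≤ s
    · simpa only [if_pos hys] using hLu y hys
    · obtain ⟨h1, h2⟩ := hj y (hs y hy (not_le.1 hys).le)
      simp only [if_neg hys, hl]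
      rw [Complex.exp_add, (hc _ h1).1, Complex.exp_log (div_ne_zero (hu0 _) (hu0 _)),
        div_mul_cancel₀ _ (hu0 _)]

theorem hasLogOn_univ_of_local_injectivity [CompactSpace Y] [T2Space Y] {g : Y → ℝ} {u : Y → ℂ}
    (hg : Continuous g) (hu : Continuous u) (hu0 : ∀ y, u y ≠ 0)
    (hfin : ∀ t, {y | g y = t}.Finite)
    (hinj : ∀ y, ∀ᶠ q : Y × Y in 𝓝 (y, y), g q.1 = g q.2 → g q.1 ≤ g y → q.1 = q.2) :
    HasLogOn u univ := by
  rcases isEmpty_or_nonempty Y with hY | hY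
  · exact ⟨fun _ => 0, continuousOn_const, fun y => isEmptyElim y⟩
  set P : Set ℝ := {t | HasLogOn u {y | g y ≤ t}} with hP
  have hPmono : ∀ {s t}, s ≤ t → t ∈ P → s ∈ P := fun hst ht =>
    HasLogOn.mono ht fun y hy => le_trans hy hst
  obtain ⟨m, hm⟩ := (isCompact_range hg).bddBelow
  obtain ⟨M, hM⟩ := (isCompact_range hg).bddAbove
  by_contra hcon
  have hMP : M ∉ P := fun h => hcon (HasLogOn.mono h fun y _ => hM ⟨y, rfl⟩)
  have hne : m - 1 ∈ P := ⟨fun _ => 0, continuousOn_const, fun y hy => by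
    have h1 : g y ≤ m - 1 := hy
    have h2 := hm ⟨y, rfl⟩
    linarith⟩
  have hbdd : BddAbove P := ⟨M, fun t ht => by
    by_contra! hlt
    exact hMP (hPmono hlt.le ht)⟩
  set t := sSup P with ht
  have htP : t ∈ P := HasLogOn.of_forall_lt hg hu hu0 (hfin t)
    (fun y hy => by simpa only [hy] using hinj y) fun s hs => by
      obtain ⟨s', hs', hss'⟩ := exists_lt_of_lt_csSup ⟨_, hne⟩ hs
      exact hPmono hss'.le hs'
  obtain ⟨V, hV, htV, hlog⟩ := htP.exists_isOpen_superset (isClosed_le hg continuous_const) hu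
  obtain ⟨s, hts, hs⟩ : ∃ s > t, s ∈ P := by
    rcases (Vᶜ).eq_empty_or_nonempty with hemp | hne
    · exact ⟨t + 1, by linarith, HasLogOn.mono hlog fun y _ => by
        rw [compl_empty_iff.1 hemp]
        trivial⟩
    · obtain ⟨m, hm, hmin⟩ := hV.isClosed_compl.isCompact.exists_isMinOn hne hg.continuousOn
      have hmt : t < g m := by
        by_contra! hle
        exact hm (htV hle)
      refine ⟨(g m + t) / 2, by linarith, HasLogOn.mono hlog fun y hy => ?_⟩
      by_contra hyV
      have h1 : g m ≤ g y := hmin hyV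
      have h2 : g y ≤ (g m + t) / 2 := hy
      linarith
  exact absurd (le_csSup hbdd hs) (not_le.2 hts)

end

section
open Bundle

variable {B : Type*} [TopologicalSpace B] {E : B → Type*} [∀ x, AddCommGroup (E x)]
  [TopologicalSpace (TotalSpace ℂ E)]

variable (E) in
/-- The line bundle has a nonvanishing continuous section on `A`. -/
def HasSectionOn (A : Set B) : Prop :=
  ∃ s : ∀ x, E x, ContinuousOn (fun x => (⟨x, s x⟩ : TotalSpace ℂ E)) A ∧ ∀ x, s x ≠ 0

theorem HasSectionOn.mono {A A' : Set B} (h : HasSectionOn E A') (hA : A ⊆ A') :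
    HasSectionOn E A := by
  obtain ⟨s, hs, hs0⟩ := h
  exact ⟨s, hs.mono hA, hs0⟩

variable [∀ x, TopologicalSpace (E x)] [∀ x, Module ℂ (E x)] [FiberBundle ℂ E]
  [VectorBundle ℂ ℂ E]

theorem trivializationAt_smul_snd {x b : B} (hb : b ∈ (trivializationAt ℂ E x).baseSet) (c : ℂ)
    (v : E b) : (trivializationAt ℂ E x ⟨b, c • v⟩).2 = c * (trivializationAt ℂ E x ⟨b, v⟩).2 :=
  (((trivializationAt ℂ E x).linear ℂ hb).map_smul c v).trans (smul_eq_mul _ _)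

theorem trivializationAt_snd_ne_zero {x b : B} (hb : b ∈ (trivializationAt ℂ E x).baseSet)
    {v : E b} (hv : v ≠ 0) : (trivializationAt ℂ E x ⟨b, v⟩).2 ≠ 0 := fun h0 =>
  hv (((trivializationAt ℂ E x).continuousLinearEquivAt ℂ b hb).map_eq_zero_iff.1 h0)

theorem ContinuousWithinAt.bundle_smul {Y : Type*} [TopologicalSpace Y] {b : Y → B}
    {v : ∀ y, E (b y)} {f : Y → ℂ} {A : Set Y} {y : Y}
    (hv : ContinuousWithinAt (fun y => (⟨b y, v y⟩ : TotalSpace ℂ E)) A y)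
    (hf : ContinuousWithinAt f A y) :
    ContinuousWithinAt (fun y => (⟨b y, f y • v y⟩ : TotalSpace ℂ E)) A y := by
  rw [FiberBundle.continuousWithinAt_totalSpace] at hv ⊢
  refine ⟨hv.1, (hf.mul hv.2).congr_of_eventuallyEq ?_ ?_⟩
  · filter_upwards [hv.1.eventually_mem ((trivializationAt ℂ E (b y)).open_baseSet.mem_nhds
      (FiberBundle.mem_baseSet_trivializationAt' (b y)))] with y' hy'
    exact trivializationAt_smul_snd hy' _ _
  · exact trivializationAt_smul_snd (FiberBundle.mem_baseSet_trivializationAt' (b y)) _ _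

theorem ContinuousWithinAt.of_bundle_smul {Y : Type*} [TopologicalSpace Y] {b : Y → B}
    {v : ∀ y, E (b y)} {f : Y → ℂ} {A : Set Y} {y : Y}
    (hv : ContinuousWithinAt (fun y => (⟨b y, v y⟩ : TotalSpace ℂ E)) A y)
    (hfv : ContinuousWithinAt (fun y => (⟨b y, f y • v y⟩ : TotalSpace ℂ E)) A y)
    (hv0 : ∀ y, v y ≠ 0) : ContinuousWithinAt f A y := by
  rw [FiberBundle.continuousWithinAt_totalSpace] at hv hfv
  have hby := FiberBundle.mem_baseSet_trivializationAt' (F := ℂ) (E := E) (b y)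
  have hdiv : ∀ y', b y' ∈ (trivializationAt ℂ E (b y)).baseSet → f y' =
      (trivializationAt ℂ E (b y) ⟨b y', f y' • v y'⟩).2 /
        (trivializationAt ℂ E (b y) ⟨b y', v y'⟩).2 := fun y' hy' => by
    rw [trivializationAt_smul_snd hy', mul_div_cancel_right₀ _
      (trivializationAt_snd_ne_zero hy' (hv0 y'))]
  refine (hfv.2.div hv.2 (trivializationAt_snd_ne_zero hby (hv0 y))).congr_of_eventuallyEq ?_
    (hdiv y hby)
  filter_upwards [hv.1.eventually_mem ((trivializationAt ℂ E (b y)).open_baseSet.mem_nhds hby)]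
    with y' hy'
  exact hdiv y' hy'

theorem exists_fiber_ne_zero (x : B) : ∃ v : E x, v ≠ 0 :=
  ⟨(VectorBundle.continuousLinearEquivAt ℂ ℂ E x).symm 1, fun h0 => one_ne_zero
    ((VectorBundle.continuousLinearEquivAt ℂ ℂ E x).symm.map_eq_zero_iff.1 h0)⟩

theorem exists_smul_eq_of_fiber {x : B} {v : E x} (hv : v ≠ 0) (w : E x) : ∃ c : ℂ, c • v = w := by
  set φ := VectorBundle.continuousLinearEquivAt ℂ ℂ E x
  have hφ : φ v ≠ 0 := fun h0 => hv (φ.map_eq_zero_iff.1 h0)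
  refine ⟨φ w / φ v, φ.injective ?_⟩
  rw [map_smul, smul_eq_mul, div_mul_cancel₀ _ hφ]

theorem hasSectionOn_baseSet (x : B) : HasSectionOn E (trivializationAt ℂ E x).baseSet := by
  classical
  set e := trivializationAt ℂ E x
  choose t ht using exists_fiber_ne_zero (E := E)
  refine ⟨fun y => if y ∈ e.baseSet then e.symm y 1 else t y, ?_, fun y => ?_⟩
  · have h1 : ContinuousOn (fun y => (⟨y, e.symm y 1⟩ : TotalSpace ℂ E)) e.baseSet :=
      e.continuousOn_symm.comp (continuous_id.prodMk continuous_const).continuousOn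
        fun y hy => ⟨hy, trivial⟩
    exact h1.congr fun y hy => by simp only [if_pos hy]
  · by_cases hy : y ∈ e.baseSet
    · simp only [if_pos hy]
      intro h0
      have := e.apply_mk_symm hy (1 : ℂ)
      rw [h0] at this
      have h2 := trivializationAt_smul_snd hy 0 (0 : E y)
      rw [zero_smul, zero_mul] at h2
      change (e _).2 = 0 at h2
      rw [this] at h2
      exact one_ne_zero h2
    · simpa only [if_neg hy] using ht y

/-- Nonvanishing sections over two closed sets can be glued if the nonvanishing functions on the
intersection have logarithms. -/
theorem HasSectionOn.union [NormalSpace B] {A₁ A₂ : Set B} (h₁ : HasSectionOn E A₁)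
    (h₂ : HasSectionOn E A₂) (hA₁ : IsClosed A₁) (hA₂ : IsClosed A₂)
    (hlog : ∀ u : B → ℂ, ContinuousOn u (A₁ ∩ A₂) → (∀ x, u x ≠ 0) → HasLogOn u (A₁ ∩ A₂)) :
    HasSectionOn E (A₁ ∪ A₂) := by
  classical
  obtain ⟨s₁, hs₁, hs₁0⟩ := h₁
  obtain ⟨s₂, hs₂, hs₂0⟩ := h₂
  choose u hu using fun x => exists_smul_eq_of_fiber (hs₁0 x) (s₂ x)
  obtain ⟨l, hl, hlu⟩ := hlog u (fun x hx => ((hs₁.mono inter_subset_left) x hx).of_bundle_smul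
    (by simpa only [hu] using (hs₂.mono inter_subset_right) x hx) hs₁0) fun x h0 => hs₂0 x (by
      rw [← hu x, h0, zero_smul])
  obtain ⟨m, hm, hml⟩ := hl.exists_continuous_extension (hA₁.inter hA₂)
  refine ⟨fun x => if x ∈ A₁ then Complex.exp (m x) • s₁ x else s₂ x,
    ContinuousOn.union_of_isClosed ?_ ?_ hA₁ hA₂, fun x => ?_⟩
  · have h1 : ContinuousOn (fun x => (⟨x, Complex.exp (m x) • s₁ x⟩ : TotalSpace ℂ E)) A₁ :=
      fun x hx => (hs₁ x hx).bundle_smul (Complex.continuous_exp.comp hm).continuousWithinAt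
    exact h1.congr fun x hx => by simp only [if_pos hx]
  · refine hs₂.congr fun x hx => ?_
    by_cases hx₁ : x ∈ A₁
    · simp only [if_pos hx₁]
      rw [hml ⟨hx₁, hx⟩, hlu x ⟨hx₁, hx⟩, hu]
    · simp only [if_neg hx₁]
  · by_cases hx₁ : x ∈ A₁
    · simpa only [if_pos hx₁] using smul_ne_zero (Complex.exp_ne_zero _) (hs₁0 x)
    · simpa only [if_neg hx₁] using hs₂0 x

end

theorem LineBundle.isTrivial_of_hasSectionOn_univ {X : Type} [TopologicalSpace X]
    {L : LineBundle X} (h : HasSectionOn L.E univ) : L.IsTrivial := by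
  obtain ⟨s, hs, hs0⟩ := h
  set e : ∀ x, ℂ ≃ₗ[ℂ] L.E x := fun x => LinearEquiv.ofBijective
    (LinearMap.toSpanSingleton ℂ (L.E x) (s x))
    ⟨smul_left_injective ℂ (hs0 x), fun w => exists_smul_eq_of_fiber (hs0 x) w⟩ with he
  have hes : ∀ x c, e x c = c • s x := fun x c => rfl
  have hsmul : ∀ x w, (e x).symm w • s x = w := fun x w => by
    rw [← hes, LinearEquiv.apply_symm_apply]
  have hsc : Continuous fun x => (⟨x, s x⟩ : Bundle.TotalSpace ℂ L.E) := continuousOn_univ.1 hs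
  have hproj : Continuous (Bundle.TotalSpace.proj : Bundle.TotalSpace ℂ L.E → X) :=
    FiberBundle.continuous_proj ℂ L.E
  have hhomeo : ∀ {Y : Type} [TopologicalSpace Y] (b : Y → X) (c : Y → ℂ),
      Continuous b → Continuous c →
      Continuous fun y => (⟨b y, c y⟩ : Bundle.TotalSpace ℂ (Bundle.Trivial X ℂ)) :=
    fun b c hb hc => (Bundle.Trivial.homeomorphProd X ℂ).symm.continuous.comp (hb.prodMk hc)
  have hcoord := (Bundle.Trivial.homeomorphProd X ℂ).continuous
  have hto : Continuous fun p : Bundle.TotalSpace ℂ L.E => (e p.proj).symm p.snd :=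
    continuous_iff_continuousAt.2 fun p => continuousWithinAt_univ _ _ |>.1 <|
      ContinuousWithinAt.of_bundle_smul (b := fun p : Bundle.TotalSpace ℂ L.E => p.proj)
        (v := fun p => s p.proj) (hsc.comp hproj).continuousWithinAt
        (by simp only [hsmul]; exact continuous_id.continuousWithinAt) fun p => hs0 p.proj
  have hinv : Continuous fun p : Bundle.TotalSpace ℂ (Bundle.Trivial X ℂ) =>
      (⟨p.proj, (show ℂ from p.snd) • s p.proj⟩ : Bundle.TotalSpace ℂ L.E) :=
    continuous_iff_continuousAt.2 fun p => continuousWithinAt_univ _ _ |>.1 <|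
      ContinuousWithinAt.bundle_smul
        (b := fun p : Bundle.TotalSpace ℂ (Bundle.Trivial X ℂ) => p.proj)
        (v := fun p => s p.proj) (f := fun p => p.snd)
        (hsc.comp (continuous_fst.comp hcoord)).continuousWithinAt
        (continuous_snd.comp hcoord).continuousWithinAt
  exact ⟨fun x => (e x).symm, hhomeo _ _ hproj hto, hinv⟩

theorem HullData.ae_hasLogOn_of_subset_level {σ : Type*} [Fintype σ]
    (h : HullData (Icc (0 : ℝ) 1) σ) {L M : ℝ≥0} (hγ : LipschitzWith L h.γ)
    (hf : LipschitzWith M h.fγ) {Y : Type*} [TopologicalSpace Y] [CompactSpace Y] [T2Space Y]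
    {ψ : Y → h.K} (hψ : Continuous ψ) (hψi : Function.Injective ψ) :
    ∀ᵐ c : ℝ, ∀ A : Set Y, IsClosed A → (∀ y ∈ A, (h.fK (ψ y)).re = c) → ∀ u : Y → ℂ,
      ContinuousOn u A → (∀ y, u y ≠ 0) → HasLogOn u A := by
  filter_upwards [h.ae_local_injectivity (h.ae_goodPt hγ hf)] with c hc A hA hAc u hu hu0
  obtain ⟨hfin, hinj⟩ := hc
  have hval : Continuous fun y : A => ψ y := hψ.comp continuous_subtype_val
  have hvali : Function.Injective fun y : A => ψ y := hψi.comp Subtype.val_injective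
  have := isCompact_iff_compactSpace.1 hA.isCompact
  obtain ⟨l, hl, hlu⟩ := hasLogOn_univ_of_local_injectivity (Y := A)
    (g := fun y => (h.fK (ψ y)).im) (u := A.domRestrict u)
    (Complex.continuous_im.comp (h.continuous_fK.comp hval))
    (continuousOn_iff_continuous_domRestrict.1 hu) (fun y => hu0 y)
    (fun t => ((hfin ⟨c, t⟩ rfl).preimage hvali.injOn).subset fun y hy =>
      Complex.ext (hAc y y.2) hy)
    fun y => by
      have := ((hval.prodMap hval).tendsto (y, y)).eventually (hinj (ψ y) (hAc y y.2))
      filter_upwards [this] with q hq him hle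
      exact hvali (hq (Complex.ext ((hAc _ q.1.2).trans (hAc _ q.2.2).symm) him)
        (hAc _ q.1.2) hle)
  classical
  refine ⟨fun y => if hy : y ∈ A then l ⟨y, hy⟩ else 0, ?_, fun y hy => ?_⟩
  · rw [continuousOn_iff_continuous_domRestrict]
    refine (continuousOn_univ.1 hl).congr fun y => ?_
    simp
  · simp only [dif_pos hy]
    exact hlu ⟨y, hy⟩ trivial

section
open Bundle

variable {B : Type*} {E : B → Type*} [∀ x, AddCommGroup (E x)]
  [TopologicalSpace (TotalSpace ℂ E)]

/-- A nonvanishing section over a closed set exists as soon as one exists over each of its closed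
subsets on which a given real function oscillates little. -/
theorem HasSectionOn.of_oscillation_le [TopologicalSpace B] [CompactSpace B] [NormalSpace B]
    [∀ x, TopologicalSpace (E x)] [∀ x, Module ℂ (E x)] [FiberBundle ℂ E] [VectorBundle ℂ ℂ E]
    {φ : B → ℝ} (hφ : Continuous φ)
    (hlevel : ∀ᵐ c : ℝ, ∀ A : Set B, IsClosed A → (∀ y ∈ A, φ y = c) → ∀ u : B → ℂ,
      ContinuousOn u A → (∀ y, u y ≠ 0) → HasLogOn u A) {Y : Set B} (hY : IsClosed Y) {ε : ℝ}
    (hε : 0 < ε) (h : ∀ Y' ⊆ Y, IsClosed Y' → (∀ x ∈ Y', ∀ y ∈ Y', |φ x - φ y| ≤ ε) →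
      HasSectionOn E Y') : HasSectionOn E Y := by
  obtain ⟨m, hm⟩ := (isCompact_range hφ).bddBelow
  obtain ⟨M, hM⟩ := (isCompact_range hφ).bddAbove
  have hdense := Measure.dense_of_ae hlevel
  have hle : ∀ c, IsClosed (Y ∩ {y | φ y ≤ c}) := fun c =>
    hY.inter (isClosed_le hφ continuous_const)
  have hstep : ∀ n : ℕ, ∃ c, m + n * (ε / 2) < c ∧
      (∀ A : Set B, IsClosed A → (∀ y ∈ A, φ y = c) → ∀ u : B → ℂ,
        ContinuousOn u A → (∀ y, u y ≠ 0) → HasLogOn u A) ∧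
      HasSectionOn E (Y ∩ {y | φ y ≤ c}) := fun n => by
    induction n with
    | zero =>
      obtain ⟨c, hc, hmc, hcm⟩ := hdense.exists_between (show m < m + ε by linarith)
      refine ⟨c, by simpa using hmc, hc, h _ inter_subset_left (hle c) ?_⟩
      rintro x ⟨_, hx⟩ y ⟨_, hy⟩
      have hx' : φ x ≤ c := hx
      have hy' : φ y ≤ c := hy
      have h1 := hm ⟨x, rfl⟩
      have h2 := hm ⟨y, rfl⟩
      exact abs_le.2 ⟨by linarith, by linarith⟩
    | succ n ih =>
      obtain ⟨c, hnc, hc, hs⟩ := ih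
      obtain ⟨c', hc', hcc, hcc'⟩ := hdense.exists_between (show c + ε / 2 < c + ε by linarith)
      refine ⟨c', by push_cast; linarith, hc', ?_⟩
      have hsl : IsClosed (Y ∩ {y | c ≤ φ y} ∩ {y | φ y ≤ c'}) :=
        (hY.inter (isClosed_le continuous_const hφ)).inter (isClosed_le hφ continuous_const)
      have hs' : HasSectionOn E (Y ∩ {y | c ≤ φ y} ∩ {y | φ y ≤ c'}) := by
        refine h _ (inter_subset_left.trans inter_subset_left) hsl ?_
        rintro x ⟨⟨_, hx⟩, hx'⟩ y ⟨⟨_, hy⟩, hy'⟩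
        have h1 : c ≤ φ x := hx
        have h2 : φ x ≤ c' := hx'
        have h3 : c ≤ φ y := hy
        have h4 : φ y ≤ c' := hy'
        exact abs_le.2 ⟨by linarith, by linarith⟩
      refine (hs.union hs' (hle c) hsl fun u hu hu0 => hc _ ((hle c).inter hsl)
        (fun y hy => le_antisymm hy.1.2 hy.2.1.2) u hu hu0).mono ?_
      rintro y ⟨hyY, hy⟩
      rcases le_total (φ y) c with hyc | hyc
      · exact .inl ⟨hyY, hyc⟩
      · exact .inr ⟨⟨hyY, hyc⟩, hy⟩
  obtain ⟨n, hn⟩ := exists_nat_gt ((M - m) / (ε / 2))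
  rw [div_lt_iff₀ (half_pos hε)] at hn
  obtain ⟨c, hnc, -, hs⟩ := hstep n
  refine hs.mono fun y hy => ⟨hy, ?_⟩
  have h1 : φ y ≤ M := hM ⟨y, rfl⟩
  change φ y ≤ c
  linarith

/-- If the nonvanishing functions on almost all level sets of coordinate functions have
logarithms, every line bundle has a nonvanishing section. -/
theorem hasSectionOn_univ_of_levels [MetricSpace B] [CompactSpace B]
    [∀ x, TopologicalSpace (E x)] [∀ x, Module ℂ (E x)] [FiberBundle ℂ E] [VectorBundle ℂ ℂ E]
    {ι : Type*} [Fintype ι] {φ : ι → B → ℝ} (hφ : ∀ i, Continuous (φ i)) {C : ℝ}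
    (hC : 0 < C) (hdist : ∀ ε x y, (∀ i, |φ i x - φ i y| ≤ ε) → dist x y ≤ C * ε)
    (hlevel : ∀ i, ∀ᵐ c : ℝ, ∀ A : Set B, IsClosed A → (∀ y ∈ A, φ i y = c) → ∀ u : B → ℂ,
      ContinuousOn u A → (∀ y, u y ≠ 0) → HasLogOn u A) : HasSectionOn E univ := by
  classical
  obtain ⟨δ, hδ, hball⟩ := lebesgue_number_lemma_of_metric (s := (univ : Set B))
    (c := fun x : B => (trivializationAt ℂ E x).baseSet) isCompact_univ
    (fun x => (trivializationAt ℂ E x).open_baseSet)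
    fun x _ => mem_iUnion.2 ⟨x, FiberBundle.mem_baseSet_trivializationAt' x⟩
  have hε : 0 < δ / (2 * C) := by positivity
  have hCε : C * (δ / (2 * C)) < δ := by
    rw [mul_div_assoc', mul_comm 2 C, mul_div_mul_left _ _ hC.ne']
    exact half_lt_self hδ
  have key : ∀ s : Finset ι, ∀ Y : Set B, IsClosed Y →
      (∀ i ∉ s, ∀ x ∈ Y, ∀ y ∈ Y, |φ i x - φ i y| ≤ δ / (2 * C)) → HasSectionOn E Y := fun s => by
    induction s using Finset.induction_on with
    | empty =>
      intro Y _ h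
      rcases Y.eq_empty_or_nonempty with rfl | ⟨x, hx⟩
      · choose t ht using exists_fiber_ne_zero (E := E)
        exact ⟨t, continuousOn_empty _, ht⟩
      · obtain ⟨x', hx'⟩ := hball x trivial
        exact (hasSectionOn_baseSet x').mono fun y hy => hx' (mem_ball.2
          ((hdist _ y x fun i => h i (Finset.notMem_empty i) y hy x hx).trans_lt hCε))
    | insert i s _ ih =>
      intro Y hY h
      refine HasSectionOn.of_oscillation_le (hφ i) (hlevel i) hY hε fun Y' hY' hY'c hosc =>
        ih Y' hY'c fun j hj x hx y hy => ?_
      by_cases hji : j = i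
      · exact hji ▸ hosc x hx y hy
      · exact h j (by simp [hji, hj]) x (hY' hx) y (hY' hy)
  exact key Finset.univ univ isClosed_univ fun i hi => absurd (Finset.mem_univ i) hi

end

theorem mem_polyHull_iff_mem_hullPts {n : ℕ} {T : Type*} [TopologicalSpace T] [CompactSpace T]
    [Nonempty T] {γ : T → EuclideanSpace ℂ (Fin n)} (hγ : Continuous γ)
    {z : EuclideanSpace ℂ (Fin n)} :
    z ∈ polyHull (range γ) ↔ (fun i => z i) ∈ hullPts fun s i => γ s i := by
  refine forall_congr' fun p => ?_
  have hc : Continuous fun s => ‖MvPolynomial.eval (fun i => γ s i) p‖ :=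
    (continuous_eval_comp (γ := fun s i => γ s i)
      ((PiLp.continuous_ofLp 2 _).comp hγ) p).norm
  rw [← range_comp]
  change _ ≤ sSup (range fun s => ‖MvPolynomial.eval (fun i => γ s i) p‖) ↔ _
  constructor
  · intro hz
    obtain ⟨s, hs⟩ := (isCompact_range hc).sSup_mem (range_nonempty _)
    exact ⟨s, hz.trans hs.ge⟩
  · rintro ⟨s, hs⟩
    exact hs.trans (le_csSup (isCompact_range hc).bddAbove ⟨s, rfl⟩)

theorem EuclideanSpace.dist_le_of_abs_re_le_of_abs_im_le {ε : ℝ} {z w : EuclideanSpace ℂ (Fin 4)}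
    (hre : ∀ i, |(z i).re - (w i).re| ≤ ε) (him : ∀ i, |(z i).im - (w i).im| ≤ ε) :
    dist z w ≤ 4 * ε := by
  have hε : 0 ≤ ε := (abs_nonneg _).trans (hre 0)
  rw [EuclideanSpace.dist_eq]
  refine Real.sqrt_le_iff.2 ⟨by positivity, ?_⟩
  have h : ∀ i, dist (z i) (w i) ^ 2 ≤ (2 * ε) ^ 2 := fun i => by
    refine pow_le_pow_left₀ dist_nonneg ?_ 2
    rw [dist_eq_norm]
    refine (Complex.norm_le_abs_re_add_abs_im _).trans ?_
    rw [Complex.sub_re, Complex.sub_im, two_mul]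
    exact add_le_add (hre i) (him i)
  refine (Finset.sum_le_sum fun i _ => h i).trans ?_
  rw [Finset.sum_const, Finset.card_univ, Fintype.card_fin, nsmul_eq_mul]
  push_cast
  nlinarith

/-! **Statement 9.**
Let `S ⊂ M₂(ℂ) ≅ ℂ⁴` be a continuum (compact connected set) of finite one-dimensional
Hausdorff measure each of whose points is a rank-one idempotent matrix.  Then every
complex line bundle over the polynomially convex hull `Ŝ` of `S` is trivial. -/

theorem line_bundle_over_hull_of_idempotent_continuum_is_trivial
    (S : Set (EuclideanSpace ℂ (Fin 4))) (hSc : IsCompact S) (hSconn : IsConnected S)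
    (hlen : μH[1] S < ⊤) (hidem : ∀ z ∈ S, IsRankOneIdem z) :
    ∀ L : LineBundle (polyHull S), L.IsTrivial := by
  intro L
  obtain ⟨C, γ₀, hγ₀, himage, -⟩ := hSc.exists_lipschitz_parametrization hSconn hlen
  set γ₁ : Icc (0 : ℝ) 1 → EuclideanSpace ℂ (Fin 4) := fun s => γ₀ s with hγ₁
  have hγ₁l : LipschitzWith C γ₁ := mul_one C ▸ hγ₀.comp (LipschitzWith.subtype_val _)
  have hrange : range γ₁ = S := by rw [← himage, image_eq_range]
  set γ : Icc (0 : ℝ) 1 → Fin 4 → ℂ := fun s i => γ₁ s i with hγdef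
  have hγ : LipschitzWith C γ :=
    one_mul C ▸ (PiLp.lipschitzWith_ofLp 2 fun _ : Fin 4 => ℂ).comp hγ₁l
  have hmem : ∀ z, z ∈ polyHull S ↔ (fun i => z i) ∈ hullPts γ := fun z => by
    rw [← hrange]
    exact mem_polyHull_iff_mem_hullPts hγ₁l.continuous
  set ψ : polyHull S → hullPts γ := fun z => ⟨fun i => (z : EuclideanSpace ℂ (Fin 4)) i,
    (hmem z).1 z.2⟩ with hψdef
  have hψ : Continuous ψ :=
    ((PiLp.continuous_ofLp 2 _).comp continuous_subtype_val).subtype_mk _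
  have hψi : Function.Injective ψ := fun z w hzw => by
    refine Subtype.ext (PiLp.ext fun i => ?_)
    exact congrFun (congrArg Subtype.val hzw) i
  have hcompact : CompactSpace (polyHull S) := by
    rw [← isCompact_iff_compactSpace]
    have hpre : polyHull S = (PiLp.homeomorph 2 fun _ : Fin 4 => ℂ) ⁻¹' hullPts γ := by
      ext z
      exact hmem z
    rw [hpre, Homeomorph.isCompact_preimage]
    exact isCompact_hullPts hγ.continuous
  choose μ hprob hrepr using fun x : hullPts γ =>
    exists_representing_measure hγ.continuous x.2
  have hlevel : ∀ (w : ℂ) (i : Fin 4), ∀ᵐ c : ℝ, ∀ A : Set (polyHull S), IsClosed A →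
      (∀ z ∈ A, (w * (z : EuclideanSpace ℂ (Fin 4)) i).re = c) → ∀ u : polyHull S → ℂ,
      ContinuousOn u A → (∀ y, u y ≠ 0) → HasLogOn u A := fun w i => by
    set h : HullData (Icc (0 : ℝ) 1) (Fin 4) :=
      ⟨γ, hγ.continuous, μ, hprob, hrepr, MvPolynomial.C w * MvPolynomial.X i⟩
    have hf : LipschitzWith (‖w‖₊ * (1 * C)) h.fγ := by
      have h1 : h.fγ = fun s => w • γ s i := by
        ext s
        simp [HullData.fγ, h]
      rw [h1]
      exact (lipschitzWith_smul w).comp ((LipschitzWith.eval i).comp hγ)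
    have h2 : ∀ z, h.fK (ψ z) = w * (z : EuclideanSpace ℂ (Fin 4)) i := fun z => by
      simp [HullData.fK, h, ψ]
    simpa only [h2] using h.ae_hasLogOn_of_subset_level hγ hf hψ hψi
  have hcoord : ∀ i, Continuous fun z : polyHull S => (z : EuclideanSpace ℂ (Fin 4)) i := fun i =>
    (continuous_apply i).comp ((PiLp.continuous_ofLp 2 _).comp continuous_subtype_val)
  refine LineBundle.isTrivial_of_hasSectionOn_univ (hasSectionOn_univ_of_levels
    (φ := fun (j : Bool × Fin 4) z =>
      (bif j.1 then 1 else -Complex.I) * (z : EuclideanSpace ℂ (Fin 4)) j.2 |>.re)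
    (fun j => Complex.continuous_re.comp (continuous_const.mul (hcoord j.2))) four_pos
    (fun ε z w hzw => ?_) fun j => hlevel _ j.2)
  exact EuclideanSpace.dist_le_of_abs_re_le_of_abs_im_le
    (fun i => by simpa using hzw (true, i)) fun i => by simpa using hzw (false, i)
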